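/- Assume P is a uniformly elliptic i.i.d. probability measure on Ω satisfying condition (𝒫) (with d ≥ 4). Fix z₁ ∈ ℤ^d and N ∈ ℕ, and let z ∈ 𝒫̃(z₁,N). Then for all large enough N there is a constant C < ∞ (depending only on P) such that: (1) for every m ∈ ℕ and every x ∈ ∂⁺𝒫(z₁,N), ℙ^z(T_{∂𝒫(z₁,N)} = m, X_{T_{∂𝒫(z₁,N)}} = x) < C N^{−d}; (2) for every m ∈ ℕ and every x, y ∈ ∂⁺𝒫(z₁,N) with ‖x−y‖₁ = 1, |ℙ^z(T_{∂𝒫(z₁,N)} = m, X_{T_{∂𝒫(z₁,N)}} = x) − ℙ^z(T_{∂𝒫(z₁,N)} = m+1, X_{T_{∂𝒫(z₁,N)}} = y)| < C N^{−d−1}; (3) for every m ∈ ℕ, every x ∈ ∂⁺𝒫(z₁,N) and every 1 ≤ j ≤ d, |ℙ^z(T_{∂𝒫(z₁,N)} = m, X_{T_{∂𝒫(z₁,N)}} = x) − ℙ^{z+e_j}(T_{∂𝒫(z₁,N)} = m+1, X_{T_{∂𝒫(z₁,N)}} = x)| < C N^{−d−1}. -/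

import Mathlib

open MeasureTheory Filter
open scoped ENNReal

noncomputable section

namespace RWRE

/-- sites of the lattice `ℤ^d`. -/
abbrev Site (d : ℕ) := Fin d → ℤ

/-- index set for the `2d` nearest-neighbour steps: `(i, true) ↦ e_i`, `(i, false) ↦ -e_i`. -/
abbrev StepIdx (d : ℕ) := Fin d × Bool

/-- the signed unit vector corresponding to a step index. -/
def stepVec {d : ℕ} (s : StepIdx d) : Site d :=
  fun j => if j = s.1 then (if s.2 then 1 else -1) else 0

/-- probability vectors on the `2d` nearest-neighbour steps. -/
abbrev EnvAt (d : ℕ) := {p : StepIdx d → ℝ // (∀ s, 0 ≤ p s) ∧ ∑ s, p s = 1}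

/-- the space of environments `Ω = (M_d)^{ℤ^d}`. -/
abbrev Env (d : ℕ) := Site d → EnvAt d

/-- the space of trajectories. -/
abbrev Path (d : ℕ) := ℕ → Site d

/-- the shift of the environment by `x`. -/
def shift {d : ℕ} (x : Site d) (ω : Env d) : Env d := fun y => ω (x + y)

/-- transition probability in environment `ω` from site `y` by increment `v`. -/
def envP {d : ℕ} (ω : Env d) (y v : Site d) : ℝ≥0∞ :=
  ∑ s : StepIdx d, if v = stepVec s then ENNReal.ofReal ((ω y).1 s) else 0

/-- `μ` is the quenched law of the walk started at `x` in the environment `ω`: a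
probability measure on path space whose cylinder probabilities are the products of
the transition probabilities of `ω`. -/
def IsQuenched {d : ℕ} (ω : Env d) (x : Site d) (μ : Measure (Path d)) : Prop :=
  IsProbabilityMeasure μ ∧
    ∀ (n : ℕ) (γ : ℕ → Site d),
      μ {f | ∀ i ≤ n, f i = γ i} =
        (if γ 0 = x then 1 else 0) *
          ∏ i ∈ Finset.range n, envP ω (γ i) (γ (i + 1) - γ i)

/-- `Pq` is a measurable family of quenched laws. -/
def IsQuenchedFamily {d : ℕ} (Pq : Env d → Site d → Measure (Path d)) : Prop :=
  (∀ ω x, IsQuenched ω x (Pq ω x)) ∧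
    ∀ (x : Site d) (A : Set (Path d)), MeasurableSet A →
      Measurable fun ω => Pq ω x A

/-- the annealed probability `ℙ^x(A) = ∫ P_ω^x(A) dP(ω)` of a path event. -/
def ann {d : ℕ} (P : Measure (Env d)) (Pq : Env d → Site d → Measure (Path d))
    (x : Site d) (A : Set (Path d)) : ℝ≥0∞ :=
  ∫⁻ ω, Pq ω x A ∂P

/-- the annealed expectation `𝔼^x[g]` of a real path functional. -/
def annE {d : ℕ} (P : Measure (Env d)) (Pq : Env d → Site d → Measure (Path d))
    (x : Site d) (g : Path d → ℝ) : ℝ :=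
  ∫ ω, (∫ f, g f ∂(Pq ω x)) ∂P

/-- `P` is an i.i.d. measure on the space of environments: its finite-dimensional
marginals are products of a fixed single-site probability measure. -/
def IsIID {d : ℕ} (P : Measure (Env d)) : Prop :=
  ∃ ν : Measure (EnvAt d), IsProbabilityMeasure ν ∧
    ∀ (s : Finset (Site d)) (B : Site d → Set (EnvAt d)),
      (∀ x, MeasurableSet (B x)) →
        P {ω | ∀ x ∈ s, ω x ∈ B x} = ∏ x ∈ s, ν (B x)

/-- uniform ellipticity of `P`. -/
def UniformlyElliptic {d : ℕ} (P : Measure (Env d)) : Prop :=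
  ∃ η : ℝ, 0 < η ∧ ∀ s : StepIdx d, P {ω : Env d | (ω 0).1 s < η} = 0

/-- a lattice point, viewed as a real vector. -/
def toR {d : ℕ} (x : Site d) : Fin d → ℝ := fun i => (x i : ℝ)

/-- inner product of a lattice point with a real direction. -/
def dotR {d : ℕ} (x : Site d) (ℓ : Fin d → ℝ) : ℝ := ∑ i, (x i : ℝ) * ℓ i

/-- the euclidean norm of a real vector. -/
def norm2R {d : ℕ} (ℓ : Fin d → ℝ) : ℝ := Real.sqrt (∑ i, ℓ i ^ 2)

/-- the event `{T_L^{(-ℓ)} < T_L^{(ℓ)}}` that the walk reaches level `L` in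
direction `-ℓ` strictly before reaching level `L` in direction `ℓ`. -/
def backtrackEvent {d : ℕ} (ℓ : Fin d → ℝ) (L : ℝ) : Set (Path d) :=
  {f | ∃ n, L ≤ dotR (f n) (-ℓ) ∧ ∀ m ≤ n, dotR (f m) ℓ < L}

/-- condition `(T_γ)` in the direction `ℓ₀`. -/
def CondTAt {d : ℕ} (P : Measure (Env d)) (Pq : Env d → Site d → Measure (Path d))
    (γ : ℝ) (ℓ₀ : Fin d → ℝ) : Prop :=
  ∃ ε : ℝ, 0 < ε ∧ ∀ ℓ : Fin d → ℝ, norm2R ℓ = 1 → norm2R (ℓ - ℓ₀) < ε →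
    ∃ C : ℝ, ∀ L : ℝ, 0 < L →
      ann P Pq 0 (backtrackEvent ℓ L) ≤ ENNReal.ofReal (C * Real.exp (-(L ^ γ)))

/-- condition `(T_γ)` in some direction. -/
def CondT {d : ℕ} (P : Measure (Env d)) (Pq : Env d → Site d → Measure (Path d))
    (γ : ℝ) : Prop :=
  ∃ ℓ₀ : Fin d → ℝ, norm2R ℓ₀ = 1 ∧ CondTAt P Pq γ ℓ₀

/-- condition `(𝒫)`: condition `(T_γ)` holds for some `γ ∈ (0,1)` in some direction. -/
def CondP {d : ℕ} (P : Measure (Env d)) (Pq : Env d → Site d → Measure (Path d)) : Prop :=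
  ∃ γ : ℝ, 0 < γ ∧ γ < 1 ∧ CondT P Pq γ

/-- condition `(𝒫)` in a given direction. -/
def CondPAt {d : ℕ} (P : Measure (Env d)) (Pq : Env d → Site d → Measure (Path d))
    (ℓ₀ : Fin d → ℝ) : Prop :=
  ∃ γ : ℝ, 0 < γ ∧ γ < 1 ∧ CondTAt P Pq γ ℓ₀

/-- `Q` is invariant with respect to the point of view of the particle. -/
def InvariantPOV {d : ℕ} (Q : Measure (Env d)) : Prop :=
  ∀ g : Env d → ℝ, Measurable g → (∃ C : ℝ, ∀ ω, |g ω| ≤ C) →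
    ∫ ω, (∑ s : StepIdx d, (ω 0).1 s * g (shift (stepVec s) ω)) ∂Q = ∫ ω, g ω ∂Q

/-- superpolynomial decay: `g N = N^{-ξ(1)}`. -/
def Superpoly (g : ℕ → ℝ) : Prop :=
  ∀ k : ℕ, Tendsto (fun N : ℕ => (N : ℝ) ^ k * g N) atTop (nhds 0)

/-- the first coordinate `⟨x, e₁⟩` of a lattice point. -/
def firstCoord {d : ℕ} (x : Fin d → ℤ) : ℤ := if h : 0 < d then x ⟨0, h⟩ else 0

/-- the first coordinate `⟨ℓ, e₁⟩` of a real vector. -/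
def firstCoordR {d : ℕ} (ℓ : Fin d → ℝ) : ℝ := if h : 0 < d then ℓ ⟨0, h⟩ else 0

/-- the first standard basis vector, as a real direction. -/
def e1R (d : ℕ) : Fin d → ℝ := fun i => if (i : ℕ) = 0 then 1 else 0

/-- `R_k(N) = ⌊exp((log log N)^{k+1})⌋`. -/
def Rk (k N : ℕ) : ℕ := ⌊Real.exp (Real.log (Real.log (N : ℝ)) ^ (k + 1))⌋₊

/-- the `ℓ¹`-norm of a lattice point. -/
def norm1 {d : ℕ} (x : Site d) : ℤ := ∑ i, |x i|

/-- the parallelogram `𝒫(z,N)` (relative to the asymptotic direction `ϑ`). -/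
def para {d : ℕ} (ϑ : Fin d → ℝ) (z : Site d) (N : ℕ) : Set (Site d) :=
  {x | |firstCoord (x - z)| < (N : ℤ) ^ 2 ∧
    ∀ i, |((x - z) i : ℝ) - (firstCoord (x - z) : ℝ) / firstCoordR ϑ * ϑ i|
      < (N : ℝ) * (Rk 5 N : ℝ)}

/-- the middle third `𝒫̃(z,N)` of the parallelogram. -/
def paraMid {d : ℕ} (ϑ : Fin d → ℝ) (z : Site d) (N : ℕ) : Set (Site d) :=
  {x | 3 * |firstCoord (x - z)| < (N : ℤ) ^ 2 ∧
    ∀ i, 3 * |((x - z) i : ℝ) - (firstCoord (x - z) : ℝ) / firstCoordR ϑ * ϑ i|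
      < (N : ℝ) * (Rk 5 N : ℝ)}

/-- the boundary `∂𝒫(z,N)`. -/
def paraBdry {d : ℕ} (ϑ : Fin d → ℝ) (z : Site d) (N : ℕ) : Set (Site d) :=
  {x | x ∉ para ϑ z N ∧ ∃ y ∈ para ϑ z N, norm1 (x - y) = 1}

/-- the right boundary `∂⁺𝒫(z,N)`. -/
def paraBdryPlus {d : ℕ} (ϑ : Fin d → ℝ) (z : Site d) (N : ℕ) : Set (Site d) :=
  {x | x ∈ paraBdry ϑ z N ∧ firstCoord (x - z) = (N : ℤ) ^ 2}

/-- the walk hits the set `A`. -/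
def hits {d : ℕ} (A : Set (Site d)) (f : Path d) : Prop := ∃ n, f n ∈ A

/-- the hitting time `T_A` of a set of sites. -/
def hitTime {d : ℕ} (A : Set (Site d)) (f : Path d) : ℕ := sInf {n | f n ∈ A}

/-- the hyperplane `H_M = {x : ⟨x,e₁⟩ = M}`. -/
def hyper {d : ℕ} (M : ℤ) : Set (Site d) := {x | firstCoord x = M}

/-- the event that the walk hits `A`, at a time belonging to `I`, and in a point of `Δ`. -/
def exitEvent {d : ℕ} (A Δ : Set (Site d)) (I : Set ℕ) : Set (Path d) :=
  {f | hits A f ∧ f (hitTime A f) ∈ Δ ∧ hitTime A f ∈ I}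

/-- the `d`-dimensional cube with corner `a` and side length `L`. -/
def cube {d : ℕ} (a : Site d) (L : ℕ) : Set (Site d) :=
  {x | ∀ i, a i ≤ x i ∧ x i < a i + (L : ℤ)}

/-- the same cube, as a finite set. -/
def cubeF {d : ℕ} (a : Site d) (L : ℕ) : Finset (Site d) :=
  Fintype.piFinset fun i => Finset.Ico (a i) (a i + (L : ℤ))

/-- a `(d-1)`-dimensional cube of side length `L` inside the hyperplane `H_m`. -/
def cubeHyp {d : ℕ} (m : ℤ) (a : Site d) (L : ℕ) : Set (Site d) :=
  {x | firstCoord x = m ∧ ∀ i : Fin d, (i : ℕ) ≠ 0 → a i ≤ x i ∧ x i < a i + (L : ℤ)}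

/-- the time interval `[t, t + L)`. -/
def interval (t L : ℕ) : Set ℕ := {n | t ≤ n ∧ n < t + L}

/-- `S` is the set of corners of a partition of `ℤ^d` into cubes of side length `L`. -/
def IsCubePartition {d : ℕ} (L : ℕ) (S : Set (Site d)) : Prop :=
  (∀ x : Site d, ∃ a ∈ S, x ∈ cube a L) ∧
    ∀ a ∈ S, ∀ b ∈ S, a ≠ b → Disjoint (cube a L) (cube b L)

/-- `t` is a regeneration time of the path `f` in direction `e₁`. -/
def IsRegen {d : ℕ} (f : Path d) (t : ℕ) : Prop :=
  (∀ s < t, firstCoord (f s) < firstCoord (f t)) ∧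
    firstCoord (f t) < firstCoord (f (t + 1)) ∧
    ∀ s, t + 1 < s → firstCoord (f (t + 1)) < firstCoord (f s)

/-- the `k`-th regeneration time `τ_k` (with the convention `τ₀ = 0`). -/
def regTime {d : ℕ} (f : Path d) : ℕ → ℕ
  | 0 => 0
  | k + 1 => sInf {t | regTime f k < t ∧ IsRegen f t}

/-- the event `B_N` that each of the first `N²` regeneration gaps is at most `R(N)`. -/
def BN {d : ℕ} (N : ℕ) : Set (Path d) :=
  {f | ∀ k, 1 ≤ k → k ≤ N ^ 2 → regTime f k - regTime f (k - 1) ≤ Rk 1 N}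

/-- `ϑ` is the asymptotic direction `lim Xₙ/‖Xₙ‖₂` of the walk, annealed a.s. -/
def DirSpeed {d : ℕ} (P : Measure (Env d)) (Pq : Env d → Site d → Measure (Path d))
    (ϑ : Fin d → ℝ) : Prop :=
  ann P Pq 0 {f | ¬ Tendsto (fun n => fun i => toR (f n) i / norm2R (toR (f n)))
    atTop (nhds ϑ)} = 0

/-- the σ-algebra generated by the environment in the half space `⟨z,e₁⟩ ≤ m`. -/
def sigmaUpTo (d : ℕ) (m : ℤ) : MeasurableSpace (Env d) :=
  MeasurableSpace.comap
    (fun ω => (fun z : {z : Site d // firstCoord z ≤ m} => ω z.1)) inferInstance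

/-! ### Path events determined by an initial segment -/

/-- The path event `S` is determined by the first `n + 1` positions. -/
def DetBy {d : ℕ} (n : ℕ) (S : Set (Path d)) : Prop :=
  ∀ f g : Path d, (∀ i ≤ n, f i = g i) → f ∈ S → g ∈ S

/-- The initial segment of a path. -/
def initSeg {d : ℕ} (n : ℕ) (f : Path d) : Fin (n + 1) → Site d := fun i => f i

lemma measurable_initSeg {d : ℕ} (n : ℕ) : Measurable (initSeg (d := d) n) :=
  measurable_pi_lambda _ fun i => measurable_pi_apply (i : ℕ)

lemma DetBy.preimage {d n : ℕ} {S : Set (Path d)} (hS : DetBy n S) :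
    initSeg n ⁻¹' (initSeg n '' S) = S := by
  refine Set.Subset.antisymm ?_ (Set.subset_preimage_image _ _)
  rintro f ⟨g, hg, hgf⟩
  refine hS g f (fun i hi => ?_) hg
  exact congrFun hgf ⟨i, by omega⟩

lemma DetBy.measurableSet {d n : ℕ} {S : Set (Path d)} (hS : DetBy n S) : MeasurableSet S := by
  rw [← hS.preimage]
  exact measurable_initSeg n (Set.to_countable _).measurableSet

lemma DetBy.mono {d n m : ℕ} {S : Set (Path d)} (hS : DetBy n S) (h : n ≤ m) : DetBy m S :=
  fun f g hfg => hS f g fun i hi => hfg i (hi.trans h)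

lemma DetBy.inter {d n : ℕ} {S S' : Set (Path d)} (hS : DetBy n S) (hS' : DetBy n S') :
    DetBy n (S ∩ S') :=
  fun f g hfg hf => ⟨hS f g hfg hf.1, hS' f g hfg hf.2⟩

lemma detBy_position {d : ℕ} (n : ℕ) (y : Site d) : DetBy n {f : Path d | f n = y} :=
  fun f g hfg hf => by
    have : f n = y := hf
    simpa [hfg n le_rfl] using this

/-- The cylinder of paths which agree with `γ` up to time `n`. -/
def cyl {d : ℕ} (n : ℕ) (γ : Path d) : Set (Path d) := {f | ∀ i ≤ n, f i = γ i}

lemma detBy_cyl {d : ℕ} (n : ℕ) (γ : Path d) : DetBy n (cyl n γ) :=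
  fun _ _ hfg hf i hi => (hfg i hi).symm.trans (hf i hi)

/-- Two measures which agree on the cylinders contained in `S` agree on `S`. -/
lemma DetBy.measure_congr {d n : ℕ} {S : Set (Path d)} (hS : DetBy n S) (μ ν : Measure (Path d))
    (h : ∀ γ ∈ S, μ (cyl n γ) = ν (cyl n γ)) : μ S = ν S := by
  have key : ∀ κ : Measure (Path d),
      κ S = ∑' c : (initSeg n '' S : Set (Fin (n + 1) → Site d)), κ (initSeg n ⁻¹' {c.1}) := by
    intro κ
    conv_lhs => rw [← hS.preimage, ← Set.biUnion_preimage_singleton]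
    rw [measure_biUnion (Set.to_countable _)]
    · intro a _ b _ hab
      exact Disjoint.preimage _ (by simpa using hab)
    · intro c _
      exact measurable_initSeg n (measurableSet_singleton c)
  rw [key μ, key ν]
  refine tsum_congr fun c => ?_
  obtain ⟨c, f, hf, rfl⟩ := c
  have e : initSeg n ⁻¹' {initSeg n f} = cyl n f := by
    ext g
    simp only [Set.mem_preimage, Set.mem_singleton_iff, cyl, Set.mem_ofPred_eq, funext_iff, initSeg]
    exact ⟨fun h i hi => h ⟨i, by omega⟩, fun h i => h i (by omega)⟩
  simp only [e]
  exact h f hf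

lemma generateFrom_detBy {d : ℕ} :
    (inferInstance : MeasurableSpace (Path d)) =
      MeasurableSpace.generateFrom {S | ∃ n, DetBy n S} := by
  refine le_antisymm ?_ ?_
  · refine iSup_le fun n => ?_
    rintro _ ⟨T, -, rfl⟩
    refine MeasurableSpace.measurableSet_generateFrom ⟨n, fun f g hfg hf => ?_⟩
    have : f n ∈ T := hf
    rwa [hfg n le_rfl] at this
  · refine MeasurableSpace.generateFrom_le ?_
    rintro S ⟨n, hS⟩
    exact hS.measurableSet

/-- Finite measures on path space which agree on events of finite horizon are equal. -/
lemma measure_ext_detBy {d : ℕ} (μ ν : Measure (Path d)) [IsFiniteMeasure μ]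
    (h : ∀ n S, DetBy n S → μ S = ν S) : μ = ν := by
  refine ext_of_generate_finite _ generateFrom_detBy ?_ ?_ ?_
  · rintro S ⟨n, hS⟩ T ⟨m, hT⟩ -
    exact ⟨max n m, (hS.mono (le_max_left _ _)).inter (hT.mono (le_max_right _ _))⟩
  · rintro S ⟨n, hS⟩
    exact h n S hS
  · exact h 0 _ fun _ _ _ _ => trivial

/-! ### Quenched laws -/

/-- The path seen from time `n` on. -/
def after {d : ℕ} (n : ℕ) (f : Path d) : Path d := fun k => f (n + k)

/-- The increments of the path seen from time `n` on. -/
def tail {d : ℕ} (n : ℕ) (f : Path d) : Path d := fun k => f (n + k) - f n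

lemma measurable_after {d : ℕ} (n : ℕ) : Measurable (after (d := d) n) :=
  measurable_pi_lambda _ fun k => measurable_pi_apply (n + k)

lemma measurable_tail {d : ℕ} (n : ℕ) : Measurable (tail (d := d) n) :=
  measurable_pi_lambda _ fun k => (measurable_pi_apply (n + k)).sub (measurable_pi_apply n)

variable {d : ℕ} {ω : Env d} {x : Site d} {μ : Measure (Path d)}

lemma IsQuenched.measure_cyl (h : IsQuenched ω x μ) (n : ℕ) (γ : Path d) :
    μ (cyl n γ) = (if γ 0 = x then 1 else 0) *
          ∏ i ∈ Finset.range n, envP ω (γ i) (γ (i + 1) - γ i) := h.2 n γ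

lemma IsQuenched.unique (h : IsQuenched ω x μ) {ν : Measure (Path d)} (h' : IsQuenched ω x ν) :
    μ = ν := by
  have := h.1
  exact measure_ext_detBy _ _ fun n S hS => hS.measure_congr _ _ fun γ _ => by
    rw [h.measure_cyl, h'.measure_cyl]

/-- Translating the path corresponds to shifting the environment. -/
lemma IsQuenched.translate (h : IsQuenched ω x μ) :
    IsQuenched (shift x ω) 0 (μ.map fun f k => f k - x) := by
  have hm : Measurable fun (f : Path d) k => f k - x :=
    measurable_pi_lambda _ fun k => (measurable_pi_apply k).sub_const _
  have := h.1
  refine ⟨Measure.isProbabilityMeasure_map hm.aemeasurable, fun n γ => ?_⟩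
  have hms := (detBy_cyl n γ).measurableSet
  unfold cyl at hms
  rw [Measure.map_apply hm hms]
  have := h.2 n (fun k => γ k + x)
  have e : (fun (f : Path d) k => f k - x) ⁻¹' {f | ∀ i ≤ n, f i = γ i} =
      {f | ∀ i ≤ n, f i = γ i + x} := by
    ext f
    simp [sub_eq_iff_eq_add]
  rw [e, this]
  simp [envP, shift, add_comm x]

/-- The quenched Markov property. -/
lemma IsQuenched.markov {Pω : Site d → Measure (Path d)} (h : ∀ x, IsQuenched ω x (Pω x))
    {n : ℕ} {S : Set (Path d)} (hS : DetBy n S) (x y : Site d) {A : Set (Path d)}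
    (hA : MeasurableSet A) :
    Pω x (S ∩ {f | f n = y} ∩ after n ⁻¹' A) = Pω x (S ∩ {f | f n = y}) * Pω y A := by
  have hp : ∀ x, IsProbabilityMeasure (Pω x) := fun x => (h x).1
  set S' := S ∩ {f | f n = y}
  have hS' : DetBy n S' := hS.inter (detBy_position n y)
  have hms := hS'.measurableSet
  suffices H : ((Pω x).restrict S').map (after n) = (Pω x S') • Pω y by
    have := congrArg (fun κ => κ A) H
    simp only [Measure.map_apply (measurable_after n) hA, Measure.smul_apply, smul_eq_mul] at this
    rw [Measure.restrict_apply (measurable_after n hA), Set.inter_comm] at this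
    exact this
  have hfin : IsFiniteMeasure (((Pω x).restrict S').map (after n)) := by
    infer_instance
  refine measure_ext_detBy _ _ fun m T hT => hT.measure_congr _ _ fun δ _ => ?_
  have hcm := (detBy_cyl m δ).measurableSet
  rw [Measure.map_apply (measurable_after n) hcm,
    Measure.restrict_apply (measurable_after n hcm), Measure.smul_apply, smul_eq_mul,
    Set.inter_comm]
  have hmul : Pω x S' * Pω y (cyl m δ) = ((Pω y (cyl m δ)) • Pω x) S' := by
    rw [Measure.smul_apply, smul_eq_mul, mul_comm]
  rw [hmul, ← Measure.restrict_apply' (measurable_after n hcm)]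
  refine hS'.measure_congr _ _ fun γ hγ => ?_
  rw [Measure.restrict_apply' (measurable_after n hcm), Measure.smul_apply, smul_eq_mul,
    (h y).measure_cyl, (h x).measure_cyl]
  have hγn : γ n = y := hγ.2
  by_cases hδ : δ 0 = y
  · have e : cyl n γ ∩ after n ⁻¹' cyl m δ =
        cyl (n + m) (fun i => if i ≤ n then γ i else δ (i - n)) := by
      ext f
      simp only [cyl, after, Set.mem_inter_iff, Set.mem_preimage, Set.mem_ofPred_eq]
      constructor
      · rintro ⟨h1, h2⟩ i hi
        split_ifs with hin
        · exact h1 i hin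
        · have := h2 (i - n) (by omega)
          rwa [show n + (i - n) = i by omega] at this
      · intro h1
        refine ⟨fun i hi => by simpa [hi] using h1 i (by omega), fun i hi => ?_⟩
        have := h1 (n + i) (by omega)
        rw [this]
        split_ifs with hin
        · obtain rfl : i = 0 := by omega
          simp [hγn, hδ]
        · simp
    rw [e, (h x).measure_cyl, Finset.prod_range_add]
    have e1 : ∀ i ∈ Finset.range n, envP ω (if i ≤ n then γ i else δ (i - n))
        ((if i + 1 ≤ n then γ (i + 1) else δ (i + 1 - n)) - if i ≤ n then γ i else δ (i - n)) =
        envP ω (γ i) (γ (i + 1) - γ i) := by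
      intro i hi
      rw [Finset.mem_range] at hi
      simp [hi.le, Nat.succ_le_of_lt hi]
    have e2 : ∀ i ∈ Finset.range m, envP ω (if n + i ≤ n then γ (n + i) else δ (n + i - n))
        ((if n + i + 1 ≤ n then γ (n + i + 1) else δ (n + i + 1 - n)) -
          if n + i ≤ n then γ (n + i) else δ (n + i - n)) =
        envP ω (δ i) (δ (i + 1) - δ i) := by
      intro i _
      have : (if n + i ≤ n then γ (n + i) else δ (n + i - n)) = δ i := by
        split_ifs with hin
        · obtain rfl : i = 0 := by omega
          simp [hγn, hδ]
        · simp
      rw [this, if_neg (by omega), show n + i + 1 - n = i + 1 by omega]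
    rw [Finset.prod_congr rfl e1, Finset.prod_congr rfl e2]
    simp [hδ]
    ring_nf
  · have e : cyl n γ ∩ after n ⁻¹' cyl m δ = ∅ := by
      ext f
      simp only [cyl, after, Set.mem_inter_iff, Set.mem_preimage, Set.mem_ofPred_eq,
        Set.mem_empty_iff_false, iff_false, not_and]
      intro h1 h2
      have := h2 0 (by omega)
      rw [add_zero, h1 n le_rfl, hγn] at this
      exact hδ this.symm
    rw [e]
    simp [hδ]

/-- An event in which the walk departs only from sites of `B` before time `n` has a quenched
probability depending only on the environment in `B`. -/
lemma IsQuenched.congr_detBy {ω' : Env d} {B : Set (Site d)} (hB : ∀ z ∈ B, ω z = ω' z)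
    {ν : Measure (Path d)} (h : IsQuenched ω x μ) (h' : IsQuenched ω' x ν) {n : ℕ}
    {S : Set (Path d)} (hS : DetBy n S) (hSB : ∀ f ∈ S, ∀ i < n, f i ∈ B) : μ S = ν S := by
  refine hS.measure_congr _ _ fun γ hγ => ?_
  rw [h.measure_cyl, h'.measure_cyl]
  congr 1
  refine Finset.prod_congr rfl fun i hi => ?_
  rw [envP, envP, hB _ (hSB γ hγ i (Finset.mem_range.1 hi))]

/-- An event in which the walk stays in `B` has a quenched probability depending only on the
environment in `B`. -/
lemma IsQuenched.congr_stay {ω' : Env d} {B : Set (Site d)} (hB : ∀ z ∈ B, ω z = ω' z)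
    {ν : Measure (Path d)} (h : IsQuenched ω x μ) (h' : IsQuenched ω' x ν)
    {A : Set (Path d)} (hA : MeasurableSet A) (hAB : ∀ f ∈ A, ∀ i, f i ∈ B) : μ A = ν A := by
  have := h.1
  have := h'.1
  set stay : ℕ → Set (Path d) := fun n => {f | ∀ i ≤ n, f i ∈ B}
  have hst : ∀ n, DetBy n (stay n) := fun n f g hfg hf i hi => hfg i hi ▸ hf i hi
  have hmst : MeasurableSet (⋂ n, stay n) := MeasurableSet.iInter fun n => (hst n).measurableSet
  have H : μ.restrict (⋂ n, stay n) = ν.restrict (⋂ n, stay n) := by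
    refine measure_ext_detBy _ _ fun m S hS => ?_
    rw [Measure.restrict_apply hS.measurableSet, Measure.restrict_apply hS.measurableSet,
      Set.inter_iInter]
    have hanti : Antitone fun n => S ∩ stay n := fun n n' hn f hf =>
      ⟨hf.1, fun i hi => hf.2 i (hi.trans hn)⟩
    have lim : ∀ κ : Measure (Path d), IsProbabilityMeasure κ →
        Tendsto (fun n => κ (S ∩ stay n)) atTop (nhds (κ (⋂ n, S ∩ stay n))) := fun κ hκ =>
      tendsto_measure_iInter_atTop
        (fun n => (hS.measurableSet.inter (hst n).measurableSet).nullMeasurableSet) hanti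
        ⟨0, measure_ne_top _ _⟩
    refine tendsto_nhds_unique (lim μ inferInstance) ((lim ν inferInstance).congr' ?_)
    filter_upwards [eventually_ge_atTop m] with n hn
    exact (h.congr_detBy hB h' ((hS.mono hn).inter (hst n)) fun f hf i hi => hf.2 i hi.le).symm
  have hsub : A ⊆ ⋂ n, stay n := fun f hf => Set.mem_iInter.2 fun n i _ => hAB f hf i
  have := congrArg (fun κ => κ A) H
  simpa [Measure.restrict_apply hA, Set.inter_eq_left.2 hsub] using this

/-! ### The annealed law -/

/-- The level of a site in the direction of the integer vector `u`. -/
def lev {d : ℕ} (u x : Site d) : ℤ := ∑ i, u i * x i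

/-- The properties of the annealed law, started at the origin, used below. -/
structure IsAnnealed {d : ℕ} (μ : Measure (Path d)) (η : ℝ≥0∞) : Prop where
  prob : IsProbabilityMeasure μ
  start : ∀ᵐ f ∂μ, f 0 = 0
  steps : ∀ᵐ f ∂μ, ∀ n, ∃ s, f (n + 1) = f n + stepVec s
  markov_le : ∀ (S : ℕ → Set (Path d)), (∀ n, DetBy n (S n)) → Pairwise (Function.onFun Disjoint S) →
    ∀ (y : Site d) (A : Set (Path d)), MeasurableSet A →
      μ {f | ∃ n, f ∈ S n ∧ f n = y ∧ tail n f ∈ A} ≤ μ A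
  fresh : ∀ (u : Site d) (n : ℕ) (S : Set (Path d)), DetBy n S →
    (∀ f ∈ S, ∀ i < n, lev u (f i) < lev u (f n)) → ∀ A : Set (Path d), MeasurableSet A →
      (∀ f ∈ A, ∀ k, 0 ≤ lev u (f k)) → μ (S ∩ tail n ⁻¹' A) = μ S * μ A
  pos : 0 < η
  ellip : ∀ (n : ℕ) (S : Set (Path d)), DetBy n S → ∀ s : StepIdx d,
    η * μ S ≤ μ (S ∩ {f | f (n + 1) = f n + stepVec s})
  first_step : ∀ (s : StepIdx d) (A : Set (Path d)), MeasurableSet A →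
    η * μ A ≤ μ ({f | f 1 = f 0 + stepVec s} ∩ tail 1 ⁻¹' A)

/-- The annealed law of the walk started at `x`. -/
def annLaw {d : ℕ} (P : Measure (Env d)) (Pq : Env d → Site d → Measure (Path d)) (x : Site d) :
    Measure (Path d) := P.bind fun ω => Pq ω x

section
variable {d : ℕ} {P : Measure (Env d)} {Pq : Env d → Site d → Measure (Path d)}

lemma IsQuenchedFamily.measurable (hPq : IsQuenchedFamily Pq) (x : Site d) :
    Measurable fun ω => Pq ω x :=
  Measure.measurable_of_measurable_coe _ fun A hA => hPq.2 x A hA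

lemma annLaw_apply (hPq : IsQuenchedFamily Pq) (x : Site d) {A : Set (Path d)}
    (hA : MeasurableSet A) : annLaw P Pq x A = ∫⁻ ω, Pq ω x A ∂P :=
  Measure.bind_apply hA (hPq.measurable x).aemeasurable

lemma ann_eq_annLaw (hPq : IsQuenchedFamily Pq) (x : Site d) {A : Set (Path d)}
    (hA : MeasurableSet A) : ann P Pq x A = annLaw P Pq x A :=
  (annLaw_apply hPq x hA).symm

lemma IsQuenchedFamily.prob (hPq : IsQuenchedFamily Pq) (ω : Env d) (x : Site d) :
    IsProbabilityMeasure (Pq ω x) := (hPq.1 ω x).1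

lemma isProbabilityMeasure_annLaw [IsProbabilityMeasure P] (hPq : IsQuenchedFamily Pq)
    (x : Site d) : IsProbabilityMeasure (annLaw P Pq x) := by
  refine ⟨?_⟩
  rw [annLaw_apply hPq x MeasurableSet.univ]
  have := hPq.prob
  simp

lemma IsQuenched.start_ae {ω : Env d} {x : Site d} {μ : Measure (Path d)}
    (h : IsQuenched ω x μ) : μ {f | f 0 = x} = 1 := by
  have := h.2 0 (fun _ => x)
  simpa using this

lemma measurable_shift (x : Site d) : Measurable (shift x) :=
  measurable_pi_lambda _ fun y => measurable_pi_apply (x + y)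

/-- An i.i.d. environment law is shift-invariant. -/
lemma IsIID.map_shift (h : IsIID P) (x : Site d) : P.map (shift x) = P := by
  obtain ⟨ν, hν, h⟩ := h
  have h1 : P = Measure.infinitePi fun _ => ν := Measure.eq_infinitePi _ fun s t ht => h s t ht
  conv_rhs => rw [h1]
  have hm := measurable_shift x
  refine Measure.eq_infinitePi _ fun s t ht => ?_
  rw [Measure.map_apply hm (MeasurableSet.pi (Set.to_countable _) fun i _ => ht i)]
  have := h (s.image (x + ·)) (fun y => t (y - x)) fun y => ht _
  rw [Finset.prod_image (fun a _ b _ hab => by simpa using hab)] at this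
  simp only [add_sub_cancel_left] at this
  rw [← this]
  congr 1
  ext ω
  simp only [shift, Set.mem_preimage, Set.mem_pi, Finset.mem_coe, Set.mem_ofPred_eq,
    Finset.forall_mem_image, add_sub_cancel_left]

open Classical in
/-- The environment equal to `p.1` in `B` and to `p.2` outside of `B`. -/
def glue (B : Set (Site d)) (p : Env d × Env d) : Env d :=
  fun x => if x ∈ B then p.1 x else p.2 x

lemma measurable_glue (B : Set (Site d)) : Measurable (glue B) := by
  refine measurable_pi_lambda _ fun x => ?_
  unfold glue
  by_cases hx : x ∈ B
  · simpa [hx] using measurable_fst.eval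
  · simpa [hx] using measurable_snd.eval

lemma IsIID.map_glue [IsProbabilityMeasure P] (h : IsIID P) (B : Set (Site d)) :
    (P.prod P).map (glue B) = P := by
  classical
  obtain ⟨ν, hν, h⟩ := h
  have h1 : P = Measure.infinitePi fun _ => ν := Measure.eq_infinitePi _ fun s t ht => h s t ht
  conv_rhs => rw [h1]
  refine Measure.eq_infinitePi _ fun s t ht => ?_
  rw [Measure.map_apply (measurable_glue B)
    (MeasurableSet.pi (Set.to_countable _) fun i _ => ht i)]
  have e : glue B ⁻¹' (Set.pi s t) =
      {ω | ∀ x ∈ s.filter (· ∈ B), ω x ∈ t x} ×ˢ {ω | ∀ x ∈ s.filter (· ∉ B), ω x ∈ t x} := by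
    ext p
    simp only [glue, Set.mem_preimage, Set.mem_pi, Finset.mem_coe, Set.mem_prod,
      Set.mem_ofPred_eq, Finset.mem_filter, and_imp]
    constructor
    · intro hp
      exact ⟨fun x hx hB => by simpa [hB] using hp x hx,
        fun x hx hB => by simpa [hB] using hp x hx⟩
    · rintro ⟨h1, h2⟩ x hx
      by_cases hB : x ∈ B
      · simpa [hB] using h1 x hx hB
      · simpa [hB] using h2 x hx hB
  rw [e, Measure.prod_prod, h _ _ ht, h _ _ ht]
  exact Finset.prod_filter_mul_prod_filter_not s (· ∈ B) fun x => ν (t x)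

/-- Functions of the environment inside and outside of `B` are independent. -/
lemma IsIID.lintegral_mul [IsProbabilityMeasure P] (h : IsIID P) (B : Set (Site d))
    {F G : Env d → ℝ≥0∞} (hF : Measurable F) (hG : Measurable G)
    (hFB : ∀ ω ω', (∀ x, x ∉ B → ω x = ω' x) → F ω = F ω')
    (hGB : ∀ ω ω', (∀ x ∈ B, ω x = ω' x) → G ω = G ω') :
    ∫⁻ ω, F ω * G ω ∂P = (∫⁻ ω, F ω ∂P) * ∫⁻ ω, G ω ∂P := by
  conv_lhs => rw [← h.map_glue B]
  rw [lintegral_map (f := fun ω => F ω * G ω) (hF.mul hG) (measurable_glue B)]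
  have e : ∀ p : Env d × Env d, F (glue B p) * G (glue B p) = G p.1 * F p.2 := by
    intro p
    rw [hFB (glue B p) p.2 fun x hx => by simp [glue, hx],
      hGB (glue B p) p.1 fun x hx => by simp [glue, hx], mul_comm]
  simp_rw [e]
  rw [lintegral_prod_mul hG.aemeasurable hF.aemeasurable, mul_comm]

/-- Translation invariance of the annealed law. -/
lemma annLaw_translate (hPq : IsQuenchedFamily Pq) (hIID : IsIID P)
    (x : Site d) {A : Set (Path d)} (hA : MeasurableSet A) :
    annLaw P Pq x ((fun f k => f k - x) ⁻¹' A) = annLaw P Pq 0 A := by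
  have hm : Measurable fun (f : Path d) k => f k - x :=
    measurable_pi_lambda _ fun k => (measurable_pi_apply k).sub_const _
  have hs := measurable_shift x
  rw [annLaw_apply hPq x (hm hA), annLaw_apply hPq 0 hA]
  conv_rhs => rw [← hIID.map_shift x]
  rw [lintegral_map (hPq.2 0 A hA) hs]
  refine lintegral_congr fun ω => ?_
  rw [((hPq.1 (shift x ω) 0).unique (hPq.1 ω x).translate), Measure.map_apply hm hA]

lemma annLaw_tail_zero (hPq : IsQuenchedFamily Pq) (hIID : IsIID P)
    (x : Site d) {A : Set (Path d)} (hA : MeasurableSet A) :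
    annLaw P Pq x (tail 0 ⁻¹' A) = annLaw P Pq 0 A := by
  have hm : Measurable fun (f : Path d) k => f k - x :=
    measurable_pi_lambda _ fun k => (measurable_pi_apply k).sub_const _
  rw [← annLaw_translate hPq hIID x hA, annLaw_apply hPq x (hm hA),
    annLaw_apply hPq x (measurable_tail 0 hA)]
  refine lintegral_congr fun ω => ?_
  have := hPq.prob ω x
  refine measure_congr ?_
  have h1 : ∀ᵐ f ∂(Pq ω x), f 0 = x := by
    have := (prob_compl_eq_zero_iff (detBy_position 0 x).measurableSet).2 (hPq.1 ω x).start_ae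
    exact this
  filter_upwards [h1] with f hf
  refine propext ?_
  show tail 0 f ∈ A ↔ (fun k => f k - x) ∈ A
  rw [show tail 0 f = fun k => f k - x from funext fun k => by simp [tail, hf]]

lemma IsQuenchedFamily.markov (hPq : IsQuenchedFamily Pq) (ω : Env d)
    {n : ℕ} {S : Set (Path d)} (hS : DetBy n S) (x y : Site d) {A : Set (Path d)}
    (hA : MeasurableSet A) :
    Pq ω x (S ∩ {f | f n = y} ∩ tail n ⁻¹' A) =
      Pq ω x (S ∩ {f | f n = y}) * Pq ω y (tail 0 ⁻¹' A) := by
  rw [← IsQuenched.markov (fun x => hPq.1 ω x) hS x y (measurable_tail 0 hA)]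
  have : tail (d := d) n = tail 0 ∘ after n := by
    ext f k
    simp [tail, after]
  rw [this, Set.preimage_comp]

lemma measure_eq_tsum_position (μ : Measure (Path d)) (n : ℕ) {T : Set (Path d)}
    (hT : MeasurableSet T) : μ T = ∑' y : Site d, μ (T ∩ {f | f n = y}) := by
  rw [← measure_iUnion]
  · congr 1
    ext f
    simp
  · intro a b hab
    refine Set.disjoint_left.2 ?_
    rintro f ⟨-, hf⟩ ⟨-, hf'⟩
    exact hab (hf.symm.trans hf')
  · exact fun y => hT.inter (detBy_position n y).measurableSet

lemma IsQuenched.measure_first_step {ω : Env d} {x : Site d} {μ : Measure (Path d)}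
    (h : IsQuenched ω x μ) (v : Site d) :
    μ (tail 0 ⁻¹' {f | f 1 = v}) = envP ω x v := by
  have := h.1
  have h2 := h.2 1 (fun k => if k = 0 then x else x + v)
  simp only [if_true, Finset.range_one, Finset.prod_singleton, one_mul] at h2
  simp only [zero_add, one_ne_zero, if_false, add_sub_cancel_left] at h2
  rw [← h2]
  refine measure_congr ?_
  have h1 : ∀ᵐ f ∂μ, f 0 = x :=
    (prob_compl_eq_zero_iff (detBy_position 0 x).measurableSet).2 h.start_ae
  filter_upwards [h1] with f hf
  refine propext ?_
  show tail 0 f 1 = v ↔ ∀ i ≤ 1, f i = _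
  constructor
  · intro h i hi
    interval_cases i
    · simpa using hf
    · simpa [tail, hf, sub_eq_iff_eq_add, add_comm] using h
  · intro h
    have := h 1 le_rfl
    simp [tail, hf, this]

lemma measurableSet_position (n : ℕ) (v : Site d) : MeasurableSet {f : Path d | f n = v} :=
  (detBy_position n v).measurableSet

theorem isAnnealed_annLaw [IsProbabilityMeasure P] (hPq : IsQuenchedFamily Pq)
    (hUE : UniformlyElliptic P) (hIID : IsIID P) :
    ∃ η, IsAnnealed (annLaw P Pq 0) η := by
  have hpr := hPq.prob
  have hprob := isProbabilityMeasure_annLaw (P := P) hPq 0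
  obtain ⟨η, hη, hUE⟩ := hUE
  have hell : ∀ᵐ ω ∂P, ∀ x s, η ≤ (ω x).1 s := by
    rw [ae_all_iff]
    intro x
    rw [ae_all_iff]
    intro s
    have hm : MeasurableSet {ω : Env d | (ω 0).1 s < η} := by
      have : Measurable fun ω : Env d => (ω 0).1 s :=
        (measurable_pi_apply s).comp (measurable_subtype_coe.comp (measurable_pi_apply 0))
      exact measurableSet_lt this measurable_const
    have h := hUE s
    rw [← hIID.map_shift x, Measure.map_apply
      (measurable_shift x) hm] at h
    have h2 : P {ω : Env d | ¬ η ≤ (ω x).1 s} = 0 := by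
      rw [← h]
      congr 1
      ext ω
      simp [shift]
    exact h2
  have hell' : ∀ᵐ ω ∂P, ∀ x s, ENNReal.ofReal η ≤ envP ω x (stepVec s) := by
    filter_upwards [hell] with ω hω x s
    refine (ENNReal.ofReal_le_ofReal (hω x s)).trans ?_
    unfold envP
    have := Finset.single_le_sum (f := fun s' : StepIdx d =>
      if stepVec s = stepVec s' then ENNReal.ofReal ((ω x).1 s') else 0)
      (fun _ _ => zero_le) (Finset.mem_univ s)
    simpa using this
  refine ⟨ENNReal.ofReal η, hprob, ?_, ?_, ?_, ?_, by simpa using hη, ?_, ?_⟩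
  · have := (prob_compl_eq_zero_iff (μ := annLaw P Pq 0)
      (measurableSet_position (d := d) 0 0)).2 ?_
    · exact this
    rw [annLaw_apply hPq 0 (measurableSet_position 0 0)]
    simp [(hPq.1 _ 0).start_ae]
  · rw [ae_all_iff]
    intro n
    have hm : MeasurableSet {f : Path d | ∃ s, f 1 = stepVec s} := by
      have : {f : Path d | ∃ s, f 1 = stepVec s} = ⋃ s, {f | f 1 = stepVec s} := by
        ext; simp
      rw [this]
      exact MeasurableSet.iUnion fun s => measurableSet_position 1 _
    have key : annLaw P Pq 0 (tail n ⁻¹' {f : Path d | ∃ s, f 1 = stepVec s}) = 1 := by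
      rw [annLaw_apply hPq 0 (measurable_tail n hm)]
      have : ∀ ω, Pq ω 0 (tail n ⁻¹' {f : Path d | ∃ s, f 1 = stepVec s}) = 1 := by
        intro ω
        rw [measure_eq_tsum_position _ n (measurable_tail n hm)]
        have h1 := measure_eq_tsum_position (Pq ω 0) n MeasurableSet.univ
        simp only [measure_univ, Set.univ_inter] at h1
        rw [h1]
        refine tsum_congr fun y => ?_
        have := hPq.markov ω (n := n) (S := Set.univ) (fun _ _ _ _ => trivial) 0 y hm
        rw [Set.univ_inter] at this
        rw [Set.inter_comm, this]
        suffices h : Pq ω y (tail 0 ⁻¹' {f : Path d | ∃ s, f 1 = stepVec s}) = 1 by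
          rw [h, mul_one]
        refine le_antisymm prob_le_one ?_
        have e : tail 0 ⁻¹' {f : Path d | ∃ s, f 1 = stepVec s} =
            ⋃ v ∈ Finset.univ.image (stepVec (d := d)), tail 0 ⁻¹' {f : Path d | f 1 = v} := by
          ext f; simp [eq_comm]
        rw [e, measure_biUnion_finset]
        · simp_rw [(hPq.1 ω y).measure_first_step]
          unfold envP
          rw [Finset.sum_comm]
          have : ∀ s : StepIdx d, ∑ v ∈ Finset.univ.image (stepVec (d := d)),
              (if v = stepVec s then ENNReal.ofReal ((ω y).1 s) else 0) =
              ENNReal.ofReal ((ω y).1 s) := by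
            intro s
            rw [Finset.sum_ite_eq' _ (stepVec s) (fun _ => ENNReal.ofReal ((ω y).1 s))]
            simp
          rw [Finset.sum_congr rfl fun s _ => this s,
            ← ENNReal.ofReal_sum_of_nonneg fun s _ => (ω y).2.1 s, (ω y).2.2]
          simp
        · intro a _ b _ hab
          refine Disjoint.preimage _ (Set.disjoint_left.2 fun f hf hf' => hab ?_)
          exact Eq.trans (Eq.symm hf) hf'
        · exact fun v _ => measurable_tail 0 (measurableSet_position 1 v)
      simp_rw [this]
      simp
    have := (prob_compl_eq_zero_iff (μ := annLaw P Pq 0) (measurable_tail n hm)).2 key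
    have h2 : ∀ᵐ f ∂(annLaw P Pq 0), tail n f ∈ {f : Path d | ∃ s, f 1 = stepVec s} := this
    filter_upwards [h2] with f hf
    obtain ⟨s, hs⟩ := hf
    exact ⟨s, by simpa [tail, sub_eq_iff_eq_add, add_comm] using hs⟩
  · intro S hS hdisj y A hA
    have hSA : ∀ n, MeasurableSet (S n ∩ {f | f n = y} ∩ tail n ⁻¹' A) := fun n =>
      ((hS n).inter (detBy_position n y)).measurableSet.inter (measurable_tail n hA)
    have e : {f | ∃ n, f ∈ S n ∧ f n = y ∧ tail n f ∈ A} =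
        ⋃ n, S n ∩ {f | f n = y} ∩ tail n ⁻¹' A := by
      ext f
      simp [and_assoc]
    rw [e, annLaw_apply hPq 0 (MeasurableSet.iUnion hSA), ← annLaw_tail_zero hPq hIID y hA,
      annLaw_apply hPq y (measurable_tail 0 hA)]
    refine lintegral_mono fun ω => ?_
    refine (measure_iUnion_le _).trans ?_
    simp_rw [hPq.markov ω (hS _) 0 y hA]
    rw [ENNReal.tsum_mul_right]
    refine mul_le_of_le_one_left zero_le ?_
    rw [← measure_iUnion (fun i j hij => (hdisj hij).mono Set.inter_subset_left
      Set.inter_subset_left) fun n => ((hS n).inter (detBy_position n y)).measurableSet]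
    exact prob_le_one
  · intro u n S hS hSu A hA hAu
    rw [measure_eq_tsum_position _ n (hS.measurableSet.inter (measurable_tail n hA)),
      measure_eq_tsum_position _ n hS.measurableSet, ← ENNReal.tsum_mul_right]
    refine tsum_congr fun y => ?_
    have hSy := (hS.inter (detBy_position n y))
    rw [Set.inter_right_comm, annLaw_apply hPq 0 (hSy.measurableSet.inter (measurable_tail n hA)),
      annLaw_apply hPq 0 hSy.measurableSet, ← annLaw_tail_zero hPq hIID y hA,
      annLaw_apply hPq y (measurable_tail 0 hA)]
    simp_rw [hPq.markov _ hS 0 y hA]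
    have hstart : ∀ ω, Pq ω y (tail 0 ⁻¹' A) = Pq ω y (tail 0 ⁻¹' A ∩ {f | f 0 = y}) := by
      intro ω
      rw [measure_inter_conull]
      exact ((prob_compl_eq_zero_iff (measurableSet_position 0 y)).2 (hPq.1 ω y).start_ae)
    refine hIID.lintegral_mul {z | lev u y ≤ lev u z} (hPq.2 0 _ hSy.measurableSet)
      (hPq.2 y _ (measurable_tail 0 hA)) ?_ ?_
    · intro ω ω' hω
      refine (hPq.1 ω 0).congr_detBy (B := {z | lev u y ≤ lev u z}ᶜ) hω (hPq.1 ω' 0) hSy ?_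
      rintro f ⟨hf, hfy⟩ i hi
      have h1 := hSu f hf i hi
      rw [show f n = y from hfy] at h1
      simpa using h1
    · intro ω ω' hω
      rw [hstart, hstart]
      refine (hPq.1 ω y).congr_stay hω (hPq.1 ω' y)
        ((measurable_tail 0 hA).inter (measurableSet_position 0 y)) ?_
      rintro f ⟨hf, hfy⟩ i
      have h1 := hAu _ hf i
      have h0 : f 0 = y := hfy
      simp only [tail, zero_add, h0] at h1
      have : lev u (f i - y) = lev u (f i) - lev u y := by
        simp [lev, mul_sub]
      show lev u y ≤ lev u (f i)
      linarith
  · intro n S hS s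
    have hm := measurableSet_position (d := d) 1 (stepVec s)
    have e : {f : Path d | f (n + 1) = f n + stepVec s} = tail n ⁻¹' {f | f 1 = stepVec s} := by
      ext f
      simp [tail, sub_eq_iff_eq_add, add_comm]
    rw [e, annLaw_apply hPq 0 hS.measurableSet,
      annLaw_apply hPq 0 (hS.measurableSet.inter (measurable_tail n hm)),
      ← lintegral_const_mul _ (hPq.2 0 _ hS.measurableSet)]
    refine lintegral_mono_ae ?_
    filter_upwards [hell'] with ω hω
    rw [measure_eq_tsum_position _ n hS.measurableSet,
      measure_eq_tsum_position _ n (hS.measurableSet.inter (measurable_tail n hm)),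
      ← ENNReal.tsum_mul_left]
    refine ENNReal.tsum_le_tsum fun y => ?_
    rw [Set.inter_right_comm, hPq.markov ω hS 0 y hm, mul_comm,
      (hPq.1 ω y).measure_first_step]
    gcongr
    exact hω y s
  · intro s A hA
    have hS : DetBy 1 {f : Path d | f 1 = f 0 + stepVec s} := by
      intro f g hfg hf
      have : f 1 = f 0 + stepVec s := hf
      rwa [hfg 1 le_rfl, hfg 0 zero_le_one] at this
    have hm := measurableSet_position (d := d) 1 (stepVec s)
    rw [annLaw_apply hPq 0 (hS.measurableSet.inter (measurable_tail 1 hA)),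
      ← annLaw_tail_zero hPq hIID (stepVec s) hA,
      annLaw_apply hPq _ (measurable_tail 0 hA),
      ← lintegral_const_mul _ (hPq.2 _ _ (measurable_tail 0 hA))]
    refine lintegral_mono_ae ?_
    filter_upwards [hell'] with ω hω
    refine le_trans ?_ (measure_mono (Set.inter_subset_inter_left _
      (Set.inter_subset_left (t := {f | f 1 = stepVec s}))))
    rw [hPq.markov ω hS 0 _ hA]
    gcongr
    refine (hω 0 s).trans ?_
    rw [← (hPq.1 ω 0).measure_first_step,
      ← measure_inter_conull (s := tail 0 ⁻¹' {f | f 1 = stepVec s})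
      ((prob_compl_eq_zero_iff (measurableSet_position 0 0)).2 (hPq.1 ω 0).start_ae)]
    refine measure_mono ?_
    rintro f ⟨h1, h2⟩
    have h0 : f 0 = 0 := h2
    have h1' : f 1 - f 0 = stepVec s := h1
    simp only [h0, sub_zero] at h1'
    simp [h0, h1']

end

/-! ### Stretched exponential decay -/

/-- Stretched exponential decay. -/
def StretchedDecay (g : ℕ → ℝ≥0∞) : Prop :=
  ∃ δ : ℝ, 0 < δ ∧ ∃ C : ℝ, 0 ≤ C ∧
    ∀ L : ℕ, 1 ≤ L → g L ≤ ENNReal.ofReal (C * Real.exp (-((L : ℝ) ^ δ)))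

lemma exists_pow_mul_exp_le (k : ℕ) {c δ : ℝ} (hc : 0 < c) (hδ : 0 < δ) :
    ∃ C : ℝ, 0 ≤ C ∧ ∀ L : ℕ, 1 ≤ L →
      (L : ℝ) ^ k * Real.exp (-(c * (L : ℝ) ^ δ)) ≤ C * Real.exp (-((L : ℝ) ^ (δ / 2))) := by
  have h0 : Tendsto (fun L : ℕ => (L : ℝ) ^ (δ / 2)) atTop atTop :=
    (tendsto_rpow_atTop (by positivity)).comp tendsto_natCast_atTop_atTop
  have h1 := (tendsto_rpow_mul_exp_neg_mul_atTop_nhds_zero (k * (2 / δ)) 1 one_pos).comp h0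
  obtain ⟨B, hB⟩ := h1.bddAbove_range
  refine ⟨max B 0 * Real.exp (1 / c), by positivity, fun L hL => ?_⟩
  have hL0 : (0 : ℝ) < L := by exact_mod_cast hL
  set t := (L : ℝ) ^ (δ / 2) with ht
  have hB' : t ^ (k * (2 / δ)) * Real.exp (-1 * t) ≤ max B 0 :=
    (hB ⟨L, rfl⟩).trans (le_max_left _ _)
  have e1 : t ^ (k * (2 / δ)) = (L : ℝ) ^ k := by
    rw [ht, ← Real.rpow_mul hL0.le, ← Real.rpow_natCast]
    congr 1
    field_simp
  have e2 : (L : ℝ) ^ δ = t ^ 2 := by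
    rw [ht, ← Real.rpow_natCast, ← Real.rpow_mul hL0.le]
    congr 1
    push_cast
    ring
  rw [e1] at hB'
  rw [e2]
  have e3 : -(c * t ^ 2) ≤ 1 / c + -1 * t + -t := by
    have : 0 ≤ (c * t - 1) ^ 2 / c := by positivity
    have e : (c * t - 1) ^ 2 / c = c * t ^ 2 - 2 * t + 1 / c := by
      field_simp
      ring
    linarith
  calc (L : ℝ) ^ k * Real.exp (-(c * t ^ 2))
      ≤ (L : ℝ) ^ k * Real.exp (1 / c + -1 * t + -t) := by gcongr
    _ = ((L : ℝ) ^ k * Real.exp (-1 * t)) * Real.exp (1 / c) * Real.exp (-t) := by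
        rw [Real.exp_add, Real.exp_add]; ring
    _ ≤ max B 0 * Real.exp (1 / c) * Real.exp (-t) := by gcongr

lemma StretchedDecay.of_le {g : ℕ → ℝ≥0∞} (k : ℕ) {c δ C : ℝ} (hc : 0 < c) (hδ : 0 < δ)
    (hC : 0 ≤ C) (h : ∀ L : ℕ, 1 ≤ L →
      g L ≤ ENNReal.ofReal (C * ((L : ℝ) ^ k * Real.exp (-(c * (L : ℝ) ^ δ))))) :
    StretchedDecay g := by
  obtain ⟨C', hC', h'⟩ := exists_pow_mul_exp_le k hc hδ
  refine ⟨δ / 2, by positivity, C * C', by positivity, fun L hL => (h L hL).trans ?_⟩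
  refine ENNReal.ofReal_le_ofReal ?_
  rw [mul_assoc]
  exact mul_le_mul_of_nonneg_left (h' L hL) hC

lemma StretchedDecay.mono {g g' : ℕ → ℝ≥0∞} (h : StretchedDecay g)
    (hg : ∀ L, 1 ≤ L → g' L ≤ g L) : StretchedDecay g' := by
  obtain ⟨δ, hδ, C, hC, h⟩ := h
  exact ⟨δ, hδ, C, hC, fun L hL => (hg L hL).trans (h L hL)⟩

lemma StretchedDecay.add {g g' : ℕ → ℝ≥0∞} (h : StretchedDecay g) (h' : StretchedDecay g') :
    StretchedDecay fun L => g L + g' L := by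
  obtain ⟨δ, hδ, C, hC, h⟩ := h
  obtain ⟨δ', hδ', C', hC', h'⟩ := h'
  refine ⟨min δ δ', lt_min hδ hδ', C + C', by positivity, fun L hL => ?_⟩
  have hL1 : (1 : ℝ) ≤ L := by exact_mod_cast hL
  refine (add_le_add (h L hL) (h' L hL)).trans ?_
  rw [← ENNReal.ofReal_add (by positivity) (by positivity), add_mul]
  refine ENNReal.ofReal_le_ofReal ?_
  gcongr
  · exact min_le_left _ _
  · exact min_le_right _ _

lemma StretchedDecay.pow_mul {g : ℕ → ℝ≥0∞} (h : StretchedDecay g) (k : ℕ) (a : ℕ) :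
    StretchedDecay fun L => ((a * L ^ k : ℕ) : ℝ≥0∞) * g L := by
  obtain ⟨δ, hδ, C, hC, h⟩ := h
  refine StretchedDecay.of_le (C := a * C) k one_pos hδ (by positivity) fun L hL => ?_
  refine (mul_le_mul_right (h L hL) _).trans ?_
  rw [← ENNReal.ofReal_natCast, ← ENNReal.ofReal_mul (by positivity)]
  refine ENNReal.ofReal_le_ofReal (le_of_eq ?_)
  push_cast
  ring_nf

lemma StretchedDecay.comp {g : ℕ → ℝ≥0∞} (h : StretchedDecay g) {φ : ℕ → ℕ}
    (hφ : ∀ L, L ≤ φ L) : StretchedDecay fun L => g (φ L) := by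
  obtain ⟨δ, hδ, C, hC, h⟩ := h
  refine ⟨δ, hδ, C, hC, fun L hL => (h _ (hL.trans (hφ L))).trans ?_⟩
  refine ENNReal.ofReal_le_ofReal ?_
  gcongr
  exact hφ L

lemma stretchedDecay_geom {r : ℝ≥0∞} (hr : r < 1) : StretchedDecay fun L => r ^ L := by
  rcases eq_or_ne r 0 with rfl | hr0
  · refine ⟨1, one_pos, 0, le_rfl, fun L hL => ?_⟩
    simp [Nat.one_le_iff_ne_zero.1 hL]
  have ht : r ≠ ∞ := (hr.trans ENNReal.one_lt_top).ne
  have hpos : 0 < r.toReal := ENNReal.toReal_pos hr0 ht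
  have hlt : r.toReal < 1 := by
    have := (ENNReal.toReal_lt_toReal ht ENNReal.one_ne_top).2 hr
    simpa using this
  refine StretchedDecay.of_le (C := 1) (c := -Real.log r.toReal) 0
    (by have := Real.log_neg hpos hlt; linarith) one_pos zero_le_one fun L _ => ?_
  rw [← ENNReal.ofReal_toReal ht, ← ENNReal.ofReal_pow hpos.le]
  refine ENNReal.ofReal_le_ofReal (le_of_eq ?_)
  rw [ENNReal.toReal_ofReal hpos.le]
  simp only [pow_zero, one_mul, Real.rpow_one, neg_mul, neg_neg]
  rw [mul_comm, ← Real.log_pow, Real.exp_log (by positivity)]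

lemma summable_exp_neg_two_rpow {δ : ℝ} (hδ : 0 < δ) :
    Summable fun k : ℕ => Real.exp (-(1 / 2 * ((2 : ℝ) ^ k) ^ δ)) := by
  have hl : 0 < 1 / 2 * (δ * Real.log 2) := by
    have := Real.log_pos one_lt_two
    positivity
  refine Summable.of_nonneg_of_le (fun k => (Real.exp_pos _).le) (fun k => ?_)
    (Real.summable_exp_nat_mul_iff.2 (neg_lt_zero.2 hl))
  refine Real.exp_le_exp.2 ?_
  have : (k : ℝ) * (δ * Real.log 2) ≤ ((2 : ℝ) ^ k) ^ δ := by
    rw [Real.rpow_def_of_pos (by positivity), Real.log_pow]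
    have := Real.add_one_le_exp ((k : ℝ) * Real.log 2 * δ)
    linarith
  linarith

lemma StretchedDecay.tsum_two_pow {g : ℕ → ℝ≥0∞} (h : StretchedDecay g) :
    StretchedDecay fun L => ∑' k : ℕ, g (2 ^ k * L) := by
  obtain ⟨δ, hδ, C, hC, h⟩ := h
  set s := ∑' k : ℕ, Real.exp (-(1 / 2 * ((2 : ℝ) ^ k) ^ δ))
  have hs : 0 ≤ s := tsum_nonneg fun k => (Real.exp_pos _).le
  refine StretchedDecay.of_le (C := C * s) (c := 1 / 2) 0 (by norm_num) hδ (by positivity)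
    fun L hL => ?_
  have hL1 : (1 : ℝ) ≤ L := by exact_mod_cast hL
  have hb : ∀ k : ℕ, g (2 ^ k * L) ≤ ENNReal.ofReal
      (C * Real.exp (-(1 / 2 * (L : ℝ) ^ δ)) * Real.exp (-(1 / 2 * ((2 : ℝ) ^ k) ^ δ))) := by
    intro k
    refine (h _ (Nat.mul_pos (by positivity) hL)).trans (ENNReal.ofReal_le_ofReal ?_)
    rw [mul_assoc, ← Real.exp_add]
    gcongr
    push_cast
    rw [Real.mul_rpow (by positivity) (by positivity)]
    have h1 : (1 : ℝ) ≤ ((2 : ℝ) ^ k) ^ δ :=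
      Real.one_le_rpow (one_le_pow₀ one_le_two) hδ.le
    have h2 : (1 : ℝ) ≤ (L : ℝ) ^ δ := Real.one_le_rpow hL1 hδ.le
    nlinarith
  refine (ENNReal.tsum_le_tsum hb).trans ?_
  rw [← ENNReal.ofReal_tsum_of_nonneg (fun k => by positivity)
    ((summable_exp_neg_two_rpow hδ).mul_left _), tsum_mul_left]
  refine ENNReal.ofReal_le_ofReal (le_of_eq ?_)
  simp only [pow_zero, one_mul]
  ring

/-- Recursive inequality for survival probabilities. -/
lemma le_geom_of_add_mul_le {a : ℕ → ℝ≥0∞} {q : ℝ≥0∞} (hq : q ≤ 1) (h0 : a 0 ≤ 1)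
    (h : ∀ k, a (k + 1) + q * a k ≤ a k) (k : ℕ) : a k ≤ (1 - q) ^ k := by
  induction k with
  | zero => simpa using h0
  | succ k ih =>
    have hfin : a k ≠ ∞ := (ih.trans_lt (ENNReal.pow_lt_top
      (tsub_le_self.trans_lt ENNReal.one_lt_top))).ne
    have hq' : q * a k ≠ ∞ := ENNReal.mul_ne_top (hq.trans_lt ENNReal.one_lt_top).ne hfin
    calc a (k + 1) ≤ a k - q * a k := ENNReal.le_sub_of_add_le_right hq' (h k)
      _ = (1 - q) * a k := by rw [ENNReal.sub_mul (fun _ _ => hfin), one_mul]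
      _ ≤ (1 - q) ^ (k + 1) := by rw [pow_succ']; gcongr

lemma StretchedDecay.eq_zero_of_le {g : ℕ → ℝ≥0∞} (h : StretchedDecay g) {p : ℝ≥0∞}
    (hp : ∀ L, 1 ≤ L → p ≤ g L) : p = 0 := by
  obtain ⟨δ, hδ, C, hC, h⟩ := h
  have h0 : Tendsto (fun L : ℕ => (L : ℝ) ^ δ) atTop atTop :=
    (tendsto_rpow_atTop hδ).comp tendsto_natCast_atTop_atTop
  have h1 : Tendsto (fun L : ℕ => ENNReal.ofReal (C * Real.exp (-((L : ℝ) ^ δ)))) atTop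
      (nhds (ENNReal.ofReal (C * 0))) :=
    ENNReal.tendsto_ofReal ((Real.tendsto_exp_neg_atTop_nhds_zero.comp h0).const_mul C)
  rw [mul_zero, ENNReal.ofReal_zero] at h1
  refine le_antisymm (ge_of_tendsto h1 ?_) zero_le
  filter_upwards [eventually_ge_atTop 1] with L hL using (hp L hL).trans (h L hL)

lemma StretchedDecay.exists_le {g : ℕ → ℝ≥0∞} (h : StretchedDecay g) {ε : ℝ≥0∞} (hε : 0 < ε) :
    ∃ L, 1 ≤ L ∧ g L ≤ ε := by
  by_contra! hcon
  exact hε.ne' (h.eq_zero_of_le fun L hL => (hcon L hL).le)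

/-! ### Elementary facts on levels and first times -/

section
variable {d : ℕ}

lemma lev_add (u x y : Site d) : lev u (x + y) = lev u x + lev u y := by
  simp [lev, mul_add, Finset.sum_add_distrib]

lemma lev_sub (u x y : Site d) : lev u (x - y) = lev u x - lev u y := by
  simp [lev, mul_sub, Finset.sum_sub_distrib]

lemma lev_sub_left (u v x : Site d) : lev (u - v) x = lev u x - lev v x := by
  simp [lev, sub_mul, Finset.sum_sub_distrib]

lemma lev_smul (u x : Site d) (k : ℤ) : lev u (k • x) = k * lev u x := by
  simp [lev, Finset.mul_sum, mul_left_comm]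

@[simp] lemma lev_zero (u : Site d) : lev u 0 = 0 := by simp [lev]

lemma stepVec_eq_single (s : StepIdx d) :
    stepVec s = Pi.single s.1 (if s.2 then (1 : ℤ) else -1) := by
  funext j
  simp [stepVec, Pi.single_apply]

lemma lev_stepVec (u : Site d) (s : StepIdx d) :
    lev u (stepVec s) = if s.2 then u s.1 else - u s.1 := by
  rw [stepVec_eq_single]
  by_cases h : s.2 <;> simp [lev, h, Pi.single_apply]

lemma stepVec_lev (s : StepIdx d) (x : Site d) :
    lev (stepVec s) x = if s.2 then x s.1 else - x s.1 := by
  rw [stepVec_eq_single]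
  by_cases h : s.2 <;> simp [lev, h, Pi.single_apply]

lemma abs_stepVec_le (s : StepIdx d) (i : Fin d) : |stepVec s i| ≤ 1 := by
  unfold stepVec
  split_ifs <;> simp

/-- A nonzero direction admits a step which increases the level. -/
lemma exists_stepVec_lev_pos {u : Site d} (hu : u ≠ 0) : ∃ s, 1 ≤ lev u (stepVec s) := by
  obtain ⟨i, hi⟩ := Function.ne_iff.1 hu
  have hi' : u i ≠ 0 := hi
  rcases lt_or_gt_of_ne hi' with h | h
  · exact ⟨(i, false), by rw [lev_stepVec]; simp; omega⟩
  · exact ⟨(i, true), by rw [lev_stepVec]; simp; omega⟩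

lemma exists_stepVec_lev_neg {u : Site d} (hu : u ≠ 0) : ∃ s, lev u (stepVec s) ≤ -1 := by
  obtain ⟨i, hi⟩ := Function.ne_iff.1 hu
  have hi' : u i ≠ 0 := hi
  rcases lt_or_gt_of_ne hi' with h | h
  · exact ⟨(i, true), by rw [lev_stepVec]; simp; omega⟩
  · exact ⟨(i, false), by rw [lev_stepVec]; simp; omega⟩

/-- The event that `n` is the first time at which the events `E` hold. -/
def firstTime (E : ℕ → Set (Path d)) (n : ℕ) : Set (Path d) :=
  {f | f ∈ E n ∧ ∀ m < n, f ∉ E m}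

lemma detBy_firstTime {E : ℕ → Set (Path d)} (hE : ∀ n, DetBy n (E n)) (n : ℕ) :
    DetBy n (firstTime E n) := by
  intro f g hfg hf
  refine ⟨hE n f g hfg hf.1, fun m hm hg => hf.2 m hm ?_⟩
  exact hE m g f (fun i hi => (hfg i (by omega)).symm) hg

lemma firstTime_unique {E : ℕ → Set (Path d)} {n m : ℕ} {f : Path d} (hn : f ∈ firstTime E n)
    (hm : f ∈ firstTime E m) : n = m := by
  rcases lt_trichotomy n m with h | h | h
  · exact absurd hn.1 (hm.2 n h)
  · exact h
  · exact absurd hm.1 (hn.2 m h)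

lemma pairwise_disjoint_firstTime (E : ℕ → Set (Path d)) :
    Pairwise (Function.onFun Disjoint (firstTime E)) := fun _ _ hnm =>
  Set.disjoint_left.2 fun _ hn hm => hnm (firstTime_unique hn hm)

lemma exists_firstTime {E : ℕ → Set (Path d)} {f : Path d} {n : ℕ} (h : f ∈ E n) :
    ∃ m ≤ n, f ∈ firstTime E m := by
  classical
  have hex : ∃ n, f ∈ E n := ⟨n, h⟩
  exact ⟨Nat.find hex, Nat.find_min' hex h, Nat.find_spec hex, fun m hm => Nat.find_min hex hm⟩

lemma exists_mem_iff_exists_firstTime {E : ℕ → Set (Path d)} {f : Path d} :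
    (∃ n, f ∈ E n) ↔ ∃ n, f ∈ firstTime E n :=
  ⟨fun ⟨_, h⟩ => let ⟨m, _, hm⟩ := exists_firstTime h; ⟨m, hm⟩, fun ⟨n, h⟩ => ⟨n, h.1⟩⟩

/-- The event that level `h` is attained at time `n`. -/
def reach (u : Site d) (h : ℤ) (n : ℕ) : Set (Path d) := {f | h ≤ lev u (f n)}

lemma detBy_reach (u : Site d) (h : ℤ) (n : ℕ) : DetBy n (reach u h n) := by
  intro f g hfg hf
  have hf' : h ≤ lev u (f n) := hf
  rwa [hfg n le_rfl] at hf'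

lemma mem_firstTime_reach {u : Site d} {h : ℤ} {n : ℕ} {f : Path d} :
    f ∈ firstTime (reach u h) n ↔ h ≤ lev u (f n) ∧ ∀ m < n, lev u (f m) < h := by
  simp [firstTime, reach]

end

namespace IsAnnealed
variable {d : ℕ} {μ : Measure (Path d)} {η : ℝ≥0∞}

lemma eta_le_one (h : IsAnnealed μ η) (s : StepIdx d) : η ≤ 1 := by
  have := h.prob
  have h1 := h.ellip 0 Set.univ (fun _ _ _ _ => trivial) s
  rw [measure_univ, mul_one] at h1
  exact h1.trans prob_le_one

/-- Forcing the walk to go straight costs a factor `η` per step. -/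
lemma straight (h : IsAnnealed μ η) {n : ℕ} {S : Set (Path d)} (hS : DetBy n S) (s : StepIdx d)
    (k : ℕ) :
    η ^ k * μ S ≤ μ (S ∩ {f | ∀ j ≤ k, f (n + j) = f n + (j : ℤ) • stepVec s}) := by
  induction k with
  | zero => simp
  | succ k ih =>
    have hdet : DetBy (n + k) (S ∩ {f | ∀ j ≤ k, f (n + j) = f n + (j : ℤ) • stepVec s}) := by
      refine (hS.mono (by omega)).inter ?_
      intro f g hfg hf j hj
      rw [← hfg (n + j) (by omega), ← hfg n (by omega)]
      exact hf j hj
    calc η ^ (k + 1) * μ S = η * (η ^ k * μ S) := by rw [pow_succ']; ring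
      _ ≤ η * μ (S ∩ {f | ∀ j ≤ k, f (n + j) = f n + (j : ℤ) • stepVec s}) := by gcongr
      _ ≤ _ := h.ellip _ _ hdet s
      _ ≤ _ := by
        refine measure_mono ?_
        rintro f ⟨⟨hf, hk⟩, h1⟩
        refine ⟨hf, fun j hj => ?_⟩
        rcases Nat.lt_or_ge j (k + 1) with hj' | hj'
        · exact hk j (by omega)
        · obtain rfl : j = k + 1 := by omega
          have h1' : f (n + k + 1) = f (n + k) + stepVec s := h1
          rw [← add_assoc, h1', hk k le_rfl]
          push_cast
          rw [add_smul, one_smul, add_assoc]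

lemma straight_union (h : IsAnnealed μ η) {S : ℕ → Set (Path d)} (hS : ∀ n, DetBy n (S n))
    (hdisj : Pairwise (Function.onFun Disjoint S)) (s : StepIdx d) (k : ℕ) :
    η ^ k * μ {f | ∃ n, f ∈ S n} ≤
      μ {f | ∃ n, f ∈ S n ∧ ∀ j ≤ k, f (n + j) = f n + (j : ℤ) • stepVec s} := by
  have hT : ∀ n, MeasurableSet {f : Path d | ∀ j ≤ k, f (n + j) = f n + (j : ℤ) • stepVec s} := by
    intro n
    refine DetBy.measurableSet (n := n + k) ?_
    intro f g hfg hf j hj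
    rw [← hfg (n + j) (by omega), ← hfg n (by omega)]
    exact hf j hj
  have e1 : {f | ∃ n, f ∈ S n} = ⋃ n, S n := by ext; simp
  have e2 : {f | ∃ n, f ∈ S n ∧ ∀ j ≤ k, f (n + j) = f n + (j : ℤ) • stepVec s} =
      ⋃ n, S n ∩ {f : Path d | ∀ j ≤ k, f (n + j) = f n + (j : ℤ) • stepVec s} := by
    ext; simp
  rw [e1, e2, measure_iUnion hdisj fun n => (hS n).measurableSet,
    measure_iUnion (fun n m hnm => (hdisj hnm).mono Set.inter_subset_left Set.inter_subset_left)
      fun n => (hS n).measurableSet.inter (hT n), ← ENNReal.tsum_mul_left]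
  exact ENNReal.tsum_le_tsum fun n => h.straight (hS n) s k

/-- The Markov inequality at a stopping time, summed over a box. -/
lemma markov_box (h : IsAnnealed μ η) {S : ℕ → Set (Path d)} (hS : ∀ n, DetBy n (S n))
    (hdisj : Pairwise (Function.onFun Disjoint S)) {A : Set (Path d)} (hA : MeasurableSet A)
    (R : ℕ) : μ {f | ∃ n, f ∈ S n ∧ (∀ i, |f n i| ≤ (R : ℤ)) ∧ tail n f ∈ A} ≤
      ((2 * R + 1) ^ d : ℕ) * μ A := by
  have hsub : {f | ∃ n, f ∈ S n ∧ (∀ i, |f n i| ≤ (R : ℤ)) ∧ tail n f ∈ A} ⊆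
      ⋃ y ∈ (Fintype.piFinset fun _ : Fin d => Finset.Icc (-(R : ℤ)) R),
        {f | ∃ n, f ∈ S n ∧ f n = y ∧ tail n f ∈ A} := by
    rintro f ⟨n, h1, h2, h3⟩
    simp only [Set.mem_iUnion]
    exact ⟨f n, by simpa [abs_le] using h2, n, h1, rfl, h3⟩
  refine (measure_mono hsub).trans ((measure_biUnion_finset_le _ _).trans ?_)
  refine (Finset.sum_le_sum fun y _ => h.markov_le S hS hdisj y A hA).trans ?_
  rw [Finset.sum_const, nsmul_eq_mul]
  gcongr
  simp only [Fintype.card_piFinset, Int.card_Icc, Finset.prod_const, Finset.card_univ,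
    Fintype.card_fin]
  gcongr
  omega

end IsAnnealed

/-! ### Ballisticity -/

/-- The walk drops to level `-L` before reaching level `L`. -/
def Back {d : ℕ} (w : Site d) (L : ℕ) : Set (Path d) :=
  {f | ∃ n, lev w (f n) ≤ -(L : ℤ) ∧ ∀ m ≤ n, lev w (f m) < L}

/-- Stretched exponential decay of backtracking probabilities around the direction `u`. -/
structure Ballistic {d : ℕ} (μ : Measure (Path d)) (u : Site d) : Prop where
  ne_zero : ∀ i, u i ≠ 0
  sub_ne : ∀ s, u - stepVec s ≠ 0
  back : ∃ γ : ℝ, 0 < γ ∧ ∃ c : ℝ, 0 < c ∧ ∃ C : ℝ, 0 ≤ C ∧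
    ∀ w, (w = u ∨ ∃ s, w = u - stepVec s) → ∀ L : ℕ, 1 ≤ L →
      μ (Back w L) ≤ ENNReal.ofReal (C * Real.exp (-(c * (L : ℝ) ^ γ)))

/-- The walk makes a large lateral displacement inside a slab. -/
def Lat {d : ℕ} (u : Site d) (L R : ℕ) : Set (Path d) :=
  {f | ∃ n, (∀ m ≤ n, |lev u (f m)| < L) ∧ ∃ i, (R : ℤ) ≤ |f n i|}

/-- The walk reaches level `L` before `-L` and without large displacement. -/
def Good {d : ℕ} (u : Site d) (A L : ℕ) : Set (Path d) :=
  {f | ∃ n, (L : ℤ) ≤ lev u (f n) ∧ ∀ m ≤ n, -(L : ℤ) < lev u (f m) ∧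
    ∀ i, |f m i| ≤ ((L ^ A : ℕ) : ℤ)}

lemma measurableSet_good {d : ℕ} (u : Site d) (A L : ℕ) : MeasurableSet (Good u A L) := by
  refine measurableSet_setOfPred.2 ?_
  fun_prop

section
variable {d : ℕ} {μ : Measure (Path d)} {η : ℝ≥0∞} {u : Site d}

lemma IsAnnealed.lat_le (h : IsAnnealed μ η) (hB : Ballistic μ u) (L R : ℕ) :
    η ^ (2 * L) * μ (Lat u L R) ≤ ∑ s : StepIdx d, μ (Back (u - stepVec s) (L + R)) := by
  set E : ℕ → Set (Path d) :=
    fun n => {f | (∀ m ≤ n, |lev u (f m)| < L) ∧ ∃ i, (R : ℤ) ≤ |f n i|} with hE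
  have hEd : ∀ n, DetBy n (E n) := by
    rintro n f g hfg ⟨h1, i, hi⟩
    exact ⟨fun m hm => hfg m hm ▸ h1 m hm, i, hfg n le_rfl ▸ hi⟩
  set S : StepIdx d → ℕ → Set (Path d) :=
    fun s n => firstTime E n ∩ {f | (R : ℤ) ≤ lev (stepVec s) (f n)} with hS
  have hSd : ∀ s n, DetBy n (S s n) := fun s n =>
    (detBy_firstTime hEd n).inter (detBy_reach (stepVec s) R n)
  have hSp : ∀ s, Pairwise (Function.onFun Disjoint (S s)) := fun s n m hnm =>
    (pairwise_disjoint_firstTime E hnm).mono Set.inter_subset_left Set.inter_subset_left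
  have hcov : Lat u L R ⊆ ⋃ s : StepIdx d, {f | ∃ n, f ∈ S s n} := by
    rintro f hf
    obtain ⟨n, hn⟩ := exists_mem_iff_exists_firstTime.1 (show ∃ n, f ∈ E n from hf)
    obtain ⟨i, hi⟩ := hn.1.2
    rw [Set.mem_iUnion]
    rcases le_abs'.1 hi with h1 | h1
    · exact ⟨(i, false), n, hn, by rw [Set.mem_ofPred_eq, stepVec_lev]; simp; omega⟩
    · exact ⟨(i, true), n, hn, by rw [Set.mem_ofPred_eq, stepVec_lev]; simp; omega⟩
  refine (mul_le_mul_right ((measure_mono hcov).trans (measure_iUnion_fintype_le μ _)) _).trans ?_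
  rw [Finset.mul_sum]
  refine Finset.sum_le_sum fun s _ => ?_
  obtain ⟨t, ht⟩ := exists_stepVec_lev_neg (hB.sub_ne s)
  refine (h.straight_union (hSd s) (hSp s) t (2 * L)).trans (measure_mono ?_)
  rintro f ⟨n, ⟨hn, hs⟩, hrun⟩
  have hs' : (R : ℤ) ≤ lev (stepVec s) (f n) := hs
  have hlev : ∀ j ≤ 2 * L, lev (u - stepVec s) (f (n + j)) ≤
      lev (u - stepVec s) (f n) - j := by
    intro j hj
    rw [hrun j hj, lev_add, lev_smul]
    nlinarith
  have hn0 := abs_lt.1 (hn.1.1 n le_rfl)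
  have hnw : lev (u - stepVec s) (f n) < L - R := by rw [lev_sub_left]; omega
  refine ⟨n + 2 * L, ?_, fun m hm => ?_⟩
  · have := hlev (2 * L) le_rfl
    push_cast at *
    omega
  · rcases Nat.lt_or_ge m n with hmn | hmn
    · have h1 := abs_lt.1 (hn.1.1 m hmn.le)
      have h2 := hn.2 m hmn
      have h3 : ∀ i, |f m i| < R := by
        by_contra! hc
        exact h2 ⟨fun k hk => hn.1.1 k (by omega), hc⟩
      have h4 := abs_lt.1 (h3 s.1)
      rw [lev_sub_left, stepVec_lev]
      push_cast
      split_ifs <;> omega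
    · have := hlev (m - n) (by omega)
      rw [Nat.add_sub_cancel' hmn] at this
      push_cast
      omega

lemma IsAnnealed.stretchedDecay_lat (h : IsAnnealed μ η) (hB : Ballistic μ u) :
    ∃ A : ℕ, 1 ≤ A ∧ StretchedDecay fun L => μ (Lat u L (L ^ A)) := by
  obtain ⟨γ, hγ, c, hc, C, hC, hback⟩ := hB.back
  rcases isEmpty_or_nonempty (StepIdx d) with hemp | ⟨⟨s₀⟩⟩
  · refine ⟨1, le_rfl, 1, one_pos, 0, le_rfl, fun L _ => ?_⟩
    have : IsEmpty (Fin d) := ⟨fun i => hemp.elim (i, true)⟩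
    simp [Lat]
  set A := ⌈2 / γ⌉₊ with hA
  have hA1 : 1 ≤ A := Nat.one_le_iff_ne_zero.2 (Nat.ceil_pos.2 (by positivity)).ne'
  refine ⟨A, hA1, ?_⟩
  have hAγ : 2 ≤ A * γ := by
    have := Nat.le_ceil (2 / γ)
    rwa [div_le_iff₀ hγ] at this
  have hη1 := h.eta_le_one s₀
  have hηt : η ≠ ∞ := (hη1.trans_lt ENNReal.one_lt_top).ne
  have hη0 : 0 < η.toReal := ENNReal.toReal_pos h.pos.ne' hηt
  set b : ℝ := -Real.log η.toReal with hb
  set K : ℝ := (2 * b / c) ^ 2 * c / 2 with hK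
  refine StretchedDecay.of_le (C := Fintype.card (StepIdx d) * C * Real.exp K) (c := c / 2)
    (δ := 2) 0 (by positivity) two_pos (by positivity) fun L hL => ?_
  have hL1 : (1 : ℝ) ≤ L := by exact_mod_cast hL
  have h1 := (h.lat_le hB L (L ^ A)).trans
    (Finset.sum_le_sum fun s _ => hback (u - stepVec s) (Or.inr ⟨s, rfl⟩) (L + L ^ A) (by omega))
  rw [Finset.sum_const, nsmul_eq_mul, Finset.card_univ] at h1
  have h2 : μ (Lat u L (L ^ A)) ≤ (η ^ (2 * L))⁻¹ * (Fintype.card (StepIdx d) *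
      ENNReal.ofReal (C * Real.exp (-(c * ((L + L ^ A : ℕ) : ℝ) ^ γ)))) := by
    exact (ENNReal.mul_le_iff_le_inv (pow_ne_zero _ h.pos.ne') (ENNReal.pow_ne_top hηt)).1 h1
  refine h2.trans ?_
  rw [← ENNReal.ofReal_toReal hηt, ← ENNReal.ofReal_pow hη0.le,
    ← ENNReal.ofReal_inv_of_pos (by positivity), ← ENNReal.ofReal_natCast,
    ← ENNReal.ofReal_mul (by positivity), ← ENNReal.ofReal_mul (by positivity)]
  refine ENNReal.ofReal_le_ofReal ?_
  have e1 : (η.toReal ^ (2 * L))⁻¹ = Real.exp (2 * L * b) := by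
    rw [hb, ← Real.exp_log (pow_pos hη0 (2 * L)), ← Real.exp_neg, Real.log_pow]
    congr 1
    push_cast
    ring
  have e2 : (L : ℝ) ^ (2 : ℝ) ≤ ((L + L ^ A : ℕ) : ℝ) ^ γ := by
    calc (L : ℝ) ^ (2 : ℝ) ≤ (L : ℝ) ^ (A * γ) := Real.rpow_le_rpow_of_exponent_le hL1 hAγ
      _ = ((L : ℝ) ^ A) ^ γ := by rw [Real.rpow_mul (by positivity), Real.rpow_natCast]
      _ ≤ _ := by
        refine Real.rpow_le_rpow (by positivity) ?_ hγ.le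
        push_cast
        linarith
  rw [e1]
  have e3 : 2 * L * b + -(c * ((L + L ^ A : ℕ) : ℝ) ^ γ) ≤ K + -(c / 2 * (L : ℝ) ^ (2 : ℝ)) := by
    have h3 : c * (L : ℝ) ^ (2 : ℝ) ≤ c * ((L + L ^ A : ℕ) : ℝ) ^ γ := by gcongr
    have h4 : (L : ℝ) ^ (2 : ℝ) = (L : ℝ) ^ 2 := by norm_num
    have h5 : 0 ≤ ((2 * b / c) - L) ^ 2 * c / 2 := by positivity
    have h6 : ((2 * b / c) - L) ^ 2 * c / 2 = K - 2 * b * L + c / 2 * (L : ℝ) ^ 2 := by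
      rw [hK]
      field_simp
      ring
    rw [h4] at h3 ⊢
    linarith
  calc Real.exp (2 * L * b) * (Fintype.card (StepIdx d) *
        (C * Real.exp (-(c * ((L + L ^ A : ℕ) : ℝ) ^ γ))))
      = Fintype.card (StepIdx d) * C *
        Real.exp (2 * L * b + -(c * ((L + L ^ A : ℕ) : ℝ) ^ γ)) := by rw [Real.exp_add]; ring
    _ ≤ Fintype.card (StepIdx d) * C * Real.exp (K + -(c / 2 * (L : ℝ) ^ (2 : ℝ))) := by gcongr
    _ = _ := by rw [Real.exp_add]; ring

/-- The walk a.s. leaves every slab. -/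
lemma IsAnnealed.slab_null (h : IsAnnealed μ η) (hu : u ≠ 0) (L : ℕ) :
    μ {f | ∀ n, |lev u (f n)| < L} = 0 := by
  obtain ⟨s, hs⟩ := exists_stepVec_lev_pos hu
  have := h.prob
  set S : ℕ → Set (Path d) := fun k => {f | ∀ m ≤ k * (2 * L), |lev u (f m)| < L} with hS
  have hSd : ∀ k, DetBy (k * (2 * L)) (S k) := by
    intro k f g hfg hf m hm
    exact hfg m hm ▸ hf m hm
  have hη1 := h.eta_le_one s
  have hq : η ^ (2 * L) ≤ 1 := pow_le_one' hη1 _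
  have hstep : ∀ k, μ (S (k + 1)) + η ^ (2 * L) * μ (S k) ≤ μ (S k) := by
    intro k
    refine (add_le_add_right (h.straight (hSd k) s (2 * L)) _).trans ?_
    rw [← measure_union' _ (hSd (k + 1)).measurableSet]
    · refine measure_mono (Set.union_subset ?_ Set.inter_subset_left)
      intro f hf m hm
      exact hf m (hm.trans (by nlinarith))
    · refine Set.disjoint_left.2 fun f hf hf' => ?_
      have h1 := abs_lt.1 (hf (k * (2 * L) + 2 * L) (by ring_nf; rfl))
      have h2 := abs_lt.1 (hf'.1 _ le_rfl)
      rw [hf'.2 (2 * L) le_rfl, lev_add, lev_smul] at h1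
      push_cast at h1
      nlinarith
  have hle := le_geom_of_add_mul_le hq prob_le_one hstep
  refine (stretchedDecay_geom (r := 1 - η ^ (2 * L)) ?_).eq_zero_of_le fun k _ => ?_
  · exact ENNReal.sub_lt_self ENNReal.one_ne_top one_ne_zero (pow_ne_zero _ h.pos.ne')
  · exact (measure_mono (show {f | ∀ n, |lev u (f n)| < L} ⊆ S k from fun f hf m _ => hf m)).trans (hle k)

lemma IsAnnealed.stretchedDecay_good_compl (h : IsAnnealed μ η) (hB : Ballistic μ u) (hu : u ≠ 0)
    {A : ℕ} (hA : StretchedDecay fun L => μ (Lat u L (L ^ A))) :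
    StretchedDecay fun L => μ (Good u A L)ᶜ := by
  obtain ⟨γ, hγ, c, hc, C, hC, hback⟩ := hB.back
  have hb : StretchedDecay fun L => μ (Back u L) :=
    StretchedDecay.of_le (C := C) 0 hc hγ hC fun L hL => by
      simpa using hback u (Or.inl rfl) L hL
  refine (hA.add hb).mono fun L hL => ?_
  have hL' : (1 : ℤ) ≤ L := by exact_mod_cast hL
  have hae : (Good u A L)ᶜ ≤ᵐ[μ] ((Lat u L (L ^ A) ∪ Back u L : Set (Path d)) ) := by
    have hz : ∀ᵐ f ∂μ, ¬ ∀ n, |lev u (f n)| < L := by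
      rw [ae_iff]
      simpa using h.slab_null hu L
    filter_upwards [hz, h.start, h.steps] with f hz h0 hst hg
    by_contra hcon
    refine hg ?_
    have hcon' : f ∉ Lat u L (L ^ A) ∧ f ∉ Back u L := not_or.1 hcon
    push Not at hz
    obtain ⟨n, hn⟩ := hz
    obtain ⟨n, -, hn, hmin⟩ := exists_firstTime
      (E := fun n => {f : Path d | (L : ℤ) ≤ |lev u (f n)|}) (f := f) hn
    have hmin' : ∀ m < n, |lev u (f m)| < L := fun m hm => not_le.1 (hmin m hm)
    have hbox : ∀ m < n, ∀ i, |f m i| < ((L ^ A : ℕ) : ℤ) := by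
      intro m hm
      by_contra! hc
      exact hcon'.1 ⟨m, fun k hk => hmin' k (by omega), hc⟩
    have hn0 : n ≠ 0 := by
      rintro rfl
      have : (L : ℤ) ≤ |lev u (f 0)| := hn
      rw [h0, lev_zero, abs_zero] at this
      omega
    rcases le_abs'.1 (show (L : ℤ) ≤ |lev u (f n)| from hn) with h1 | h1
    · refine absurd ⟨n, h1, fun m hm => ?_⟩ hcon'.2
      rcases hm.lt_or_eq with hm | rfl
      · exact (abs_lt.1 (hmin' m hm)).2
      · omega
    · refine ⟨n, h1, fun m hm => ?_⟩
      rcases hm.lt_or_eq with hm | rfl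
      · exact ⟨(abs_lt.1 (hmin' m hm)).1, fun i => (hbox m hm i).le⟩
      · refine ⟨by omega, fun i => ?_⟩
        obtain ⟨s, hs⟩ := hst (m - 1)
        rw [Nat.sub_add_cancel (by omega)] at hs
        rw [hs]
        have h2 := hbox (m - 1) (by omega) i
        have h3 := abs_stepVec_le s i
        have h4 := abs_add_le (f (m - 1) i) (stepVec s i)
        simp only [Pi.add_apply]
        omega
  exact (measure_mono_ae hae).trans (measure_union_le _ _)

/-- The multi-scale failure event controlling deep backtracking. -/
def Fail (u : Site d) (A L : ℕ) : Set (Path d) :=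
  ⋃ k : ℕ, {f | ∃ n, f ∈ firstTime (reach u (((2 ^ k - 1) * L : ℕ) : ℤ)) n ∧
    (∀ i, |f n i| ≤ (((2 ^ k * L) ^ A : ℕ) : ℤ)) ∧ tail n f ∈ (Good u A (2 ^ k * L))ᶜ}

lemma IsAnnealed.stretchedDecay_fail (h : IsAnnealed μ η) {A : ℕ}
    (hg : StretchedDecay fun L => μ (Good u A L)ᶜ) :
    StretchedDecay fun L => μ (Fail u A L) := by
  refine (hg.pow_mul (A * d) (3 ^ d)).tsum_two_pow.mono fun L hL => ?_
  refine (measure_iUnion_le _).trans (ENNReal.tsum_le_tsum fun k => ?_)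
  refine (h.markov_box (detBy_firstTime fun n => detBy_reach u _ n)
    (pairwise_disjoint_firstTime _) (measurableSet_good u A _).compl _).trans ?_
  gcongr
  rw [pow_mul, ← mul_pow]
  gcongr
  have : 1 ≤ (2 ^ k * L) ^ A := Nat.one_le_pow _ _ (by positivity)
  omega

lemma not_fail_reach {A L : ℕ} (hA : 1 ≤ A) (hL : 1 ≤ L) {f : Path d} (hf : f ∉ Fail u A L)
    (h0 : f 0 = 0) (k : ℕ) :
    ∃ n, f ∈ firstTime (reach u (((2 ^ k - 1) * L : ℕ) : ℤ)) n ∧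
      (∀ m ≤ n, -(L : ℤ) < lev u (f m)) ∧ ∀ i, |f n i| ≤ (((2 ^ k * L) ^ A : ℕ) : ℤ) := by
  induction k with
  | zero =>
    refine ⟨0, by simp [mem_firstTime_reach, h0], fun m hm => ?_, fun i => ?_⟩
    · obtain rfl : m = 0 := by omega
      rw [h0, lev_zero]
      omega
    · rw [h0]
      simp
  | succ k ih =>
    obtain ⟨n, hn, hlow, hbox⟩ := ih
    have hgood : tail n f ∈ Good u A (2 ^ k * L) := by
      by_contra hc
      exact hf (Set.mem_iUnion.2 ⟨k, n, hn, hbox, hc⟩)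
    obtain ⟨n', h1, h2⟩ := hgood
    rw [mem_firstTime_reach] at hn
    have hpk : 1 ≤ 2 ^ k := Nat.one_le_two_pow
    have hcast : (((2 ^ k - 1) * L : ℕ) : ℤ) = ((2 ^ k * L : ℕ) : ℤ) - L := by
      rw [Nat.sub_mul, one_mul, Nat.cast_sub (by nlinarith)]
    have hcast' : (((2 ^ (k + 1) - 1) * L : ℕ) : ℤ) = 2 * ((2 ^ k * L : ℕ) : ℤ) - L := by
      rw [Nat.sub_mul, one_mul, Nat.cast_sub
        (by have := Nat.one_le_two_pow (n := k + 1); nlinarith)]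
      push_cast
      ring
    have hlt : ∀ j, lev u (f (n + j)) = lev u (tail n f j) + lev u (f n) := by
      intro j
      simp only [tail, lev_sub]
      ring
    rw [hcast] at hn
    have hreach : f ∈ reach u (((2 ^ (k + 1) - 1) * L : ℕ) : ℤ) (n + n') := by
      show _ ≤ lev u (f (n + n'))
      rw [hlt, hcast']
      linarith [hn.1]
    obtain ⟨t, ht, htf⟩ := exists_firstTime hreach
    have hLk : 0 ≤ ((2 ^ k * L : ℕ) : ℤ) := by positivity
    have htn : n ≤ t := by
      by_contra hc
      have h3 := hn.2 t (by omega)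
      have h4 := (mem_firstTime_reach.1 htf).1
      rw [hcast'] at h4
      omega
    refine ⟨t, htf, fun m hm => ?_, fun i => ?_⟩
    · rcases Nat.lt_or_ge m n with hmn | hmn
      · exact hlow m hmn.le
      · have h3 := (h2 (m - n) (by omega)).1
        have h4 := hlt (m - n)
        rw [Nat.add_sub_cancel' hmn] at h4
        rw [h4]
        linarith [hn.1]
    · have h3 := (h2 (t - n) (by omega)).2 i
      have h4 : f t i = tail n f (t - n) i + f n i := by simp [tail, Nat.add_sub_cancel' htn]
      rw [h4]
      refine (abs_add_le _ _).trans ?_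
      have h5 : 2 * (2 ^ k * L) ^ A ≤ (2 ^ (k + 1) * L) ^ A := by
        rw [pow_succ, mul_right_comm, mul_pow _ 2, mul_comm]
        gcongr
        exact Nat.le_self_pow (by omega) 2
      have h6 := hbox i
      have h7 : (2 * ((2 ^ k * L) ^ A : ℕ) : ℤ) ≤ ((2 ^ (k + 1) * L) ^ A : ℕ) := by exact_mod_cast h5
      linarith

lemma not_fail_spec {A L : ℕ} (hA : 1 ≤ A) (hL : 1 ≤ L) {f : Path d} (hf : f ∉ Fail u A L)
    (h0 : f 0 = 0) : (∀ n, -(L : ℤ) < lev u (f n)) ∧ ∀ H : ℤ, ∃ n, H ≤ lev u (f n) := by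
  have key : ∀ H : ℤ, ∃ k, H ≤ (((2 ^ k - 1) * L : ℕ) : ℤ) := by
    intro H
    refine ⟨H.toNat, ?_⟩
    have h1 : H.toNat < 2 ^ H.toNat := Nat.lt_two_pow_self
    have h2 : H.toNat ≤ (2 ^ H.toNat - 1) * L := by
      calc H.toNat ≤ 2 ^ H.toNat - 1 := by omega
        _ ≤ _ := Nat.le_mul_of_pos_right _ hL
    calc H ≤ (H.toNat : ℤ) := Int.self_le_toNat H
      _ ≤ _ := by exact_mod_cast h2
  refine ⟨fun n => ?_, fun H => ?_⟩
  · obtain ⟨H, hH⟩ : ∃ H : ℤ, ∀ m ≤ n, lev u (f m) < H := by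
      obtain ⟨B, hB⟩ := ((Set.finite_Iic n).image fun m => lev u (f m)).bddAbove
      exact ⟨B + 1, fun m hm => Int.lt_add_one_of_le (hB ⟨m, hm, rfl⟩)⟩
    obtain ⟨k, hk⟩ := key H
    obtain ⟨t, ht, hlow, -⟩ := not_fail_reach hA hL hf h0 k
    refine hlow n ?_
    by_contra hc
    have := hH t (by omega)
    have := (mem_firstTime_reach.1 ht).1
    omega
  · obtain ⟨k, hk⟩ := key H
    obtain ⟨t, ht, -⟩ := not_fail_reach hA hL hf h0 k
    exact ⟨t, hk.trans (mem_firstTime_reach.1 ht).1⟩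

/-- The walk drops to level `-L`. -/
def Deep (u : Site d) (L : ℕ) : Set (Path d) := {f | ∃ n, lev u (f n) ≤ -(L : ℤ)}

/-- The walk makes a large displacement before reaching level `L`. -/
def Wide (u : Site d) (A L : ℕ) : Set (Path d) :=
  {f | ∃ n, (∀ m ≤ n, lev u (f m) < L) ∧ ∃ i, ((L ^ A : ℕ) : ℤ) ≤ |f n i|}

/-- The walk stays in the half space above its starting level. -/
def Stay (u : Site d) : Set (Path d) := {f | ∀ n, 0 ≤ lev u (f n)}

lemma measurableSet_deep (u : Site d) (L : ℕ) : MeasurableSet (Deep u L) := by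
  refine measurableSet_setOfPred.2 ?_
  fun_prop

lemma measurableSet_stay (u : Site d) : MeasurableSet (Stay u) := by
  refine measurableSet_setOfPred.2 ?_
  fun_prop

/-- Ballistic behaviour of the walk. -/
lemma IsAnnealed.ballistic (h : IsAnnealed μ η) (hB : Ballistic μ u) (hu : u ≠ 0) :
    ∃ A : ℕ, 1 ≤ A ∧ (StretchedDecay fun L => μ (Deep u L)) ∧
      (StretchedDecay fun L => μ (Wide u A L)) ∧
      (∀ᵐ f ∂μ, ∀ H : ℤ, ∃ n, H ≤ lev u (f n)) ∧ 0 < μ (Stay u) := by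
  obtain ⟨A, hA, hlat⟩ := h.stretchedDecay_lat hB
  have hf := h.stretchedDecay_fail (h.stretchedDecay_good_compl hB hu hlat)
  have := h.prob
  have hdeep : StretchedDecay fun L => μ (Deep u L) := by
    refine hf.mono fun L hL => measure_mono_ae ?_
    filter_upwards [h.start] with f h0 hd
    by_contra hc
    obtain ⟨n, hn⟩ := hd
    have := (not_fail_spec hA hL hc h0).1 n
    omega
  refine ⟨A, hA, hdeep, ?_, ?_, ?_⟩
  · refine (hlat.add hdeep).mono fun L _ =>
      (measure_mono ?_).trans (measure_union_le (Lat u L (L ^ A)) (Deep u L))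
    rintro f ⟨n, h1, h2⟩
    by_cases hd : f ∈ Deep u L
    · exact Or.inr hd
    · refine Or.inl ⟨n, fun m hm => abs_lt.2 ⟨?_, h1 m hm⟩, h2⟩
      by_contra hc
      exact hd ⟨m, by omega⟩
  · rw [ae_iff]
    refine hf.eq_zero_of_le fun L hL => measure_mono_ae ?_
    filter_upwards [h.start] with f h0 hd
    by_contra hc
    exact hd (not_fail_spec hA hL hc h0).2
  · obtain ⟨L, hL, hLe⟩ := hdeep.exists_le (ε := 1 / 2) (by simp)
    obtain ⟨s, hs⟩ := exists_stepVec_lev_pos hu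
    set S : ℕ → Set (Path d) := fun j => {f | ∀ n, -(j : ℤ) ≤ lev u (f n)}
    have hSm : ∀ j, MeasurableSet (S j) := by
      intro j
      refine measurableSet_setOfPred.2 ?_
      fun_prop
    have hpos : ∀ j, 0 < μ (S j) → 0 < μ (S 0) := by
      intro j
      induction j with
      | zero => exact id
      | succ j ih =>
        intro hj
        refine ih ((ENNReal.mul_pos h.pos.ne' hj.ne').trans_le ?_)
        refine (h.first_step s _ (hSm (j + 1))).trans (measure_mono_ae ?_)
        filter_upwards [h.start] with f h0 hf n
        have h1 : f 1 = f 0 + stepVec s := hf.1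
        rcases n with _ | n
        · rw [h0, lev_zero]
          omega
        · have h2 : -((j + 1 : ℕ) : ℤ) ≤ lev u (tail 1 f n) := hf.2 n
          simp only [tail, lev_sub] at h2
          rw [h1, h0, zero_add, add_comm 1 n] at h2
          push_cast at h2
          omega
    have hL0 : 0 < μ (S L) := by
      have h1 : (Deep u L)ᶜ ⊆ S L := by
        intro f hf n
        by_contra hc
        exact hf ⟨n, by omega⟩
      refine lt_of_lt_of_le ?_ (measure_mono h1)
      rw [prob_compl_eq_one_sub (measurableSet_deep u L)]
      refine tsub_pos_of_lt (hLe.trans_lt ?_)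
      simp
    simpa [S, Stay] using hpos L hL0

end

/-! ### Cut times -/

/-- `t` is a cut time of `f`: a strict record level which is never undercut afterwards. -/
def IsCut {d : ℕ} (u : Site d) (f : Path d) (t : ℕ) : Prop :=
  (∀ s < t, lev u (f s) < lev u (f t)) ∧ ∀ s, t ≤ s → lev u (f t) ≤ lev u (f s)

section
variable {d : ℕ} {μ : Measure (Path d)} {η : ℝ≥0∞} {u : Site d}

lemma tail_mem_stay_iff {n : ℕ} {f : Path d} :
    tail n f ∈ Stay u ↔ ∀ s, n ≤ s → lev u (f n) ≤ lev u (f s) := by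
  constructor
  · intro h s hs
    have h1 : 0 ≤ lev u (tail n f (s - n)) := h (s - n)
    simp only [tail, lev_sub, Nat.add_sub_cancel' hs] at h1
    omega
  · intro h k
    simp only [tail, lev_sub]
    have := h (n + k) (by omega)
    omega

/-- There is no cut time in the box of radius `K * h ^ B`. -/
def NoCut (u : Site d) (K B h : ℕ) : Set (Path d) :=
  {f | ¬ ∃ n, 1 ≤ n ∧ IsCut u f n ∧ ∀ m ≤ n, ∀ i, |f m i| ≤ ((K * h ^ B : ℕ) : ℤ)}

/-- The first `k` trial levels, multiples of `H`, are undercut, and `n` is the first time at which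
the next trial level is reached. -/
def Trial (u : Site d) (H : ℤ) (k n : ℕ) : Set (Path d) :=
  {f | f ∈ firstTime (reach u ((k + 1) * H)) n ∧ ∀ i < k, ∃ a b, a < b ∧ b < n ∧
    f ∈ firstTime (reach u ((i + 1) * H)) a ∧ (∀ m ≤ b, lev u (f m) < (i + 2) * H) ∧
    lev u (f b) < lev u (f a)}

lemma detBy_trial (u : Site d) (H : ℤ) (k n : ℕ) : DetBy n (Trial u H k n) := by
  rintro f g hfg ⟨h1, h2⟩
  refine ⟨detBy_firstTime (fun n => detBy_reach u _ n) n f g hfg h1, fun i hi => ?_⟩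
  obtain ⟨a, b, hab, hbn, ha, hb, hlt⟩ := h2 i hi
  refine ⟨a, b, hab, hbn, detBy_firstTime (fun n => detBy_reach u _ n) a f g
    (fun j hj => hfg j (by omega)) ha, fun m hm => hfg m (by omega) ▸ hb m hm, ?_⟩
  rw [← hfg a (by omega), ← hfg b (by omega)]
  exact hlt

lemma pairwise_disjoint_trial (u : Site d) (H : ℤ) (k : ℕ) :
    Pairwise (Function.onFun Disjoint (Trial u H k)) := fun _ _ hnm =>
  Set.disjoint_left.2 fun _ hn hm => hnm (firstTime_unique hn.1 hm.1)

lemma IsAnnealed.trial_step (h : IsAnnealed μ η) {H : ℤ} (hH : 0 ≤ H) (k : ℕ) :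
    μ (⋃ n, Trial u H (k + 1) n) + μ (Stay u) * μ (⋃ n, Trial u H k n) ≤
      μ (⋃ n, Trial u H k n) := by
  have hmeas : ∀ k n, MeasurableSet (Trial u H k n) := fun k n => (detBy_trial u H k n).measurableSet
  have e1 : μ (Stay u) * μ (⋃ n, Trial u H k n) = μ (⋃ n, Trial u H k n ∩ tail n ⁻¹' Stay u) := by
    rw [measure_iUnion (pairwise_disjoint_trial u H k) (hmeas k),
      measure_iUnion (fun n m hnm => (pairwise_disjoint_trial u H k hnm).mono Set.inter_subset_left
        Set.inter_subset_left) fun n => (hmeas k n).inter (measurable_tail n (measurableSet_stay u)),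
      ← ENNReal.tsum_mul_left]
    refine tsum_congr fun n => ?_
    rw [h.fresh u n _ (detBy_trial u H k n) (fun f hf i hi => ?_) _ (measurableSet_stay u)
      fun f hf => hf, mul_comm]
    have := mem_firstTime_reach.1 hf.1
    exact (this.2 i hi).trans_le this.1
  rw [e1, ← measure_union' _ (MeasurableSet.iUnion (hmeas (k + 1)))]
  · refine measure_mono (Set.union_subset ?_ (Set.iUnion_mono fun n => Set.inter_subset_left))
    refine Set.iUnion_subset fun n f hf => ?_
    obtain ⟨a, b, hab, hbn, ha, -⟩ := hf.2 k (by omega)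
    rw [Set.mem_iUnion]
    refine ⟨a, ha, fun i hi => ?_⟩
    obtain ⟨a', b', hab', hbn', ha', hb', hlt'⟩ := hf.2 i (by omega)
    refine ⟨a', b', hab', ?_, ha', hb', hlt'⟩
    by_contra hc
    have h1 := hb' a (by omega)
    have h2 := (mem_firstTime_reach.1 ha).1
    have h3 : ((i : ℤ) + 2) * H ≤ ((k : ℤ) + 1) * H := by gcongr ?_ * H; omega
    omega
  · refine Set.disjoint_left.2 fun f hf hf' => ?_
    obtain ⟨n, hn⟩ := Set.mem_iUnion.1 hf
    obtain ⟨n', hn', hs⟩ := Set.mem_iUnion.1 hf'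
    obtain ⟨a, b, hab, -, ha, -, hlt⟩ := hn.2 k (by omega)
    obtain rfl := firstTime_unique ha hn'.1
    have := tail_mem_stay_iff.1 hs b hab.le
    omega

/-- Cut times occur quickly. -/
lemma IsAnnealed.stretchedDecay_noCut (h : IsAnnealed μ η) (hB : Ballistic μ u) (hu : u ≠ 0) :
    ∃ K B : ℕ, StretchedDecay fun h => μ (NoCut u K B h) := by
  obtain ⟨A, hA, hdeep, hwide, hreach, hstay⟩ := h.ballistic hB hu
  have := h.prob
  obtain ⟨U, hU1, hU⟩ : ∃ U : ℕ, 1 ≤ U ∧ ∀ s, lev u (stepVec s) ≤ (U : ℤ) := by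
    refine ⟨1 + ∑ s : StepIdx d, (lev u (stepVec s)).natAbs, by omega, fun s => ?_⟩
    have : (lev u (stepVec s)).natAbs ≤ ∑ s : StepIdx d, (lev u (stepVec s)).natAbs :=
      Finset.single_le_sum (f := fun s : StepIdx d => (lev u (stepVec s)).natAbs)
        (fun _ _ => Nat.zero_le _) (Finset.mem_univ s)
    omega
  set K := (3 * (1 + U)) ^ A with hK
  have hLle : ∀ h : ℕ, 1 ≤ h → ((h + U) * (h + 2)) ^ A ≤ K * h ^ (2 * A) := by
    intro h hh
    rw [hK, pow_mul, ← mul_pow]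
    refine Nat.pow_le_pow_left ?_ A
    nlinarith [Nat.mul_le_mul hU1 hh, Nat.mul_le_mul_left U (Nat.mul_le_mul hh hh)]
  refine ⟨K, 2 * A, ?_⟩
  have h1 : StretchedDecay fun h : ℕ => (1 - μ (Stay u)) ^ h := stretchedDecay_geom
    (ENNReal.sub_lt_self ENNReal.one_ne_top one_ne_zero hstay.ne')
  have h2 : StretchedDecay fun h : ℕ => μ (Wide u A ((h + U) * (h + 2))) :=
    hwide.comp (φ := fun h => (h + U) * (h + 2)) fun h => by nlinarith
  have h3 := hdeep.pow_mul (2 * A * d + 1) (2 * (3 * K) ^ d)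
  refine ((h1.add h2).add h3).mono fun h' hh => ?_
  set L := (h' + U) * (h' + 2) with hL
  set H : ℤ := ((h' + U : ℕ) : ℤ) with hH
  have hH0 : 0 < H := by rw [hH]; omega
  set D : ℕ → Set (Path d) := fun k => {f | ∃ n, f ∈ firstTime (reach u ((k + 1) * H)) n ∧
    (∀ i, |f n i| ≤ ((L ^ A : ℕ) : ℤ)) ∧ tail n f ∈ Deep u h'} with hD
  have hDle : μ (⋃ k ∈ Finset.range (h' + 1), D k) ≤
      ((2 * (3 * K) ^ d * h' ^ (2 * A * d + 1) : ℕ) : ℝ≥0∞) * μ (Deep u h') := by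
    refine (measure_biUnion_finset_le _ _).trans ?_
    refine (Finset.sum_le_sum fun k _ => h.markov_box (detBy_firstTime fun n => detBy_reach u _ n)
      (pairwise_disjoint_firstTime _) (measurableSet_deep u h') _).trans ?_
    rw [Finset.sum_const, Finset.card_range, nsmul_eq_mul, ← mul_assoc, ← Nat.cast_mul]
    refine mul_le_mul_left (Nat.cast_le.2 ?_) _
    have hL1 : 1 ≤ L ^ A := Nat.one_le_pow _ _ (by positivity)
    have h4 : 2 * L ^ A + 1 ≤ 3 * K * h' ^ (2 * A) := by
      have := hLle h' hh
      rw [← hL] at this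
      linarith
    calc (h' + 1) * (2 * L ^ A + 1) ^ d ≤ (2 * h') * (3 * K * h' ^ (2 * A)) ^ d := by
          gcongr
          omega
      _ = _ := by rw [mul_pow, ← pow_mul]; ring
  have hTle : μ (⋃ n, Trial u H h' n) ≤ (1 - μ (Stay u)) ^ h' :=
    le_geom_of_add_mul_le prob_le_one prob_le_one (fun k => h.trial_step hH0.le k) h'
  refine le_trans ?_ (add_le_add (add_le_add hTle le_rfl) hDle)
  refine le_trans (measure_mono_ae (t := ((⋃ n, Trial u H h' n) ∪ Wide u A L) ∪
    ⋃ k ∈ Finset.range (h' + 1), D k) ?_) ((measure_union_le _ _).trans (by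
      gcongr; exact measure_union_le _ _))
  filter_upwards [h.start, h.steps, hreach] with f h0 hst hre hno
  by_contra hcon
  have hcon' : (f ∉ ⋃ n, Trial u H h' n) ∧ f ∉ Wide u A L ∧
      f ∉ ⋃ k ∈ Finset.range (h' + 1), D k := by
    refine ⟨fun hc => hcon (Or.inl (Or.inl hc)), fun hc => hcon (Or.inl (Or.inr hc)),
      fun hc => hcon (Or.inr hc)⟩
  have hnD : ∀ k ≤ h', f ∉ D k := by
    intro k hk hc
    exact hcon'.2.2 (Set.mem_biUnion (Finset.mem_coe.2 (Finset.mem_range.2 (by omega))) hc)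
  have hno' : ¬ ∃ n, 1 ≤ n ∧ IsCut u f n ∧
    ∀ m ≤ n, ∀ i, |f m i| ≤ ((K * h' ^ (2 * A) : ℕ) : ℤ) := hno
  have hLH : (L : ℤ) = ((h' : ℤ) + 2) * H := by rw [hL, hH]; push_cast; ring
  have hUH : (U : ℤ) + h' = H := by rw [hH]; push_cast; ring
  have hfirst : ∀ k ≤ h', ∀ n, f ∈ firstTime (reach u (((k : ℤ) + 1) * H)) n →
      1 ≤ n ∧ lev u (f n) < (k + 1) * H + U ∧ ∀ m ≤ n, lev u (f m) < L := by
    intro k hk n hn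
    rw [mem_firstTime_reach] at hn
    have hk0 : 0 < ((k : ℤ) + 1) * H := by positivity
    have hn1 : 1 ≤ n := by
      by_contra hc
      obtain rfl : n = 0 := by omega
      rw [h0, lev_zero] at hn
      omega
    have hkL : ((k : ℤ) + 1) * H + H ≤ L := by
      rw [hLH]
      have : ((k : ℤ) + 1) * H ≤ ((h' : ℤ) + 1) * H := by gcongr
      linarith
    obtain ⟨s, hs⟩ := hst (n - 1)
    rw [Nat.sub_add_cancel hn1] at hs
    have hlt : lev u (f n) < (k + 1) * H + U := by
      rw [hs, lev_add]
      have h5 := hn.2 (n - 1) (by omega)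
      have := hU s
      omega
    refine ⟨hn1, hlt, fun m hm => ?_⟩
    rcases hm.lt_or_eq with hm | rfl
    · have := hn.2 m hm
      omega
    · omega
  have hbox : ∀ k ≤ h', ∀ n, f ∈ firstTime (reach u (((k : ℤ) + 1) * H)) n →
      ∀ m ≤ n, ∀ i, |f m i| ≤ ((L ^ A : ℕ) : ℤ) := by
    intro k hk n hn m hm i
    by_contra hc
    refine hcon'.2.1 ⟨m, fun j hj => (hfirst k hk n hn).2.2 j (by omega), i, by omega⟩
  have key : ∀ k ≤ h', f ∈ ⋃ n, Trial u H k n := by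
    intro k
    induction k with
    | zero =>
      intro _
      obtain ⟨n, hn⟩ := hre H
      obtain ⟨t, -, ht⟩ := exists_firstTime (E := reach u (((0 : ℕ) + 1 : ℤ) * H)) (f := f)
        (n := n) (by simpa [reach] using hn)
      exact Set.mem_iUnion.2 ⟨t, ht, fun i hi => absurd hi (by omega)⟩
    | succ k ih =>
      intro hk
      obtain ⟨n, hn⟩ := Set.mem_iUnion.1 (ih (by omega))
      have hfn := hfirst k (by omega) n hn.1
      have hns : tail n f ∉ Stay u := by
        intro hs
        refine hno' ⟨n, hfn.1, ⟨fun s hs' => ?_, tail_mem_stay_iff.1 hs⟩, fun m hm i => ?_⟩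
        · have := mem_firstTime_reach.1 hn.1
          exact (this.2 s hs').trans_le this.1
        · exact (hbox k (by omega) n hn.1 m hm i).trans (by exact_mod_cast hLle h' hh)
      rw [tail_mem_stay_iff] at hns
      push Not at hns
      obtain ⟨b, hnb, hb⟩ := hns
      obtain ⟨N, hN⟩ := hre (((k + 1 : ℕ) + 1) * H)
      obtain ⟨t, -, ht⟩ := exists_firstTime (E := reach u (((k + 1 : ℕ) + 1 : ℤ) * H)) (f := f)
        (n := N) hN
      have htr := mem_firstTime_reach.1 ht
      push_cast at htr
      have hbt : b < t := by
        by_contra hc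
        refine hnD (k + 1) hk ⟨t, ht, hbox (k + 1) hk t ht t le_rfl, b - t, ?_⟩
        simp only [tail, lev_sub, Nat.add_sub_cancel' (not_lt.1 hc)]
        have h6 : ((k : ℤ) + 1 + 1) * H = (k + 1) * H + H := by ring
        rw [h6] at htr
        omega
      have hnt : n < b := lt_of_le_of_ne hnb (by rintro rfl; exact lt_irrefl _ hb)
      refine Set.mem_iUnion.2 ⟨t, ht, fun i hi => ?_⟩
      rcases Nat.lt_or_ge i k with hik | hik
      · obtain ⟨a', b', hab', hbn', h''⟩ := hn.2 i hik
        exact ⟨a', b', hab', by omega, h''⟩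
      · obtain rfl : i = k := by omega
        refine ⟨n, b, hnt, hbt, hn.1, fun m hm => ?_, hb⟩
        have := htr.2 m (by omega)
        linarith
  exact hcon'.1 (key h' le_rfl)

end

/-! ### Renewal structure -/

section
variable {d : ℕ} {μ : Measure (Path d)} {η : ℝ≥0∞} {u : Site d}

/-- The first positive cut time. -/
def cutTime (u : Site d) (f : Path d) : ℕ := sInf {n | 1 ≤ n ∧ IsCut u f n}

/-- Displacement and duration of the first block. -/
def blk (u : Site d) (f : Path d) : Site d × ℤ := (f (cutTime u f) - f 0, (cutTime u f : ℤ))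

/-- The path after the first block. -/
def nxt (u : Site d) (f : Path d) : Path d := tail (cutTime u f) f

/-- `n` is a record time and no earlier positive time is a cut time of the path up to `n`. -/
def FirstRec (u : Site d) (n : ℕ) : Set (Path d) :=
  {f | (∀ s < n, lev u (f s) < lev u (f n)) ∧ ∀ t, 1 ≤ t → t < n →
    ¬ ((∀ s < t, lev u (f s) < lev u (f t)) ∧ ∀ s, t ≤ s → s ≤ n → lev u (f t) ≤ lev u (f s))}

lemma detBy_firstRec (u : Site d) (n : ℕ) : DetBy n (FirstRec u n) := by
  rintro f g hfg ⟨h1, h2⟩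
  refine ⟨fun s hs => ?_, fun t ht htn hc => h2 t ht htn ⟨fun s hs => ?_, fun s hs hsn => ?_⟩⟩
  · rw [← hfg s hs.le, ← hfg n le_rfl]
    exact h1 s hs
  · rw [hfg s (by omega), hfg t htn.le]
    exact hc.1 s hs
  · rw [hfg s hsn, hfg t htn.le]
    exact hc.2 s hs hsn

lemma cutTime_spec {f : Path d} (h : ∃ n, 1 ≤ n ∧ IsCut u f n) :
    1 ≤ cutTime u f ∧ IsCut u f (cutTime u f) :=
  Nat.sInf_mem (s := {n | 1 ≤ n ∧ IsCut u f n}) h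

lemma cutTime_le {f : Path d} {n : ℕ} (h1 : 1 ≤ n) (h : IsCut u f n) : cutTime u f ≤ n :=
  Nat.sInf_le (s := {n | 1 ≤ n ∧ IsCut u f n}) ⟨h1, h⟩

lemma cutTime_eq_iff {f : Path d} {n : ℕ} (hn : 1 ≤ n) :
    cutTime u f = n ↔ f ∈ FirstRec u n ∧ tail n f ∈ Stay u := by
  constructor
  · rintro rfl
    have hne : ∃ n, 1 ≤ n ∧ IsCut u f n := Nat.nonempty_of_pos_sInf hn
    have hs := (cutTime_spec hne).2
    refine ⟨⟨hs.1, fun t ht htn hc => ?_⟩, tail_mem_stay_iff.2 hs.2⟩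
    refine absurd (cutTime_le ht ⟨hc.1, fun s hs' => ?_⟩) (by omega)
    rcases le_total s (cutTime u f) with h | h
    · exact hc.2 s hs' h
    · exact (hc.2 _ htn.le le_rfl).trans (hs.2 s h)
  · rintro ⟨h1, h2⟩
    have hcut : IsCut u f n := ⟨h1.1, tail_mem_stay_iff.1 h2⟩
    refine le_antisymm (cutTime_le hn hcut) ?_
    by_contra hc
    have hs := cutTime_spec ⟨n, hn, hcut⟩
    exact h1.2 _ hs.1 (not_le.1 hc) ⟨hs.2.1, fun s h _ => hs.2.2 s h⟩

lemma measurableSet_noCut (u : Site d) (K B h : ℕ) : MeasurableSet (NoCut u K B h) := by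
  refine measurableSet_setOfPred.2 ?_
  unfold IsCut
  fun_prop

lemma measurable_cutTime : Measurable (cutTime u) := by
  refine measurable_to_countable' fun n => ?_
  rcases Nat.eq_zero_or_pos n with rfl | hn
  · have : cutTime u ⁻¹' {0} = (⋃ n : ℕ, cutTime u ⁻¹' {n + 1})ᶜ := by
      ext f
      simp only [Set.mem_preimage, Set.mem_singleton_iff, Set.mem_compl_iff, Set.mem_iUnion,
        not_exists]
      constructor
      · intro h n
        omega
      · intro h
        by_contra hc
        exact h (cutTime u f - 1) (by omega)
    rw [this]
    refine (MeasurableSet.iUnion fun n => ?_).compl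
    have : cutTime u ⁻¹' {n + 1} = FirstRec u (n + 1) ∩ tail (n + 1) ⁻¹' Stay u := by
      ext f
      exact cutTime_eq_iff (by omega)
    rw [this]
    exact (detBy_firstRec u _).measurableSet.inter (measurable_tail _ (measurableSet_stay u))
  · have : cutTime u ⁻¹' {n} = FirstRec u n ∩ tail n ⁻¹' Stay u := by
      ext f
      exact cutTime_eq_iff hn
    rw [this]
    exact (detBy_firstRec u _).measurableSet.inter (measurable_tail _ (measurableSet_stay u))

lemma measurable_eval_nat : Measurable fun p : ℕ × Path d => p.2 p.1 :=
  measurable_from_prod_countable_right fun n => measurable_pi_apply n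

lemma measurable_nxt : Measurable (nxt u) := by
  refine measurable_pi_lambda _ fun k => ?_
  have h1 : Measurable fun f : Path d => f (cutTime u f + k) := measurable_eval_nat.comp
    ((measurable_cutTime.add_const k).prodMk measurable_id)
  have h2 : Measurable fun f : Path d => f (cutTime u f) := measurable_eval_nat.comp
    (measurable_cutTime.prodMk measurable_id)
  exact h1.sub h2

lemma measurable_blk : Measurable (blk u) := by
  have h2 : Measurable fun f : Path d => f (cutTime u f) := measurable_eval_nat.comp
    (measurable_cutTime.prodMk measurable_id)
  exact (h2.sub (measurable_pi_apply 0)).prodMk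
    ((Measurable.of_discrete (f := fun n : ℕ => (n : ℤ))).comp measurable_cutTime)

/-- The renewal property of the first cut time. -/
lemma IsAnnealed.renewal (h : IsAnnealed μ η) {n : ℕ} (hn : 1 ≤ n) {S : Set (Path d)}
    (hS : DetBy n S) {A : Set (Path d)} (hA : MeasurableSet A) (hp : 0 < μ (Stay u)) :
    μ ({f | cutTime u f = n} ∩ S ∩ nxt u ⁻¹' A) =
      μ ({f | cutTime u f = n} ∩ S) * ProbabilityTheory.cond μ (Stay u) A := by
  have := h.prob
  have hrec : ∀ f ∈ FirstRec u n ∩ S, ∀ i < n, lev u (f i) < lev u (f n) := fun f hf => hf.1.1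
  have hd := (detBy_firstRec u n).inter hS
  have e1 : {f | cutTime u f = n} ∩ S ∩ nxt u ⁻¹' A =
      (FirstRec u n ∩ S) ∩ tail n ⁻¹' (Stay u ∩ A) := by
    ext f
    simp only [Set.mem_inter_iff, Set.mem_ofPred_eq, Set.mem_preimage, nxt]
    constructor
    · rintro ⟨⟨h1, h2⟩, h3⟩
      rw [h1] at h3
      rw [cutTime_eq_iff hn] at h1
      exact ⟨⟨h1.1, h2⟩, h1.2, h3⟩
    · rintro ⟨⟨h1, h2⟩, h3, h4⟩
      have h5 := (cutTime_eq_iff hn).2 ⟨h1, h3⟩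
      exact ⟨⟨h5, h2⟩, h5.symm ▸ h4⟩
  have e2 : {f | cutTime u f = n} ∩ S = (FirstRec u n ∩ S) ∩ tail n ⁻¹' (Stay u) := by
    ext f
    simp only [Set.mem_inter_iff, Set.mem_ofPred_eq, Set.mem_preimage, cutTime_eq_iff hn]
    tauto
  rw [e1, e2, h.fresh u n _ hd hrec _ ((measurableSet_stay u).inter hA) fun f hf => hf.1,
    h.fresh u n _ hd hrec _ (measurableSet_stay u) fun f hf => hf,
    ProbabilityTheory.cond_apply (measurableSet_stay u), mul_assoc, ← mul_assoc (μ (Stay u)),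
    ENNReal.mul_inv_cancel hp.ne' (measure_ne_top _ _), one_mul]

lemma IsAnnealed.renewal_cond (h : IsAnnealed μ η) {n : ℕ} (hn : 1 ≤ n) {S : Set (Path d)}
    (hS : DetBy n S) {A : Set (Path d)} (hA : MeasurableSet A) (hp : 0 < μ (Stay u)) :
    ProbabilityTheory.cond μ (Stay u) ({f | cutTime u f = n} ∩ S ∩ nxt u ⁻¹' A) =
      ProbabilityTheory.cond μ (Stay u) ({f | cutTime u f = n} ∩ S) *
        ProbabilityTheory.cond μ (Stay u) A := by
  set S' : Set (Path d) := {f | ∀ m ≤ n, 0 ≤ lev u (f m)} with hS'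
  have hd : DetBy n (S' ∩ S) := by
    refine DetBy.inter ?_ hS
    intro f g hfg hf m hm
    exact hfg m hm ▸ hf m hm
  have key : {f | cutTime u f = n} ∩ S' = {f | cutTime u f = n} ∩ Stay u := by
    ext f
    simp only [Set.mem_inter_iff, Set.mem_ofPred_eq]
    refine and_congr_right fun h1 => ⟨fun h2 k => ?_, fun h2 m _ => h2 m⟩
    have h3 := tail_mem_stay_iff.1 ((cutTime_eq_iff hn).1 h1).2
    rcases le_total k n with hk | hk
    · exact h2 k hk
    · exact (h2 n le_rfl).trans (h3 k hk)
  have e : ∀ X : Set (Path d), Stay u ∩ ({f | cutTime u f = n} ∩ X) =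
      {f | cutTime u f = n} ∩ S' ∩ X := by
    intro X
    rw [key, ← Set.inter_assoc, Set.inter_comm (Stay u)]
  have h1 := h.renewal hn hd hA hp
  rw [ProbabilityTheory.cond_apply (measurableSet_stay u), Set.inter_assoc, e,
    ProbabilityTheory.cond_apply (measurableSet_stay u), e, Set.inter_assoc, Set.inter_assoc,
    ← Set.inter_assoc S', ← Set.inter_assoc, h1, mul_assoc]

end

/-- The annealed law `μ` and the block law `Q` of a walk with renewal structure. -/
structure IsRenewal {d : ℕ} (μ Q : Measure (Path d)) (u : Site d) (K B : ℕ) : Prop where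
  prob : IsProbabilityMeasure μ
  prob' : IsProbabilityMeasure Q
  start : ∀ᵐ f ∂μ, f 0 = 0
  steps : ∀ᵐ f ∂μ, ∀ n, ∃ s, f (n + 1) = f n + stepVec s
  abs_cont : Q ≪ μ
  indep : ∀ g A, MeasurableSet A → μ {f | blk u f = g ∧ nxt u f ∈ A} = μ {f | blk u f = g} * Q A
  indep' : ∀ g A, MeasurableSet A → Q {f | blk u f = g ∧ nxt u f ∈ A} = Q {f | blk u f = g} * Q A
  noCut : StretchedDecay fun h => μ (NoCut u K B h)
  noCut' : StretchedDecay fun h => Q (NoCut u K B h)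
  atom : ∀ s, 0 < lev u (stepVec s) → 0 < Q {f | blk u f = (stepVec s, 1)} ∧
    ∀ k : ℕ, 1 ≤ k → 0 < Q {f | blk u f = ((2 : ℤ) • stepVec s, 2 * (k : ℤ) + 2)}

section
variable {d : ℕ} {μ : Measure (Path d)} {η : ℝ≥0∞} {u : Site d}

/-- Prescribing the first steps by a list. -/
def Follows (A : Set (Path d)) : List (StepIdx d) → Set (Path d)
  | [] => A
  | s :: l => {f | f 1 = f 0 + stepVec s} ∩ tail 1 ⁻¹' Follows A l

lemma measurableSet_follows {A : Set (Path d)} (hA : MeasurableSet A) (l : List (StepIdx d)) :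
    MeasurableSet (Follows A l) := by
  induction l with
  | nil => exact hA
  | cons s l ih =>
    refine MeasurableSet.inter (measurableSet_setOfPred.2 ?_) (measurable_tail 1 ih)
    fun_prop

lemma IsAnnealed.follows_pos (h : IsAnnealed μ η) {A : Set (Path d)} (hA : MeasurableSet A)
    (hp : 0 < μ A) (l : List (StepIdx d)) : 0 < μ (Follows A l) := by
  induction l with
  | nil => exact hp
  | cons s l ih =>
    exact (ENNReal.mul_pos h.pos.ne' ih.ne').trans_le (h.first_step s _ (measurableSet_follows hA l))

lemma follows_spec {A : Set (Path d)} {l : List (StepIdx d)} {f : Path d} (hf : f ∈ Follows A l)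
    (h0 : f 0 = 0) : (∀ k ≤ l.length, f k = ((l.take k).map stepVec).sum) ∧ tail l.length f ∈ A := by
  induction l generalizing f with
  | nil =>
    refine ⟨fun k hk => ?_, ?_⟩
    · obtain rfl : k = 0 := by simpa using hk
      simpa using h0
    · have : tail 0 f = f := by
        funext k
        simp [tail, h0]
      simpa [this, Follows] using hf
  | cons s l ih =>
    obtain ⟨h1, h2⟩ := hf
    have h1' : f 1 = stepVec s := by simpa [h0] using h1
    obtain ⟨h3, h4⟩ := ih h2 (by simp [tail])
    refine ⟨fun k hk => ?_, ?_⟩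
    · rcases k with _ | k
      · simpa using h0
      · have := h3 k (by simpa using hk)
        simp only [tail, h1'] at this
        simp only [List.take_succ_cons, List.map_cons, List.sum_cons, ← this, add_comm 1 k]
        abel
    · convert h4 using 1
      funext k
      simp only [tail, List.length_cons]
      rw [show l.length + 1 + k = 1 + (l.length + k) by ring, add_comm l.length 1]
      abel

/-- The steps of the zigzag path `0, a, 0, a, …, 0, a, 2a`. -/
def zigzag (s : StepIdx d) : ℕ → List (StepIdx d)
  | 0 => [s, s]
  | k + 1 => s :: (s.1, !s.2) :: zigzag s k

lemma stepVec_not (s : StepIdx d) : stepVec (s.1, !s.2) = - stepVec s := by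
  rw [stepVec_eq_single, stepVec_eq_single, ← Pi.single_neg]
  rcases s with ⟨i, b⟩
  cases b <;> simp

lemma length_zigzag (s : StepIdx d) (k : ℕ) : (zigzag s k).length = 2 * k + 2 := by
  induction k with
  | zero => rfl
  | succ k ih => simp [zigzag, ih]; ring

lemma zigzag_sum (s : StepIdx d) (k j : ℕ) (hj : j < 2 * k + 2) :
    (((zigzag s k).take j).map stepVec).sum = ((j % 2 : ℕ) : ℤ) • stepVec s := by
  induction k generalizing j with
  | zero =>
    interval_cases j <;> simp [zigzag]
  | succ k ih =>
    match j with
    | 0 => simp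
    | 1 => simp [zigzag]
    | j + 2 =>
      simp only [zigzag, List.take_succ_cons, List.map_cons, List.sum_cons, stepVec_not,
        ih j (by omega), add_neg_cancel_left]
      congr 2
      omega

lemma zigzag_sum_all (s : StepIdx d) (k : ℕ) :
    ((zigzag s k).map stepVec).sum = (2 : ℤ) • stepVec s := by
  induction k with
  | zero => simp [zigzag, two_smul]
  | succ k ih => simp [zigzag, ih, stepVec_not]

lemma IsAnnealed.atoms (h : IsAnnealed μ η) (hp : 0 < μ (Stay u)) {s : StepIdx d}
    (hs : 0 < lev u (stepVec s)) :
    0 < ProbabilityTheory.cond μ (Stay u) {f | blk u f = (stepVec s, 1)} ∧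
    ∀ k : ℕ, 1 ≤ k → 0 < ProbabilityTheory.cond μ (Stay u)
      {f | blk u f = ((2 : ℤ) • stepVec s, 2 * (k : ℤ) + 2)} := by
  have := h.prob
  have hpos : ∀ (l : List (StepIdx d)) (X : Set (Path d)),
      (∀ f ∈ Follows (Stay u) l, f 0 = 0 → f ∈ Stay u ∧ f ∈ X) →
      0 < ProbabilityTheory.cond μ (Stay u) X := by
    intro l X hX
    rw [ProbabilityTheory.cond_apply (measurableSet_stay u)]
    refine ENNReal.mul_pos (ENNReal.inv_ne_zero.2 (measure_ne_top _ _)) ?_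
    refine (lt_of_lt_of_le (h.follows_pos (measurableSet_stay u) hp l) (measure_mono_ae ?_)).ne'
    filter_upwards [h.start] with f h0 hf
    exact hX f hf h0
  have stay_of : ∀ (n : ℕ) (f : Path d), (∀ k ≤ n, 0 ≤ lev u (f k)) → tail n f ∈ Stay u →
      f ∈ Stay u := by
    intro n f h1 h2 k
    rcases le_total k n with hk | hk
    · exact h1 k hk
    · exact (h1 n le_rfl).trans (tail_mem_stay_iff.1 h2 k hk)
  refine ⟨hpos [s] _ fun f hf h0 => ?_, fun k hk => hpos (zigzag s k) _ fun f hf h0 => ?_⟩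
  · obtain ⟨h1, h2⟩ := follows_spec hf h0
    have hf1 : f 1 = stepVec s := by simpa using h1 1 (by simp)
    have h2' : tail 1 f ∈ Stay u := by simpa using h2
    refine ⟨stay_of 1 f (fun k hk => ?_) h2', ?_⟩
    · interval_cases k
      · simp [h0]
      · rw [hf1]
        exact hs.le
    · have hc : cutTime u f = 1 := (cutTime_eq_iff le_rfl).2 ⟨⟨fun t ht => by
        obtain rfl : t = 0 := by omega
        simpa [h0, hf1] using hs, fun t h1 h2 => by omega⟩, h2'⟩
      simp [blk, hc, h0, hf1]
  · obtain ⟨h1, h2⟩ := follows_spec hf h0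
    rw [length_zigzag] at h1 h2
    have hlast : f (2 * k + 2) = (2 : ℤ) • stepVec s := by
      rw [h1 _ le_rfl, ← length_zigzag s k, List.take_length, zigzag_sum_all]
    have hmid : ∀ j < 2 * k + 2, f j = ((j % 2 : ℕ) : ℤ) • stepVec s := fun j hj => by
      rw [h1 j hj.le, zigzag_sum s k j hj]
    have hlm : ∀ j < 2 * k + 2, lev u (f j) = ((j % 2 : ℕ) : ℤ) * lev u (stepVec s) :=
      fun j hj => by rw [hmid j hj, lev_smul]
    have hll : lev u (f (2 * k + 2)) = 2 * lev u (stepVec s) := by rw [hlast, lev_smul]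
    have hmod : ∀ j, ((j % 2 : ℕ) : ℤ) = 0 ∨ ((j % 2 : ℕ) : ℤ) = 1 := by intro j; omega
    refine ⟨stay_of (2 * k + 2) f (fun j hj => ?_) h2, ?_⟩
    · rcases hj.lt_or_eq with hj | rfl
      · rw [hlm j hj]
        positivity
      · rw [hll]
        positivity
    · have hc : cutTime u f = 2 * k + 2 := by
        refine (cutTime_eq_iff (by omega)).2 ⟨⟨fun t ht => ?_, fun t ht1 ht2 hcut => ?_⟩, h2⟩
        · rw [hlm t ht, hll]
          rcases hmod t with h | h <;> rw [h] <;> linarith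
        · obtain ⟨hc1, hc2⟩ := hcut
          rcases Nat.even_or_odd' t with ⟨j, rfl | rfl⟩
          · have := hc1 0 (by omega)
            rw [hlm 0 (by omega), hlm (2 * j) ht2] at this
            simp at this
          · by_cases hj : j = 0
            · subst hj
              have := hc2 2 (by omega) (by omega)
              rw [hlm 2 (by omega), hlm (2 * 0 + 1) ht2] at this
              simp at this
              omega
            · have := hc1 1 (by omega)
              rw [hlm 1 (by omega), hlm (2 * j + 1) ht2] at this
              have e : (2 * j + 1) % 2 = 1 := by omega
              simp [e] at this
      simp [blk, hc, h0, hlast]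

theorem IsAnnealed.isRenewal (h : IsAnnealed μ η) (hB : Ballistic μ u) (hu : u ≠ 0) :
    ∃ Q K B, IsRenewal μ Q u K B := by
  obtain ⟨K, B, hno⟩ := h.stretchedDecay_noCut hB hu
  obtain ⟨A, -, -, -, -, hp⟩ := h.ballistic hB hu
  have hprob := h.prob
  have hprob' := ProbabilityTheory.cond_isProbabilityMeasure (μ := μ) hp.ne'
  have hac : ProbabilityTheory.cond μ (Stay u) ≪ μ := ProbabilityTheory.cond_absolutelyContinuous
  have hcut : ∀ᵐ f ∂μ, ∃ n, 1 ≤ n ∧ IsCut u f n := by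
    rw [ae_iff]
    refine hno.eq_zero_of_le fun h' _ => measure_mono fun f hf hc => hf ?_
    obtain ⟨n, hn, hc, -⟩ := hc
    exact ⟨n, hn, hc⟩
  have hindep : ∀ κ : Measure (Path d), κ ≪ μ → (∀ n, 1 ≤ n → ∀ S, DetBy n S →
      ∀ A, MeasurableSet A → κ ({f | cutTime u f = n} ∩ S ∩ nxt u ⁻¹' A) =
      κ ({f | cutTime u f = n} ∩ S) * ProbabilityTheory.cond μ (Stay u) A) →
      ∀ g A, MeasurableSet A → κ {f | blk u f = g ∧ nxt u f ∈ A} =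
        κ {f | blk u f = g} * ProbabilityTheory.cond μ (Stay u) A := by
    intro κ hκ hren g A hA
    by_cases hg : 1 ≤ g.2
    · have hg' : 1 ≤ g.2.toNat := by omega
      have e : ∀ f, blk u f = g ↔ cutTime u f = g.2.toNat ∧ f g.2.toNat - f 0 = g.1 := by
        intro f
        rw [Prod.ext_iff]
        simp only [blk]
        constructor
        · rintro ⟨h1, h2⟩
          have : cutTime u f = g.2.toNat := by omega
          exact ⟨this, this ▸ h1⟩
        · rintro ⟨h1, h2⟩
          exact ⟨h1.symm ▸ h2, by omega⟩
      have hd : DetBy g.2.toNat {f : Path d | f g.2.toNat - f 0 = g.1} := by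
        intro f f' hff hf
        have hf' : f g.2.toNat - f 0 = g.1 := hf
        rw [hff _ le_rfl, hff 0 (Nat.zero_le _)] at hf'
        exact hf'
      have := hren _ hg' _ hd A hA
      convert this using 2
      · ext f
        simp only [Set.mem_inter_iff, Set.mem_ofPred_eq, Set.mem_preimage, e]
      · congr 1
        ext f
        simp only [Set.mem_inter_iff, Set.mem_ofPred_eq, e]
    · have hz : κ {f | blk u f = g} = 0 := by
        refine measure_mono_null ?_ (ae_iff.1 (hκ.ae_le hcut))
        intro f hf hc
        have h1 := (cutTime_spec hc).1
        have h2 : blk u f = g := hf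
        rw [← h2] at hg
        simp only [blk] at hg
        omega
      rw [hz, zero_mul]
      exact measure_mono_null (fun f hf => hf.1) hz
  refine ⟨ProbabilityTheory.cond μ (Stay u), K, B, hprob, hprob', h.start, h.steps, hac,
    hindep μ Measure.AbsolutelyContinuous.rfl
      (fun n hn S hS A hA => h.renewal hn hS hA hp),
    hindep _ hac (fun n hn S hS A hA => h.renewal_cond hn hS hA hp), hno, ?_,
    fun s hs => h.atoms hp hs⟩
  obtain ⟨δ, hδ, C, hC, hle⟩ := hno
  have hpt : (μ (Stay u))⁻¹ ≠ ∞ := ENNReal.inv_ne_top.2 hp.ne'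
  refine ⟨δ, hδ, (μ (Stay u))⁻¹.toReal * C, by positivity, fun L hL => ?_⟩
  beta_reduce
  rw [ProbabilityTheory.cond_apply (measurableSet_stay u), mul_assoc,
    ENNReal.ofReal_mul ENNReal.toReal_nonneg, ENNReal.ofReal_toReal hpt]
  gcongr
  exact (measure_mono Set.inter_subset_right).trans (hle L hL)

end

/-! ### Smoothing by convolution powers -/

section
variable {G : Type*} [AddCommGroup G] {φ : G →+ ℤ}

/-- The operator of convolution with `p`. -/
def conv (p F : G → ℝ≥0∞) (x : G) : ℝ≥0∞ := ∑' g, p g * F (x - g)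

/-- The sum over the levels of `φ` of the supremum of `F` on the level. -/
def lnorm (φ : G →+ ℤ) (F : G → ℝ≥0∞) : ℝ≥0∞ := ∑' a : ℤ, ⨆ (x : G) (_ : φ x = a), F x

/-- The distance of two extended nonnegative numbers. -/
def adist (a b : ℝ≥0∞) : ℝ≥0∞ := (a - b) + (b - a)

lemma le_add_adist (a b : ℝ≥0∞) : a ≤ b + adist a b :=
  le_add_tsub.trans (by unfold adist; gcongr; exact le_self_add)

lemma adist_comm (a b : ℝ≥0∞) : adist a b = adist b a := add_comm _ _

lemma adist_triangle (a b c : ℝ≥0∞) : adist a c ≤ adist a b + adist b c := by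
  unfold adist
  calc (a - c) + (c - a) ≤ ((a - b) + (b - c)) + ((c - b) + (b - a)) :=
        add_le_add tsub_le_tsub_add_tsub tsub_le_tsub_add_tsub
    _ = _ := by ring

lemma adist_add_le (a b a' b' : ℝ≥0∞) : adist (a + a') (b + b') ≤ adist a b + adist a' b' := by
  unfold adist
  calc (a + a' - (b + b')) + (b + b' - (a + a'))
      ≤ ((a - b) + (a' - b')) + ((b - a) + (b' - a')) :=
        add_le_add add_tsub_add_le_tsub_add_tsub add_tsub_add_le_tsub_add_tsub
    _ = _ := by ring

lemma adist_mul_le (c a b : ℝ≥0∞) : adist (c * a) (c * b) ≤ c * adist a b := by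
  unfold adist
  rw [mul_add]
  refine add_le_add ?_ ?_ <;> rw [tsub_le_iff_right, ← mul_add] <;> gcongr <;> exact le_tsub_add

lemma adist_tsum_le {ι : Type*} (a b : ι → ℝ≥0∞) :
    adist (∑' i, a i) (∑' i, b i) ≤ ∑' i, adist (a i) (b i) := by
  unfold adist
  rw [ENNReal.tsum_add]
  refine add_le_add ?_ ?_ <;> rw [tsub_le_iff_right, ← ENNReal.tsum_add] <;>
    exact ENNReal.tsum_le_tsum fun i => le_tsub_add

lemma lnorm_mono {F F' : G → ℝ≥0∞} (h : ∀ x, F x ≤ F' x) : lnorm φ F ≤ lnorm φ F' :=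
  ENNReal.tsum_le_tsum fun _ => iSup₂_mono fun x _ => h x

lemma lnorm_tsum_le {ι : Type*} (F : ι → G → ℝ≥0∞) :
    lnorm φ (fun x => ∑' i, F i x) ≤ ∑' i, lnorm φ (F i) := by
  unfold lnorm
  rw [ENNReal.tsum_comm]
  exact ENNReal.tsum_le_tsum fun a => iSup₂_le fun x hx => ENNReal.tsum_le_tsum fun i =>
    le_iSup₂ (f := fun x (_ : φ x = a) => F i x) x hx

lemma lnorm_add_le (F F' : G → ℝ≥0∞) : lnorm φ (fun x => F x + F' x) ≤ lnorm φ F + lnorm φ F' := by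
  unfold lnorm
  rw [← ENNReal.tsum_add]
  exact ENNReal.tsum_le_tsum fun a => iSup₂_le fun x hx => add_le_add
    (le_iSup₂ (f := fun x (_ : φ x = a) => F x) x hx)
    (le_iSup₂ (f := fun x (_ : φ x = a) => F' x) x hx)

lemma lnorm_mul_le (c : ℝ≥0∞) (F : G → ℝ≥0∞) : lnorm φ (fun x => c * F x) ≤ c * lnorm φ F := by
  unfold lnorm
  rw [← ENNReal.tsum_mul_left]
  exact ENNReal.tsum_le_tsum fun a => iSup₂_le fun x hx =>
    mul_le_mul_right (le_iSup₂ (f := fun x (_ : φ x = a) => F x) x hx) c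

lemma lnorm_shift_le (g : G) (F : G → ℝ≥0∞) : lnorm φ (fun x => F (x - g)) ≤ lnorm φ F := by
  unfold lnorm
  rw [← (Equiv.subRight (φ g)).tsum_eq (fun a => ⨆ (x : G) (_ : φ x = a), F x)]
  exact ENNReal.tsum_le_tsum fun a => iSup₂_le fun x hx =>
    le_iSup₂ (f := fun y (_ : φ y = (Equiv.subRight (φ g)) a) => F y) (x - g) (by simp [hx])

lemma lnorm_conv_le (p F : G → ℝ≥0∞) : lnorm φ (conv p F) ≤ (∑' g, p g) * lnorm φ F := by
  refine (lnorm_tsum_le _).trans ?_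
  rw [← ENNReal.tsum_mul_right]
  exact ENNReal.tsum_le_tsum fun g => (lnorm_mul_le _ _).trans
    (mul_le_mul_right (lnorm_shift_le g F) _)

lemma conv_mono (p : G → ℝ≥0∞) {F F' : G → ℝ≥0∞} (h : ∀ x, F x ≤ F' x) (x : G) :
    conv p F x ≤ conv p F' x :=
  ENNReal.tsum_le_tsum fun _ => mul_le_mul_right (h _) _

lemma adist_conv_le (p F F' : G → ℝ≥0∞) (x : G) :
    adist (conv p F x) (conv p F' x) ≤ conv p (fun y => adist (F y) (F' y)) x :=
  (adist_tsum_le _ _).trans (ENNReal.tsum_le_tsum fun _ => adist_mul_le _ _ _)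

/-- `Nr φ F τ` measures the change of `F` under the shift by `τ`. -/
def Nr (φ : G →+ ℤ) (F : G → ℝ≥0∞) (τ : G) : ℝ≥0∞ := lnorm φ fun x => adist (F x) (F (x - τ))

lemma nr_add_le (F : G → ℝ≥0∞) (τ τ' : G) : Nr φ F (τ + τ') ≤ Nr φ F τ + Nr φ F τ' := by
  refine (lnorm_mono fun x => adist_triangle _ (F (x - τ)) _).trans
    ((lnorm_add_le _ _).trans (add_le_add le_rfl ?_))
  refine le_trans (le_of_eq ?_) (lnorm_shift_le τ _)
  congr 1
  funext x
  rw [sub_sub]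

lemma nr_neg_le (F : G → ℝ≥0∞) (τ : G) : Nr φ F (-τ) ≤ Nr φ F τ := by
  refine le_trans (le_of_eq ?_) (lnorm_shift_le (-τ) _)
  unfold Nr
  congr 1
  funext x
  rw [adist_comm]
  simp

lemma nr_conv_le (p F : G → ℝ≥0∞) (τ : G) : Nr φ (conv p F) τ ≤ (∑' g, p g) * Nr φ F τ := by
  refine le_trans (lnorm_mono fun x => ?_) (lnorm_conv_le p _)
  have : conv p F (x - τ) = conv p (fun y => F (y - τ)) x :=
    tsum_congr fun g => by rw [sub_right_comm]
  rw [this]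
  exact adist_conv_le _ _ _ _

/-- Averaging over the shift by `τ`. -/
def avg (τ : G) (F : G → ℝ≥0∞) (x : G) : ℝ≥0∞ := 2⁻¹ * (F x + F (x - τ))

lemma iterate_avg (τ : G) (F : G → ℝ≥0∞) (k : ℕ) (x : G) : (avg τ)^[k] F x =
    ∑ j ∈ Finset.range (k + 1), (k.choose j : ℝ≥0∞) * 2⁻¹ ^ k * F (x - j • τ) := by
  induction k generalizing x with
  | zero => simp
  | succ k ih =>
    rw [Function.iterate_succ_apply', avg, ih, ih, Finset.sum_range_succ' _ (k + 1)]
    have e : ∑ j ∈ Finset.range (k + 1), (k.choose j : ℝ≥0∞) * 2⁻¹ ^ k * F (x - j • τ) =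
        ∑ j ∈ Finset.range (k + 1), (k.choose (j + 1) : ℝ≥0∞) * 2⁻¹ ^ k * F (x - (j + 1) • τ) +
          2⁻¹ ^ k * F x := by
      rw [Finset.sum_range_succ' _ k, Finset.sum_range_succ _ k]
      simp
    have e' : ∑ j ∈ Finset.range (k + 1), ((k + 1).choose (j + 1) : ℝ≥0∞) * 2⁻¹ ^ (k + 1) *
        F (x - (j + 1) • τ) = ∑ j ∈ Finset.range (k + 1), ((k.choose j : ℝ≥0∞) * 2⁻¹ ^ (k + 1) *
        F (x - (j + 1) • τ) + (k.choose (j + 1) : ℝ≥0∞) * 2⁻¹ ^ (k + 1) * F (x - (j + 1) • τ)) :=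
      Finset.sum_congr rfl fun j _ => by rw [Nat.choose_succ_succ, Nat.cast_add, add_mul, add_mul]
    rw [e, e', Finset.sum_add_distrib, mul_add, mul_add, Finset.mul_sum, Finset.mul_sum]
    simp only [sub_sub, add_smul, one_smul, Nat.choose_zero_right, Nat.cast_one, one_mul,
      zero_smul, sub_zero]
    have h1 : ∀ j, 2⁻¹ * ((k.choose j : ℝ≥0∞) * 2⁻¹ ^ k * F (x - (τ + j • τ))) =
        (k.choose j : ℝ≥0∞) * 2⁻¹ ^ (k + 1) * F (x - (j • τ + τ)) := fun j => by
      rw [add_comm τ]; ring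
    have h2 : ∀ j, 2⁻¹ * ((k.choose (j + 1) : ℝ≥0∞) * 2⁻¹ ^ k * F (x - (j • τ + τ))) =
        (k.choose (j + 1) : ℝ≥0∞) * 2⁻¹ ^ (k + 1) * F (x - (j • τ + τ)) := fun j => by ring
    rw [Finset.sum_congr rfl fun j _ => h1 j, Finset.sum_congr rfl fun j _ => h2 j]
    ring

end

lemma centralBinom_sq_le (n : ℕ) : n.centralBinom ^ 2 * (2 * n + 1) ≤ 4 ^ (2 * n) := by
  induction n with
  | zero => simp
  | succ n ih =>
    have h := Nat.succ_mul_centralBinom_succ n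
    have h2 : (n + 1) ^ 2 * ((n + 1).centralBinom ^ 2 * (2 * (n + 1) + 1)) ≤
        (n + 1) ^ 2 * 4 ^ (2 * (n + 1)) := by
      calc (n + 1) ^ 2 * ((n + 1).centralBinom ^ 2 * (2 * (n + 1) + 1))
          = ((n + 1) * (n + 1).centralBinom) ^ 2 * (2 * n + 3) := by ring
        _ = (n.centralBinom ^ 2 * (2 * n + 1)) * (4 * ((2 * n + 1) * (2 * n + 3))) := by
          rw [h]; ring
        _ ≤ 4 ^ (2 * n) * (4 * (4 * (n + 1) ^ 2)) := by
          have : (2 * n + 1) * (2 * n + 3) ≤ 4 * (n + 1) ^ 2 := by nlinarith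
          gcongr
        _ = _ := by ring
    exact Nat.le_of_mul_le_mul_left h2 (by positivity)

lemma choose_half_sq_le (k : ℕ) : (k.choose (k / 2)) ^ 2 * (k + 1) ≤ 4 ^ k := by
  rcases Nat.even_or_odd' k with ⟨n, rfl | rfl⟩
  · have := centralBinom_sq_le n
    rw [Nat.centralBinom_eq_two_mul_choose, pow_mul] at this
    rw [Nat.mul_div_cancel_left _ two_pos, pow_mul]
    exact this
  · have h := centralBinom_sq_le (n + 1)
    have e : (n + 1).centralBinom = 2 * (2 * n + 1).choose n := by
      rw [Nat.centralBinom_eq_two_mul_choose, show 2 * (n + 1) = (2 * n + 1) + 1 by ring,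
        Nat.choose_succ_succ, Nat.choose_symm_half]
      ring
    rw [e] at h
    rw [show (2 * n + 1) / 2 = n by omega]
    have h3 : 4 * ((2 * n + 1).choose n ^ 2 * (2 * n + 1 + 1)) ≤ 4 * 4 ^ (2 * n + 1) := by
      calc _ ≤ (2 * (2 * n + 1).choose n) ^ 2 * (2 * (n + 1) + 1) := by
            nlinarith [sq_nonneg ((2 * n + 1).choose n)]
        _ ≤ _ := h
        _ = _ := by ring
    exact Nat.le_of_mul_le_mul_left h3 (by norm_num)

lemma choose_half_le (k : ℕ) : ((k.choose (k / 2) : ℕ) : ℝ≥0∞) * 2⁻¹ ^ k ≤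
    ENNReal.ofReal (1 / √(k + 1)) := by
  have h : ((k.choose (k / 2) : ℕ) : ℝ) / 2 ^ k ≤ 1 / √(k + 1) := by
    rw [div_le_div_iff₀ (by positivity) (by positivity), one_mul]
    refine le_of_sq_le_sq ?_ (by positivity)
    rw [mul_pow, Real.sq_sqrt (by positivity), ← pow_mul, mul_comm k, pow_mul]
    norm_num
    exact_mod_cast choose_half_sq_le k
  refine le_trans (le_of_eq ?_) (ENNReal.ofReal_le_ofReal h)
  rw [ENNReal.ofReal_div_of_pos (by positivity), ENNReal.ofReal_natCast,
    ENNReal.ofReal_pow (by norm_num), ENNReal.ofReal_ofNat, div_eq_mul_inv, ENNReal.inv_pow]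

lemma adist_add_cancel {a b : ℝ≥0∞} (h : b ≤ a) : adist a b + b = a := by
  rw [adist, tsub_eq_zero_of_le h, add_zero, tsub_add_cancel_of_le h]

/-- Total variation of the binomial coefficients. -/
lemma sum_adist_choose_le (k : ℕ) : (∑ j ∈ Finset.range (k + 1),
    adist (k.choose (j + 1) : ℝ≥0∞) (k.choose j)) ≤ 2 * (k.choose (k / 2) : ℝ≥0∞) := by
  have h1 : ∀ n ≤ k / 2, ∑ j ∈ Finset.range n, adist (k.choose (j + 1) : ℝ≥0∞) (k.choose j) ≤
      k.choose n := by
    intro n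
    induction n with
    | zero => simp
    | succ n ih =>
      intro hn
      have : (k.choose n : ℝ≥0∞) ≤ k.choose (n + 1) := by
        exact_mod_cast Nat.choose_le_succ_of_lt_half_left hn
      rw [Finset.sum_range_succ]
      calc _ ≤ (k.choose n : ℝ≥0∞) + adist (k.choose (n + 1)) (k.choose n) := by
            gcongr
            exact ih (by omega)
        _ = k.choose (n + 1) := by rw [add_comm, adist_add_cancel this]
  have h2 : ∀ n, ∑ j ∈ Finset.range n, adist (k.choose (k / 2 + j + 1) : ℝ≥0∞)
      (k.choose (k / 2 + j)) + k.choose (k / 2 + n) = k.choose (k / 2) := by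
    intro n
    induction n with
    | zero => simp
    | succ n ih =>
      have : (k.choose (k / 2 + n + 1) : ℝ≥0∞) ≤ k.choose (k / 2 + n) := by
        norm_cast
        refine Nat.le_of_mul_le_mul_right ?_ (Nat.succ_pos (k / 2 + n))
        rw [Nat.succ_eq_add_one, Nat.choose_succ_right_eq]
        exact Nat.mul_le_mul_left _ (by omega)
      rw [Finset.sum_range_succ, ← ih, add_assoc, ← add_assoc (k / 2) n 1, adist_comm,
        adist_add_cancel this]
  have hk : k + 1 = k / 2 + (k + 1 - k / 2) := by omega
  rw [hk, Finset.sum_range_add, two_mul]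
  exact add_le_add (h1 _ le_rfl) (le_self_add.trans_eq (h2 (k + 1 - k / 2)))

lemma recursion_le {a : ℕ → ℕ → ℝ≥0∞} {c : ℝ} (hc0 : 0 ≤ c) (hc1 : c ≤ 1) {A : ℝ≥0∞}
    (h0 : ∀ j : ℕ, a 0 j ≤ A * ENNReal.ofReal (1 / √(j + 1)))
    (hs : ∀ M j, a (M + 1) j ≤ ENNReal.ofReal c * a M (j + 1) + ENNReal.ofReal (1 - c) * a M j)
    (M j : ℕ) : a M j ≤ A * ENNReal.ofReal (1 / √(c / 4 * M + j + 1)) := by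
  induction M generalizing j with
  | zero => simpa using h0 j
  | succ M ih =>
    refine (hs M j).trans ?_
    refine (add_le_add (mul_le_mul_right (ih (j + 1)) _) (mul_le_mul_right (ih j) _)).trans ?_
    rw [mul_left_comm, mul_left_comm (ENNReal.ofReal (1 - c)), ← mul_add,
      ← ENNReal.ofReal_mul hc0, ← ENNReal.ofReal_mul (by linarith),
      ← ENNReal.ofReal_add (by positivity)
        (mul_nonneg (by linarith) (by positivity))]
    gcongr
    push_cast
    set y : ℝ := c / 4 * M + j + 1 with hy
    have hy1 : 1 ≤ y := by
      have : 0 ≤ c / 4 * M := by positivity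
      have : (0 : ℝ) ≤ j := by positivity
      linarith
    rw [show c / 4 * (M : ℝ) + (j + 1) + 1 = y + 1 by rw [hy]; ring,
      show c / 4 * ((M : ℝ) + 1) + j + 1 = y + c / 4 by rw [hy]; ring]
    set p := √y with hp
    set q := √(y + 1) with hq
    set r := √(y + c / 4) with hr
    have hp2 : p ^ 2 = y := Real.sq_sqrt (by linarith)
    have hq2 : q ^ 2 = y + 1 := Real.sq_sqrt (by linarith)
    have hr2 : r ^ 2 = y + c / 4 := Real.sq_sqrt (by linarith)
    have hp0 : 1 ≤ p := by rw [hp]; exact Real.one_le_sqrt.2 hy1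
    have hpr : p ≤ r := Real.sqrt_le_sqrt (by linarith)
    have hrq : r ≤ q := Real.sqrt_le_sqrt (by linarith)
    have hqp : q ≤ 2 * p := by
      refine le_of_sq_le_sq ?_ (by positivity)
      nlinarith
    have e1 : 1 / p - 1 / r = c / 4 / (p * r * (p + r)) := by
      rw [div_sub_div _ _ (by positivity) (by positivity), div_eq_div_iff (by positivity)
        (by positivity)]
      linear_combination (p * r) * (hr2 - hp2)
    have e2 : 1 / p - 1 / q = 1 / (p * q * (p + q)) := by
      rw [div_sub_div _ _ (by positivity) (by positivity), div_eq_div_iff (by positivity)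
        (by positivity)]
      linear_combination (p * q) * (hq2 - hp2)
    have e3 : c / 4 / (p * r * (p + r)) ≤ c * (1 / (p * q * (p + q))) := by
      rw [div_le_iff₀ (by positivity), mul_one_div, div_mul_eq_mul_div,
        le_div_iff₀ (by positivity)]
      have hqr : q ≤ 2 * r := hqp.trans (by linarith)
      have : p * q * (p + q) ≤ 4 * (p * r * (p + r)) := by
        calc p * q * (p + q) ≤ p * (2 * r) * (2 * p + 2 * r) := by gcongr; linarith
          _ = _ := by ring
      calc c / 4 * (p * q * (p + q)) ≤ c / 4 * (4 * (p * r * (p + r))) := by gcongr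
        _ = _ := by ring
    have : c * (1 / q) + (1 - c) * (1 / p) = 1 / p - c * (1 / (p * q * (p + q))) := by
      rw [← e2]; ring
    linarith

section
variable {G : Type*} [AddCommGroup G] {φ : G →+ ℤ}

/-- Summation along the multiples of `τ`. -/
def lineSum (τ : G) (F : G → ℝ≥0∞) (x : G) : ℝ≥0∞ := ∑' j : ℤ, F (x - j • τ)

lemma lnorm_iterate_avg_le (τ : G) (F : G → ℝ≥0∞) (k : ℕ) : lnorm φ ((avg τ)^[k] F) ≤
    lnorm φ (lineSum τ F) * ENNReal.ofReal (1 / √(k + 1)) := by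
  rw [mul_comm]
  refine le_trans (lnorm_mono fun x => ?_) (lnorm_mul_le _ _)
  rw [iterate_avg]
  calc _ ≤ ∑ j ∈ Finset.range (k + 1), ENNReal.ofReal (1 / √(k + 1)) * F (x - j • τ) := by
        refine Finset.sum_le_sum fun j _ => mul_le_mul_left (le_trans ?_ (choose_half_le k)) _
        gcongr
        exact Nat.choose_le_middle _ _
    _ = ENNReal.ofReal (1 / √(k + 1)) * ∑ j ∈ Finset.range (k + 1), F (x - ((j : ℕ) : ℤ) • τ) := by
        rw [Finset.mul_sum]
        simp
    _ ≤ _ := by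
        gcongr
        calc _ = ∑ j ∈ (Finset.range (k + 1)).map Nat.castEmbedding, F (x - (j : ℤ) • τ) := by
              rw [Finset.sum_map]
              simp
          _ ≤ _ := ENNReal.sum_le_tsum _

lemma nr_iterate_avg_le (τ : G) (F : G → ℝ≥0∞) (k : ℕ) : Nr φ ((avg τ)^[k] F) τ ≤
    3 * lnorm φ F * ENNReal.ofReal (1 / √(k + 1)) := by
  have hx : ∀ x, adist ((avg τ)^[k] F x) ((avg τ)^[k] F (x - τ)) ≤
      (∑ j ∈ Finset.range (k + 1), adist (k.choose (j + 1) : ℝ≥0∞) (k.choose j) * 2⁻¹ ^ k *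
        F (x - (j + 1) • τ)) + 2⁻¹ ^ k * F x := by
    intro x
    have e1 : (avg τ)^[k] F x = (∑ j ∈ Finset.range (k + 1), (k.choose (j + 1) : ℝ≥0∞) * 2⁻¹ ^ k *
        F (x - (j + 1) • τ)) + 2⁻¹ ^ k * F x := by
      rw [iterate_avg, Finset.sum_range_succ' _ k, Finset.sum_range_succ _ k]
      simp
    have e2 : (avg τ)^[k] F (x - τ) = (∑ j ∈ Finset.range (k + 1), (k.choose j : ℝ≥0∞) * 2⁻¹ ^ k *
        F (x - (j + 1) • τ)) + 0 := by
      rw [iterate_avg, add_zero]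
      refine Finset.sum_congr rfl fun j _ => ?_
      rw [sub_sub, add_smul, one_smul, add_comm τ]
    rw [e1, e2]
    refine (adist_add_le _ _ _ _).trans (add_le_add ?_ (by simp [adist]))
    rw [← Finset.tsum_subtype, ← Finset.tsum_subtype, ← Finset.tsum_subtype]
    refine (adist_tsum_le _ _).trans (ENNReal.tsum_le_tsum fun j => ?_)
    rw [mul_comm _ (F _), mul_comm _ (2⁻¹ ^ k), mul_comm _ (F _), mul_comm _ (2⁻¹ ^ k), mul_comm _ (F _),
      mul_comm _ (2⁻¹ ^ k)]
    exact (adist_mul_le _ _ _).trans (mul_le_mul_right (adist_mul_le _ _ _) _)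
  refine (lnorm_mono hx).trans ((lnorm_add_le _ _).trans ?_)
  have h1 : lnorm φ (fun x => ∑ j ∈ Finset.range (k + 1), adist (k.choose (j + 1) : ℝ≥0∞)
      (k.choose j) * 2⁻¹ ^ k * F (x - (j + 1) • τ)) ≤ 2 * ENNReal.ofReal (1 / √(k + 1)) * lnorm φ F := by
    calc _ ≤ ∑ j ∈ Finset.range (k + 1), adist (k.choose (j + 1) : ℝ≥0∞)
          (k.choose j) * 2⁻¹ ^ k * lnorm φ F := by
          simp_rw [← Finset.tsum_subtype (Finset.range (k + 1))]
          refine (lnorm_tsum_le _).trans (ENNReal.tsum_le_tsum fun j => ?_)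
          exact (lnorm_mul_le _ _).trans (mul_le_mul_right (lnorm_shift_le _ _) _)
      _ = (∑ j ∈ Finset.range (k + 1), adist (k.choose (j + 1) : ℝ≥0∞) (k.choose j)) * 2⁻¹ ^ k *
          lnorm φ F := by rw [Finset.sum_mul, Finset.sum_mul]
      _ ≤ (2 * (k.choose (k / 2) : ℝ≥0∞)) * 2⁻¹ ^ k * lnorm φ F := by
          gcongr
          exact sum_adist_choose_le k
      _ ≤ _ := by
          rw [mul_assoc 2]
          gcongr
          exact choose_half_le k
  have h2 : lnorm φ (fun x => 2⁻¹ ^ k * F x) ≤ ENNReal.ofReal (1 / √(k + 1)) * lnorm φ F := by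
    refine (lnorm_mul_le _ _).trans ?_
    gcongr
    refine le_trans ?_ (choose_half_le k)
    refine le_mul_of_one_le_left' ?_
    exact_mod_cast Nat.choose_pos (Nat.div_le_self k 2)
  refine (add_le_add h1 h2).trans_eq ?_
  ring

lemma conv_shift (p F : G → ℝ≥0∞) (g : G) :
    conv p (fun y => F (y - g)) = fun x => conv p F (x - g) := by
  funext x
  exact tsum_congr fun h => by rw [sub_right_comm]

lemma conv_add (p F F' : G → ℝ≥0∞) :
    conv p (fun y => F y + F' y) = fun x => conv p F x + conv p F' x := by
  funext x
  simp only [conv, mul_add, ENNReal.tsum_add]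

lemma conv_mul (p F : G → ℝ≥0∞) (c : ℝ≥0∞) :
    conv p (fun y => c * F y) = fun x => c * conv p F x := by
  funext x
  simp only [conv, ← ENNReal.tsum_mul_left]
  exact tsum_congr fun h => by ring

lemma conv_tsum {ι : Type*} (p : G → ℝ≥0∞) (F : ι → G → ℝ≥0∞) :
    conv p (fun y => ∑' i, F i y) = fun x => ∑' i, conv p (F i) x := by
  funext x
  simp only [conv, ← ENNReal.tsum_mul_left]
  exact ENNReal.tsum_comm

lemma conv_conv_comm (p q F : G → ℝ≥0∞) : conv p (conv q F) = conv q (conv p F) := by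
  have : conv p (conv q F) = _ := conv_tsum p fun g x => q g * F (x - g)
  rw [this]
  funext x
  refine tsum_congr fun g => ?_
  rw [conv_mul, conv_shift]

lemma conv_lineSum (p F : G → ℝ≥0∞) (τ : G) :
    conv p (lineSum τ F) = lineSum τ (conv p F) := by
  unfold lineSum
  rw [conv_tsum]
  funext x
  exact tsum_congr fun j => by rw [conv_shift]

lemma iterate_conv_lineSum (p F : G → ℝ≥0∞) (τ : G) (M : ℕ) :
    (conv p)^[M] (lineSum τ F) = lineSum τ ((conv p)^[M] F) := by
  induction M with
  | zero => rfl
  | succ M ih => rw [Function.iterate_succ_apply', Function.iterate_succ_apply', ih, conv_lineSum]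

lemma iterate_conv_mono (p : G → ℝ≥0∞) {F F' : G → ℝ≥0∞} (h : ∀ x, F x ≤ F' x) (M : ℕ) (x : G) :
    (conv p)^[M] F x ≤ (conv p)^[M] F' x := by
  induction M generalizing x with
  | zero => exact h x
  | succ M ih =>
    rw [Function.iterate_succ_apply', Function.iterate_succ_apply']
    exact conv_mono p ih x

/-- Splitting off two equal atoms at distance `τ`. -/
lemma exists_split {ν : G → ℝ≥0∞} (hν : ∑' g, ν g = 1) {g τ : G} (hτ : τ ≠ 0) (h1 : 0 < ν g)
    (h2 : 0 < ν (g + τ)) : ∃ c : ℝ, 0 < c ∧ c ≤ 1 ∧ ∃ β : G → ℝ≥0∞,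
      ∑' h, β h = ENNReal.ofReal (1 - c) ∧
      ∀ F x, conv ν F x = ENNReal.ofReal c * avg τ F (x - g) + conv β F x := by
  classical
  set c := min (ν g) (ν (g + τ)) with hc
  have hc1 : c ≤ 1 := (min_le_left _ _).trans ((ENNReal.le_tsum g).trans_eq hν)
  have hct : c ≠ ∞ := (hc1.trans_lt ENNReal.one_lt_top).ne
  have hc0 : 0 < c := lt_min h1 h2
  let α : G → ℝ≥0∞ := fun h => c * 2⁻¹ * ((if h = g then 1 else 0) + if h = g + τ then 1 else 0)
  have hα : ∀ h, α h ≤ ν h := by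
    intro h
    have hhalf : c * 2⁻¹ ≤ c := mul_le_of_le_one_right' (by simp)
    by_cases e1 : h = g
    · have e2 : h ≠ g + τ := by rw [e1]; simpa using hτ
      simp only [α, if_pos e1, if_neg e2, add_zero, mul_one]
      exact hhalf.trans (e1 ▸ min_le_left _ _)
    · by_cases e2 : h = g + τ
      · simp only [α, if_neg e1, if_pos e2, zero_add, mul_one]
        exact hhalf.trans (e2 ▸ min_le_right _ _)
      · simp [α, e1, e2]
  have hαβ : ∀ h, α h + (ν h - α h) = ν h := fun h => add_tsub_cancel_of_le (hα h)
  have hαs : ∑' h, α h = c := by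
    rw [ENNReal.tsum_mul_left, ENNReal.tsum_add, tsum_ite_eq, tsum_ite_eq, mul_assoc, one_add_one_eq_two,
      ENNReal.inv_mul_cancel two_ne_zero ENNReal.ofNat_ne_top, mul_one]
  refine ⟨c.toReal, ENNReal.toReal_pos hc0.ne' hct, ENNReal.toReal_le_of_le_ofReal zero_le_one
    (by simpa using hc1), fun h => ν h - α h, ?_, fun F x => ?_⟩
  · have : c + ∑' h, (ν h - α h) = 1 := by
      rw [← hαs, ← ENNReal.tsum_add, tsum_congr hαβ, hν]
    rw [ENNReal.ofReal_sub _ ENNReal.toReal_nonneg, ENNReal.ofReal_one, ENNReal.ofReal_toReal hct,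
      ← this, ENNReal.add_sub_cancel_left hct]
  · have hcα : conv α F x = ENNReal.ofReal c.toReal * avg τ F (x - g) := by
      rw [ENNReal.ofReal_toReal hct]
      have : ∀ h, α h * F (x - h) = c * 2⁻¹ * ((if h = g then F (x - g) else 0) +
          if h = g + τ then F (x - (g + τ)) else 0) := by
        intro h
        simp only [α, mul_assoc, add_mul]
        congr 3
        · split_ifs with e <;> simp [e]
        · split_ifs with e <;> simp [e]
      rw [conv, tsum_congr this, ENNReal.tsum_mul_left, ENNReal.tsum_add, tsum_ite_eq, tsum_ite_eq, avg,
        mul_assoc, sub_sub]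
    rw [← hcα, conv, conv, conv, ← ENNReal.tsum_add]
    exact tsum_congr fun h => by rw [← add_mul, hαβ]

/-- Gain of a factor from averaging along `τ`. -/
lemma exists_smoothing (φ : G →+ ℤ) {ν : G → ℝ≥0∞} (hν : ∑' g, ν g = 1) {g τ : G} (hτ : τ ≠ 0)
    (h1 : 0 < ν g) (h2 : 0 < ν (g + τ)) : ∃ c : ℝ, 0 < c ∧ ∀ (F : G → ℝ≥0∞) (M : ℕ),
      lnorm φ ((conv ν)^[M] F) ≤ lnorm φ (lineSum τ F) * ENNReal.ofReal (1 / √(c * M + 1)) ∧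
      Nr φ ((conv ν)^[M] F) τ ≤ 3 * lnorm φ F * ENNReal.ofReal (1 / √(c * M + 1)) := by
  obtain ⟨c, hc0, hc1, β, hβ, hsplit⟩ := exists_split hν hτ h1 h2
  refine ⟨c / 4, by positivity, fun F M => ?_⟩
  have hlin : ∀ (M : ℕ) (H H' : G → ℝ≥0∞), (conv ν)^[M] (fun x => ENNReal.ofReal c * H (x - g) +
      conv β H' x) = fun x => ENNReal.ofReal c * (conv ν)^[M] H (x - g) +
        conv β ((conv ν)^[M] H') x := by
    intro M
    induction M with
    | zero => intros; rfl
    | succ M ih =>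
      intro H H'
      simp only [Function.iterate_succ_apply', ih]
      rw [conv_add, conv_mul, conv_shift, conv_conv_comm ν β]
  have hstep : ∀ M j, (conv ν)^[M + 1] ((avg τ)^[j] F) = fun x =>
      ENNReal.ofReal c * (conv ν)^[M] ((avg τ)^[j + 1] F) (x - g) +
        conv β ((conv ν)^[M] ((avg τ)^[j] F)) x := by
    intro M j
    rw [Function.iterate_succ_apply, ← hlin, Function.iterate_succ_apply']
    congr 1
    funext x
    exact hsplit _ x
  have key := fun (a : ℕ → ℕ → ℝ≥0∞) (A : ℝ≥0∞) h0 hs =>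
    recursion_le (a := a) (A := A) hc0.le hc1 h0 hs M 0
  simp only [Nat.cast_zero, add_zero] at key
  constructor
  · refine key (fun M j => lnorm φ ((conv ν)^[M] ((avg τ)^[j] F))) _
      (fun j => lnorm_iterate_avg_le τ F j) fun M j => ?_
    rw [hstep, ← hβ]
    refine (lnorm_add_le _ _).trans (add_le_add ?_ (lnorm_conv_le _ _))
    exact (lnorm_mul_le _ _).trans (mul_le_mul_right (lnorm_shift_le _ _) _)
  · refine key (fun M j => Nr φ ((conv ν)^[M] ((avg τ)^[j] F)) τ) _
      (fun j => nr_iterate_avg_le τ F j) fun M j => ?_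
    rw [hstep, ← hβ]
    refine (lnorm_mono fun x => adist_add_le _ _ _ _).trans
      ((lnorm_add_le _ _).trans (add_le_add ?_ (nr_conv_le _ _ _)))
    refine (lnorm_mono fun x => adist_mul_le _ _ _).trans ((lnorm_mul_le _ _).trans ?_)
    refine mul_le_mul_right (le_trans (le_of_eq ?_) (lnorm_shift_le g _)) _
    simp only [sub_right_comm _ τ g]

lemma lnorm_iterate_conv_le {ν : G → ℝ≥0∞} (hν : ∑' g, ν g = 1) (F : G → ℝ≥0∞) (M : ℕ) :
    lnorm φ ((conv ν)^[M] F) ≤ lnorm φ F := by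
  induction M with
  | zero => exact le_rfl
  | succ M ih =>
    rw [Function.iterate_succ_apply']
    exact (lnorm_conv_le _ _).trans (by rwa [hν, one_mul])

end

section
variable {d : ℕ}

/-- The first coordinate of a space-time point. -/
def fc (d : ℕ) : Site d × ℤ →+ ℤ where
  toFun x := firstCoord x.1
  map_zero' := by simp [firstCoord]
  map_add' x y := by
    simp only [firstCoord, Prod.fst_add, Pi.add_apply]
    split_ifs <;> simp

lemma firstCoord_eq {i : Fin d} (hi : (i : ℕ) = 0) (x : Site d) : firstCoord x = x i := by
  rw [firstCoord, dif_pos i.pos]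
  exact congrArg x (Fin.ext hi.symm)

/-- `x` and `y` agree up to the time coordinate (if `0 < k`) and the coordinates between `1` and
`k - 1`. -/
def Agree (k : ℕ) (x y : Site d × ℤ) : Prop :=
  (∀ i : Fin d, ((i : ℕ) = 0 ∨ k ≤ i) → x.1 i = y.1 i) ∧ (k = 0 → x.2 = y.2)

open Classical in
/-- Summation over the points agreeing with `x`. -/
def agreeSum (k : ℕ) (F : Site d × ℤ → ℝ≥0∞) (x : Site d × ℤ) : ℝ≥0∞ :=
  ∑' y, if Agree k x y then F y else 0

lemma le_agreeSum_zero (F : Site d × ℤ → ℝ≥0∞) (x : Site d × ℤ) : F x ≤ agreeSum 0 F x := by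
  classical
  refine le_trans (le_of_eq ?_) (ENNReal.le_tsum x)
  rw [if_pos ⟨fun _ _ => rfl, fun _ => rfl⟩]

lemma lnorm_agreeSum_le (hd : 0 < d) (F : Site d × ℤ → ℝ≥0∞) :
    lnorm (fc d) (agreeSum d F) ≤ ∑' y, F y := by
  classical
  calc lnorm (fc d) (agreeSum d F) ≤ ∑' a : ℤ, ∑' y, if fc d y = a then F y else 0 := by
        refine ENNReal.tsum_le_tsum fun a => iSup₂_le fun x hx => ENNReal.tsum_le_tsum fun y => ?_
        split_ifs with h1 h2
        · exact le_rfl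
        · refine absurd ?_ h2
          have : x.1 ⟨0, hd⟩ = y.1 ⟨0, hd⟩ := h1.1 _ (Or.inl rfl)
          rw [← hx]
          change firstCoord _ = firstCoord _
          rw [firstCoord_eq (i := ⟨0, hd⟩) rfl, firstCoord_eq (i := ⟨0, hd⟩) rfl, this]
        · exact zero_le
        · exact le_rfl
    _ = _ := by
        rw [ENNReal.tsum_comm]
        refine tsum_congr fun y => ?_
        rw [tsum_eq_single (fc d y) fun a ha => if_neg (Ne.symm ha), if_pos rfl]

lemma lineSum_agreeSum_le {k : ℕ} {τ : Site d × ℤ}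
    (hone : ∀ x y : Site d × ℤ, ∀ j j' : ℤ, Agree k (x - j • τ) y → Agree k (x - j' • τ) y → j = j')
    (himp : ∀ x y : Site d × ℤ, ∀ j : ℤ, Agree k (x - j • τ) y → Agree (k + 1) x y)
    (F : Site d × ℤ → ℝ≥0∞) (x : Site d × ℤ) :
    lineSum τ (agreeSum k F) x ≤ agreeSum (k + 1) F x := by
  classical
  unfold lineSum agreeSum
  rw [ENNReal.tsum_comm]
  refine ENNReal.tsum_le_tsum fun y => ?_
  by_cases h : ∃ j : ℤ, Agree k (x - j • τ) y
  · obtain ⟨j, hj⟩ := h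
    rw [tsum_eq_single j fun j' hj' => if_neg fun hc => hj' (hone x y j' j hc hj), if_pos hj,
      if_pos (himp x y j hj)]
  · push Not at h
    simp only [h, if_false, tsum_zero]
    exact zero_le

/-- A law of block increments with enough atoms. -/
structure HasAtoms (ν : Site d × ℤ → ℝ≥0∞) : Prop where
  sum : ∑' g, ν g = 1
  atom : ∀ i : Fin d, ∃ b : Bool, 0 < ν (stepVec (i, b), 1) ∧
    0 < ν ((2 : ℤ) • stepVec (i, b), 4) ∧ 0 < ν ((2 : ℤ) • stepVec (i, b), 6)

lemma nr_step_le {F : Site d × ℤ → ℝ≥0∞} {r : ℝ≥0∞} {i : Fin d} {b : Bool}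
    (h0 : Nr (fc d) F (0, 2) ≤ r) (h1 : Nr (fc d) F (stepVec (i, b), 3) ≤ r) (b' : Bool) :
    Nr (fc d) F (stepVec (i, b'), 1) ≤ 3 * r := by
  by_cases hb : b' = b
  · subst hb
    have e : ((stepVec (i, b'), 1) : Site d × ℤ) = (stepVec (i, b'), 3) + -(0, 2) := by
      ext <;> simp
    rw [e]
    calc _ ≤ r + r := (nr_add_le _ _ _).trans (add_le_add h1 ((nr_neg_le _ _).trans h0))
      _ ≤ r + r + r := le_self_add
      _ = 3 * r := by ring
  · have hb' : b' = !b := by cases b <;> cases b' <;> simp_all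
    have hneg : stepVec (i, b') = - stepVec (i, b) := hb' ▸ stepVec_not (i, b)
    have e : ((stepVec (i, b'), 1) : Site d × ℤ) = -(stepVec (i, b), 3) + ((0, 2) + (0, 2)) := by
      rw [hneg]
      ext <;> simp
    rw [e]
    calc _ ≤ r + (r + r) := (nr_add_le _ _ _).trans (add_le_add ((nr_neg_le _ _).trans h1)
          ((nr_add_le _ _ _).trans (add_le_add h0 h0)))
      _ = 3 * r := by ring

/-- Bounds for convolution powers of a law with atoms. -/
theorem HasAtoms.exists_bound (hd : 0 < d) {ν : Site d × ℤ → ℝ≥0∞} (h : HasAtoms ν) :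
    ∃ c : ℝ, 0 < c ∧ ∀ (F : Site d × ℤ → ℝ≥0∞) (M : ℕ), ∑' y, F y ≤ 1 →
      lnorm (fc d) ((conv ν)^[(d + 1) * M] F) ≤ ENNReal.ofReal (1 / √(c * M + 1)) ^ d ∧
      ∀ s, Nr (fc d) ((conv ν)^[(d + 1) * M] F) (stepVec s, 1) ≤
        9 * ENNReal.ofReal (1 / √(c * M + 1)) ^ (d + 1) := by
  choose b hb1 hb4 hb6 using h.atom
  let i0 : Fin d := ⟨0, hd⟩
  obtain ⟨c0, hc0, hs0⟩ := exists_smoothing (fc d) h.sum (g := ((2 : ℤ) • stepVec (i0, b i0), 4))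
    (τ := (0, 2)) (by simp) (hb4 i0) (by simpa using hb6 i0)
  have hτ : ∀ i, (stepVec (i, b i), 1) + (stepVec (i, b i), (3 : ℤ)) =
      ((2 : ℤ) • stepVec (i, b i), 4) := fun i => by
    ext <;> simp [two_mul]
  have hs : ∀ i : Fin d, ∃ c : ℝ, 0 < c ∧ _ := fun i => exists_smoothing (fc d) h.sum
    (g := (stepVec (i, b i), 1)) (τ := (stepVec (i, b i), 3)) (by simp) (hb1 i)
    (by rw [hτ]; exact hb4 i)
  choose c' hc' hs' using hs
  obtain ⟨c, hc, hcle⟩ : ∃ c : ℝ, 0 < c ∧ c ≤ c0 ∧ ∀ i, c ≤ c' i := by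
    have hne : (Finset.univ : Finset (Fin d)).Nonempty := ⟨i0, Finset.mem_univ _⟩
    refine ⟨min c0 (Finset.univ.inf' hne c'), lt_min hc0 ?_, min_le_left _ _, fun i => ?_⟩
    · rw [Finset.lt_inf'_iff]
      exact fun i _ => hc' i
    · exact (min_le_right _ _).trans (Finset.inf'_le _ (Finset.mem_univ i))
  refine ⟨c, hc, fun F M hF => ?_⟩
  set r := ENNReal.ofReal (1 / √(c * M + 1)) with hr
  have hrle : ∀ c1, c ≤ c1 → ENNReal.ofReal (1 / √(c1 * M + 1)) ≤ r := fun c1 h1 => by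
    rw [hr]
    gcongr
  have hline : ∀ k : ℕ, k < d → ∀ (H : Site d × ℤ → ℝ≥0∞), ∃ τ : Site d × ℤ,
      lnorm (fc d) ((conv ν)^[M] H) ≤ lnorm (fc d) (lineSum τ H) * r ∧
      ∀ x, lineSum τ (agreeSum k F) x ≤ agreeSum (k + 1) F x := by
    intro k hk H
    rcases Nat.eq_zero_or_pos k with rfl | hkpos
    · refine ⟨(0, 2), (hs0 H M).1.trans (mul_le_mul_right (hrle _ hcle.1) _),
        lineSum_agreeSum_le (fun x y j j' h1 h2 => ?_) (fun x y j h1 => ⟨fun i hi => ?_, by simp⟩) F⟩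
      · have h3 := h1.2 rfl
        have h4 := h2.2 rfl
        simp at h3 h4
        omega
      · simpa using h1.1 i (Or.inr (Nat.zero_le _))
    · let i : Fin d := ⟨k, hk⟩
      refine ⟨(stepVec (i, b i), 3), (hs' i H M).1.trans (mul_le_mul_right (hrle _ (hcle.2 i)) _),
        lineSum_agreeSum_le (fun x y j j' h1 h2 => ?_) (fun x y j h1 => ⟨fun i' hi => ?_, by omega⟩) F⟩
      · have h3 := h1.1 i (Or.inr le_rfl)
        have h4 := h2.1 i (Or.inr le_rfl)
        have h5 : stepVec (i, b i) i ≠ 0 := by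
          simp only [stepVec, if_true]
          split_ifs <;> simp
        simp only [Prod.fst_sub, Prod.smul_fst, Pi.sub_apply, Pi.smul_apply, smul_eq_mul] at h3 h4
        exact mul_right_cancel₀ h5 (by linarith)
      · have h3 := h1.1 i' (by omega)
        have h5 : stepVec (i, b i) i' = 0 := by
          have : i' ≠ i := by
            rintro rfl
            simp only [i] at hi
            omega
          simp [stepVec, this]
        simpa [h5] using h3
  have hmain : ∀ j k, k + j = d → lnorm (fc d) ((conv ν)^[j * M] (agreeSum k F)) ≤ r ^ j := by
    intro j
    induction j with
    | zero =>
      rintro k rfl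
      simpa using (lnorm_agreeSum_le hd F).trans hF
    | succ j ih =>
      intro k hk
      obtain ⟨τ, h1, h2⟩ := hline k (by omega) ((conv ν)^[j * M] (agreeSum k F))
      rw [show (j + 1) * M = M + j * M by ring, Function.iterate_add_apply, pow_succ]
      refine h1.trans (mul_le_mul_left ?_ _)
      rw [← iterate_conv_lineSum]
      exact (lnorm_mono fun x => iterate_conv_mono ν h2 _ x).trans (ih (k + 1) (by omega))
  have hD : lnorm (fc d) ((conv ν)^[d * M] F) ≤ r ^ d :=
    (lnorm_mono fun x => iterate_conv_mono ν (le_agreeSum_zero F) _ x).trans (hmain d 0 (by omega))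
  rw [show (d + 1) * M = M + d * M by ring, Function.iterate_add_apply]
  refine ⟨(lnorm_iterate_conv_le h.sum _ _).trans hD, fun s => ?_⟩
  have hn0 : Nr (fc d) ((conv ν)^[M] ((conv ν)^[d * M] F)) (0, 2) ≤ 3 * r ^ (d + 1) := by
    refine (hs0 _ M).2.trans ?_
    rw [pow_succ, ← mul_assoc]
    gcongr
    exact hrle _ hcle.1
  have hn1 : Nr (fc d) ((conv ν)^[M] ((conv ν)^[d * M] F)) (stepVec (s.1, b s.1), 3) ≤
      3 * r ^ (d + 1) := by
    refine (hs' s.1 _ M).2.trans ?_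
    rw [pow_succ, ← mul_assoc]
    gcongr
    exact hrle _ (hcle.2 s.1)
  refine (nr_step_le hn0 hn1 s.2).trans_eq ?_
  rw [← mul_assoc]
  norm_num

end

/-! ### Iterating the renewal structure -/

section
variable {d : ℕ} {μ Q : Measure (Path d)} {u : Site d} {K B : ℕ}

/-- The `k`-th cut time. -/
def cutSeq (u : Site d) : ℕ → Path d → ℕ
  | 0, _ => 0
  | k + 1, f => cutTime u f + cutSeq u k (nxt u f)

/-- Displacement and duration of the first `k` blocks. -/
def disp (u : Site d) (k : ℕ) (f : Path d) : Site d × ℤ :=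
  (f (cutSeq u k f) - f 0, (cutSeq u k f : ℤ))

lemma disp_zero (f : Path d) : disp u 0 f = 0 := by
  simp [disp, cutSeq]

lemma disp_succ (k : ℕ) (f : Path d) : disp u (k + 1) f = blk u f + disp u k (nxt u f) := by
  simp [disp, cutSeq, blk, nxt, tail]

lemma disp_succ' (k : ℕ) (f : Path d) : disp u (k + 1) f = disp u k f + blk u ((nxt u)^[k] f) := by
  induction k generalizing f with
  | zero => simp [disp_succ, disp_zero]
  | succ k ih =>
    rw [disp_succ, ih, disp_succ k f, Function.iterate_succ_apply, add_assoc]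

lemma cutSeq_succ' (k : ℕ) (f : Path d) :
    cutSeq u (k + 1) f = cutSeq u k f + cutTime u ((nxt u)^[k] f) := by
  have := congrArg Prod.snd (disp_succ' (u := u) k f)
  simp only [disp, blk, Prod.snd_add] at this
  exact_mod_cast this

lemma tail_tail (m n : ℕ) (f : Path d) : tail m (tail n f) = tail (n + m) f := by
  funext k
  simp [tail, add_assoc]

lemma iterate_nxt (k : ℕ) {f : Path d} (hf : f 0 = 0) : (nxt u)^[k] f = tail (cutSeq u k f) f := by
  induction k with
  | zero =>
    funext n
    simp [cutSeq, tail, hf]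
  | succ k ih =>
    rw [Function.iterate_succ_apply', cutSeq_succ', nxt]
    conv_lhs => rw [ih]
    rw [tail_tail, ih]

lemma measurable_disp (k : ℕ) : Measurable (disp u k) := by
  induction k with
  | zero =>
    rw [show disp u 0 = fun _ => 0 from funext disp_zero]
    exact measurable_const
  | succ k ih =>
    rw [show disp u (k + 1) = fun f => blk u f + disp u k (nxt u f) from funext (disp_succ k)]
    exact measurable_blk.add (ih.comp measurable_nxt)

lemma measurable_iterate_nxt (k : ℕ) : Measurable (nxt u)^[k] :=
  measurable_nxt.iterate k

/-- The law of the first block under `Q`. -/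
def blkLaw (u : Site d) (Q : Measure (Path d)) (g : Site d × ℤ) : ℝ≥0∞ := Q {f | blk u f = g}

lemma tsum_measure_eq {m : Measure (Path d)} {Z : Path d → Site d × ℤ} (hZ : Measurable Z)
    {A : Set (Path d)} (hA : MeasurableSet A) : ∑' g, m ({f | Z f = g} ∩ A) = m A := by
  have hm : ∀ g, MeasurableSet ({f | Z f = g} ∩ A) := fun g => (hZ (measurableSet_singleton g)).inter hA
  rw [← measure_iUnion _ hm]
  · congr 1
    ext f
    simp
  · intro g g' hg
    refine Set.disjoint_left.2 fun f hf hf' => hg (hf.1.symm.trans hf'.1)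

lemma tsum_blkLaw (m : Measure (Path d)) [IsProbabilityMeasure m] : ∑' g, blkLaw u m g = 1 := by
  have := tsum_measure_eq (m := m) (measurable_blk (u := u)) MeasurableSet.univ
  simpa [blkLaw] using this

lemma IsRenewal.hasAtoms (h : IsRenewal μ Q u K B) (hu : ∀ i, u i ≠ 0) : HasAtoms (blkLaw u Q) := by
  have := h.prob'
  refine ⟨tsum_blkLaw Q, fun i => ?_⟩
  have key : ∃ b, 0 < lev u (stepVec (i, b)) := by
    rcases (hu i).lt_or_gt with hi | hi
    · exact ⟨false, by simp [lev_stepVec, hi]⟩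
    · exact ⟨true, by simp [lev_stepVec, hi]⟩
  obtain ⟨b, hb⟩ := key
  have hat := h.atom _ hb
  exact ⟨b, hat.1, by simpa [blkLaw] using hat.2 1 le_rfl,
    by simpa [blkLaw] using hat.2 2 (by norm_num)⟩

lemma measure_disp_succ {m : Measure (Path d)}
    (hm : ∀ g A, MeasurableSet A → m {f | blk u f = g ∧ nxt u f ∈ A} = blkLaw u m g * Q A)
    {k : ℕ} {W : Site d × ℤ → ℝ≥0∞} {A : Set (Path d)} (hA : MeasurableSet A)
    (hW : ∀ x, Q {f | disp u k f = x ∧ (nxt u)^[k] f ∈ A} = W x * Q A) (x : Site d × ℤ) :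
    m {f | disp u (k + 1) f = x ∧ (nxt u)^[k + 1] f ∈ A} = conv (blkLaw u m) W x * Q A := by
  have hmeas : ∀ k y, MeasurableSet {f | disp u k f = y ∧ (nxt u)^[k] f ∈ A} := fun k y =>
    (measurable_disp k (measurableSet_singleton y)).inter (measurable_iterate_nxt k hA)
  rw [← tsum_measure_eq measurable_blk (hmeas (k + 1) x), conv, ← ENNReal.tsum_mul_right]
  refine tsum_congr fun g => ?_
  rw [mul_assoc, ← hW, ← hm _ _ (hmeas k _)]
  congr 1
  ext f
  simp only [Set.mem_inter_iff, Set.mem_ofPred_eq, disp_succ, Function.iterate_succ_apply]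
  constructor
  · rintro ⟨rfl, rfl, h⟩
    exact ⟨rfl, by simp, h⟩
  · rintro ⟨rfl, h1, h⟩
    exact ⟨rfl, by simp [h1], h⟩

/-- The indicator of the neutral element. -/
def dirac0 (x : Site d × ℤ) : ℝ≥0∞ := if x = 0 then 1 else 0

lemma tsum_dirac0 : ∑' x, dirac0 (d := d) x = 1 := by
  rw [tsum_eq_single 0 (fun x hx => by simp [dirac0, hx])]
  simp [dirac0]

lemma IsRenewal.measure_disp' (h : IsRenewal μ Q u K B) (k : ℕ) {A : Set (Path d)}
    (hA : MeasurableSet A) (x : Site d × ℤ) :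
    Q {f | disp u k f = x ∧ (nxt u)^[k] f ∈ A} = (conv (blkLaw u Q))^[k] dirac0 x * Q A := by
  induction k generalizing x with
  | zero =>
    simp only [disp_zero, Function.iterate_zero, id, dirac0]
    by_cases hx : x = 0
    · simp [hx]
    · simp [hx, Ne.symm hx]
  | succ k ih =>
    rw [measure_disp_succ h.indep' hA ih, Function.iterate_succ_apply']

/-- The law of the displacement and duration of the first `k + 1` blocks. -/
def dispLaw (μ Q : Measure (Path d)) (u : Site d) (k : ℕ) : Site d × ℤ → ℝ≥0∞ :=
  conv (blkLaw u μ) ((conv (blkLaw u Q))^[k] dirac0)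

lemma IsRenewal.measure_disp (h : IsRenewal μ Q u K B) (k : ℕ) {A : Set (Path d)}
    (hA : MeasurableSet A) (x : Site d × ℤ) :
    μ {f | disp u (k + 1) f = x ∧ (nxt u)^[k + 1] f ∈ A} = dispLaw μ Q u k x * Q A :=
  measure_disp_succ h.indep hA (h.measure_disp' k hA) x

lemma IsRenewal.measure_nxt {m : Measure (Path d)} [IsProbabilityMeasure m]
    (hm : ∀ g A, MeasurableSet A → m {f | blk u f = g ∧ nxt u f ∈ A} = blkLaw u m g * Q A)
    {A : Set (Path d)} (hA : MeasurableSet A) : m (nxt u ⁻¹' A) = Q A := by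
  rw [← tsum_measure_eq measurable_blk (measurable_nxt hA)]
  calc _ = ∑' g, blkLaw u m g * Q A := tsum_congr fun g => hm g A hA
    _ = Q A := by rw [ENNReal.tsum_mul_right, tsum_blkLaw, one_mul]

lemma IsRenewal.measure_iterate_nxt (h : IsRenewal μ Q u K B) (k : ℕ) {A : Set (Path d)}
    (hA : MeasurableSet A) : Q ((nxt u)^[k] ⁻¹' A) = Q A := by
  have := h.prob'
  induction k with
  | zero => rfl
  | succ k ih =>
    rw [Function.iterate_succ, Set.preimage_comp, IsRenewal.measure_nxt h.indep'
      (measurable_iterate_nxt k hA), ih]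

/-- Averaging a functional of the path seen after `k + 1` blocks. -/
lemma IsRenewal.measure_conv (h : IsRenewal μ Q u K B) (k : ℕ) {H : Site d × ℤ → Set (Path d)}
    (hH : ∀ x, MeasurableSet (H x)) (X : Site d × ℤ) :
    μ {f | (nxt u)^[k + 1] f ∈ H (X - disp u (k + 1) f)} =
      conv (dispLaw μ Q u k) (fun x => Q (H x)) X := by
  have e : ∀ g, {f | disp u (k + 1) f = g} ∩ {f | (nxt u)^[k + 1] f ∈ H (X - disp u (k + 1) f)} =
      {f | disp u (k + 1) f = g ∧ (nxt u)^[k + 1] f ∈ H (X - g)} := by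
    intro g
    ext f
    simp only [Set.mem_inter_iff, Set.mem_ofPred_eq]
    constructor
    · rintro ⟨rfl, h⟩
      exact ⟨rfl, h⟩
    · rintro ⟨rfl, h⟩
      exact ⟨rfl, h⟩
  have hm : ∀ g, MeasurableSet {f | disp u (k + 1) f = g ∧ (nxt u)^[k + 1] f ∈ H (X - g)} := fun g =>
    (measurable_disp (k + 1) (measurableSet_singleton g)).inter (measurable_iterate_nxt (k + 1) (hH _))
  have hS : MeasurableSet {f | (nxt u)^[k + 1] f ∈ H (X - disp u (k + 1) f)} := by
    have : {f | (nxt u)^[k + 1] f ∈ H (X - disp u (k + 1) f)} =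
        ⋃ g, {f | disp u (k + 1) f = g ∧ (nxt u)^[k + 1] f ∈ H (X - g)} := by
      ext f
      simp
    rw [this]
    exact MeasurableSet.iUnion hm
  rw [← tsum_measure_eq (measurable_disp (u := u) (k + 1)) hS, conv]
  refine tsum_congr fun g => ?_
  rw [e, h.measure_disp k (hH _)]

end

/-! ### Moments and exponential moments of blocks -/

section
variable {d : ℕ} {μ Q : Measure (Path d)} {u : Site d} {K B : ℕ}

lemma IsRenewal.start' (h : IsRenewal μ Q u K B) : ∀ᵐ f ∂Q, f 0 = 0 := h.abs_cont.ae_le h.start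

lemma abs_le_of_notMem_noCut {h : ℕ} {f : Path d} (hf : f ∉ NoCut u K B h) {t : ℕ}
    (ht : t ≤ cutTime u f) (i : Fin d) : |f t i| ≤ ((K * h ^ B : ℕ) : ℤ) := by
  obtain ⟨n, h1, h2, h3⟩ := not_not.1 hf
  exact h3 t (ht.trans (cutTime_le h1 h2)) i

/-- A coordinate of the displacement of the first block. -/
def blkC (u : Site d) (i : Fin d) (f : Path d) : ℝ := ((blk u f).1 i : ℝ)

lemma measurable_blkC (i : Fin d) : Measurable (blkC u i) :=
  (Measurable.of_discrete (f := fun g : Site d × ℤ => (g.1 i : ℝ))).comp measurable_blk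

lemma abs_blkC_le {h : ℕ} {f : Path d} (hf : f ∉ NoCut u K B h) (h0 : f 0 = 0) (i : Fin d) :
    |blkC u i f| ≤ ((K * h ^ B : ℕ) : ℝ) := by
  have := abs_le_of_notMem_noCut hf le_rfl i
  simp only [blkC, blk, h0, sub_zero]
  exact_mod_cast this

lemma indicator_noCut_blkC_le {f : Path d} (h0 : f 0 = 0) {h : ℕ} (hh : 1 ≤ h) (i : Fin d) :
    (NoCut u K B h).indicator (fun f => ‖blkC u i f‖ₑ) f ≤
      ∑' k : ℕ, (((K * 2 ^ B + 1) * (2 ^ k * h) ^ B : ℕ) : ℝ≥0∞) *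
        (NoCut u K B (2 ^ k * h)).indicator (fun _ => 1) f := by
  classical
  by_cases hf : f ∈ NoCut u K B h
  · rw [Set.indicator_of_mem hf]
    by_cases hex : ∃ m, f ∉ NoCut u K B (2 ^ m * h)
    · have hm := Nat.find_spec hex
      have hmin := fun k => Nat.find_min hex (m := k)
      set m := Nat.find hex
      have hm0 : m ≠ 0 := by
        intro h0
        rw [h0] at hm
        simp [hf] at hm
      obtain ⟨k, hk⟩ := Nat.exists_eq_succ_of_ne_zero hm0
      refine le_trans ?_ (ENNReal.le_tsum k)
      have hk' : f ∈ NoCut u K B (2 ^ k * h) := not_not.1 (hmin k (by omega))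
      rw [Set.indicator_of_mem hk', mul_one]
      have hb := abs_blkC_le hm h0 i
      rw [← Real.norm_eq_abs] at hb
      rw [← ofReal_norm]
      refine (ENNReal.ofReal_le_ofReal hb).trans ?_
      rw [ENNReal.ofReal_natCast]
      norm_cast
      rw [hk]
      calc K * (2 ^ (k + 1) * h) ^ B = K * 2 ^ B * (2 ^ k * h) ^ B := by ring
        _ ≤ _ := by gcongr; omega
    · push Not at hex
      have : (∑' k : ℕ, (((K * 2 ^ B + 1) * (2 ^ k * h) ^ B : ℕ) : ℝ≥0∞) *
        (NoCut u K B (2 ^ k * h)).indicator (fun _ => 1) f) = ⊤ := by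
        refine top_le_iff.1 ?_
        rw [← ENNReal.tsum_const_eq_top_of_ne_zero (α := ℕ) one_ne_zero]
        refine ENNReal.tsum_le_tsum fun k => ?_
        rw [Set.indicator_of_mem (hex k), mul_one]
        have : 1 ≤ (K * 2 ^ B + 1) * (2 ^ k * h) ^ B := Nat.one_le_iff_ne_zero.2 (by positivity)
        exact_mod_cast this
      rw [this]
      exact le_top
  · simp [hf]

lemma IsRenewal.stretchedDecay_blkC (hr : IsRenewal μ Q u K B) (i : Fin d) :
    StretchedDecay fun h => ∫⁻ f in NoCut u K B h, ‖blkC u i f‖ₑ ∂Q := by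
  refine ((hr.noCut'.pow_mul B (K * 2 ^ B + 1)).tsum_two_pow).mono fun h hh => ?_
  rw [← lintegral_indicator (measurableSet_noCut u K B h)]
  calc _ ≤ ∫⁻ f, ∑' k : ℕ, (((K * 2 ^ B + 1) * (2 ^ k * h) ^ B : ℕ) : ℝ≥0∞) *
        (NoCut u K B (2 ^ k * h)).indicator (fun _ => 1) f ∂Q := by
        refine lintegral_mono_ae ?_
        filter_upwards [hr.start'] with f hf
        exact indicator_noCut_blkC_le hf hh i
    _ = _ := by
        rw [lintegral_tsum fun k => ((measurable_const.indicator
          (measurableSet_noCut u K B _)).const_mul _).aemeasurable]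
        refine tsum_congr fun k => ?_
        rw [lintegral_const_mul _ (measurable_const.indicator (measurableSet_noCut u K B _)),
          lintegral_indicator (measurableSet_noCut u K B _)]
        simp

lemma IsRenewal.integrable_blkC (hr : IsRenewal μ Q u K B) (i : Fin d) :
    Integrable (blkC u i) Q := by
  have := hr.prob'
  refine ⟨(measurable_blkC i).aestronglyMeasurable, ?_⟩
  have h1 : ∫⁻ f in NoCut u K B 1, ‖blkC u i f‖ₑ ∂Q < ⊤ := by
    obtain ⟨δ, hδ, C, hC, hb⟩ := hr.stretchedDecay_blkC i
    exact (hb 1 le_rfl).trans_lt ENNReal.ofReal_lt_top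
  have h2 : ∫⁻ f in (NoCut u K B 1)ᶜ, ‖blkC u i f‖ₑ ∂Q < ⊤ := by
    calc _ ≤ ∫⁻ f in (NoCut u K B 1)ᶜ, (K : ℝ≥0∞) ∂Q := by
          refine setLIntegral_mono_ae measurable_const.aemeasurable ?_
          filter_upwards [hr.start'] with f hf hfc
          have hb := abs_blkC_le hfc hf i
          rw [← Real.norm_eq_abs] at hb
          rw [← ofReal_norm]
          refine (ENNReal.ofReal_le_ofReal hb).trans ?_
          simp
      _ < ⊤ := by
          rw [setLIntegral_const]
          exact ENNReal.mul_lt_top (ENNReal.natCast_lt_top K) (measure_lt_top _ _)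
  rw [HasFiniteIntegral, ← lintegral_add_compl _ (measurableSet_noCut u K B 1)]
  exact ENNReal.add_lt_top.2 ⟨h1, h2⟩

/-- Truncation at level `r`. -/
def trunc (r x : ℝ) : ℝ := if |x| ≤ r then x else 0

lemma abs_trunc_le {r : ℝ} (hr : 0 ≤ r) (x : ℝ) : |trunc r x| ≤ r := by
  unfold trunc
  split_ifs with h
  · exact h
  · simpa using hr

lemma measurable_trunc (r : ℝ) : Measurable (trunc r) :=
  Measurable.ite (measurableSet_le measurable_norm measurable_const) measurable_id measurable_const

/-- Mean displacement of a block. -/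
def meanC (Q : Measure (Path d)) (u : Site d) (i : Fin d) : ℝ := ∫ f, blkC u i f ∂Q

lemma IsRenewal.abs_integral_trunc_sub_le (hr : IsRenewal μ Q u K B) (i : Fin d) {h : ℕ} (hh : 1 ≤ h)
    {r : ℝ} (hKr : ((K * h ^ B : ℕ) : ℝ) ≤ r) :
    |(∫ f, trunc r (blkC u i f) ∂Q) - meanC Q u i| ≤
      (∫⁻ f in NoCut u K B h, ‖blkC u i f‖ₑ ∂Q).toReal := by
  have := hr.prob'
  have hi := hr.integrable_blkC i
  have hr0 : 0 ≤ r := le_trans (by positivity) hKr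
  have ht : Integrable (fun f => trunc r (blkC u i f)) Q := by
    refine Integrable.of_bound ((measurable_trunc r).comp (measurable_blkC i)).aestronglyMeasurable r ?_
    exact ae_of_all _ fun f => abs_trunc_le hr0 _
  rw [meanC, ← integral_sub ht hi, ← Real.norm_eq_abs]
  refine (norm_integral_le_integral_norm _).trans ?_
  have e := integral_norm_eq_lintegral_enorm (ht.sub hi).aestronglyMeasurable
  simp only [Pi.sub_apply] at e
  rw [e, ← lintegral_indicator (measurableSet_noCut u K B h)]
  refine ENNReal.toReal_mono ?_ ?_
  · rw [lintegral_indicator (measurableSet_noCut u K B h)]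
    obtain ⟨δ, hδ, C, hC, hb⟩ := hr.stretchedDecay_blkC i
    exact ((hb h hh).trans_lt ENNReal.ofReal_lt_top).ne
  refine lintegral_mono_ae ?_
  filter_upwards [hr.start'] with f hf
  by_cases hN : f ∈ NoCut u K B h
  · rw [Set.indicator_of_mem hN]
    unfold trunc
    split_ifs <;> simp
  · have := (abs_blkC_le hN hf i).trans hKr
    simp [trunc, this]

lemma IsRenewal.indepFun (hr : IsRenewal μ Q u K B) : ProbabilityTheory.IndepFun (blk u) (nxt u) Q := by
  have := hr.prob'
  rw [ProbabilityTheory.indepFun_iff_measure_inter_preimage_eq_mul]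
  intro s t hs ht
  have e : ∀ A, MeasurableSet A → Q (blk u ⁻¹' s ∩ nxt u ⁻¹' A) = (∑' g, s.indicator (blkLaw u Q) g) * Q A := by
    intro A hA
    rw [← tsum_measure_eq measurable_blk ((measurable_blk hs).inter (measurable_nxt hA)),
      ← ENNReal.tsum_mul_right]
    refine tsum_congr fun g => ?_
    by_cases hg : g ∈ s
    · rw [Set.indicator_of_mem hg, blkLaw, ← hr.indep' g A hA]
      congr 1
      ext f
      constructor
      · rintro ⟨h1, h2, h3⟩
        exact ⟨h1, h3⟩
      · rintro ⟨h1, h3⟩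
        refine ⟨h1, ?_, h3⟩
        rw [Set.mem_preimage, h1]
        exact hg
    · rw [Set.indicator_of_notMem hg, zero_mul]
      convert measure_empty (μ := Q)
      ext f
      simp only [Set.mem_inter_iff, Set.mem_ofPred_eq, Set.mem_preimage, Set.mem_empty_iff_false,
        iff_false]
      rintro ⟨h1, h2, h3⟩
      exact hg (h1 ▸ h2)
  have e1 := e Set.univ MeasurableSet.univ
  rw [Set.preimage_univ, Set.inter_univ, measure_univ, mul_one] at e1
  rw [e t ht, e1, IsRenewal.measure_nxt hr.indep' ht]

lemma IsRenewal.lintegral_prod_blk (hr : IsRenewal μ Q u K B) (ψ : Site d × ℤ → ℝ≥0∞) (k : ℕ) :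
    ∫⁻ f, ∏ j ∈ Finset.range k, ψ (blk u ((nxt u)^[j] f)) ∂Q = (∫⁻ f, ψ (blk u f) ∂Q) ^ k := by
  have := hr.prob'
  have hψ : Measurable ψ := Measurable.of_discrete
  induction k with
  | zero => simp
  | succ k ih =>
    have hF : Measurable fun f => ∏ j ∈ Finset.range k, ψ (blk u ((nxt u)^[j] f)) :=
      Finset.measurable_prod _ fun j _ => hψ.comp (measurable_blk.comp (measurable_iterate_nxt j))
    calc _ = ∫⁻ f, (ψ ∘ blk u) f * ((fun f => ∏ j ∈ Finset.range k, ψ (blk u ((nxt u)^[j] f))) ∘ nxt u) f ∂Q := by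
          refine lintegral_congr fun f => ?_
          rw [Finset.prod_range_succ', mul_comm]
          simp [Function.iterate_succ_apply]
      _ = _ := by
          rw [ProbabilityTheory.lintegral_mul_eq_lintegral_mul_lintegral_of_indepFun''
            (hψ.comp measurable_blk).aemeasurable (hF.comp measurable_nxt).aemeasurable (hr.indepFun.comp hψ hF), pow_succ', ← ih]
          congr 1
          have hmp : Q.map (nxt u) = Q := by
            ext A hA
            rw [Measure.map_apply measurable_nxt hA, IsRenewal.measure_nxt hr.indep' hA]
          conv_rhs => rw [← hmp]
          rw [lintegral_map hF measurable_nxt]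
          rfl

/-- Centred sum of truncated displacements. -/
def truncSum (Q : Measure (Path d)) (u : Site d) (i : Fin d) (r : ℝ) (k : ℕ) (f : Path d) : ℝ :=
  ∑ j ∈ Finset.range k, (trunc r (blkC u i ((nxt u)^[j] f)) - ∫ g, trunc r (blkC u i g) ∂Q)

lemma measurable_truncSum (i : Fin d) (r : ℝ) (k : ℕ) : Measurable (truncSum Q u i r k) :=
  Finset.measurable_sum _ fun j _ => ((measurable_trunc r).comp
    ((measurable_blkC i).comp (measurable_iterate_nxt j))).sub_const _

lemma IsRenewal.lintegral_exp_truncSum_le (hr : IsRenewal μ Q u K B) (i : Fin d) {r : ℝ} (hr0 : 0 ≤ r)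
    (k : ℕ) (t : ℝ) : ∫⁻ f, ENNReal.ofReal (Real.exp (t * truncSum Q u i r k f)) ∂Q ≤
      ENNReal.ofReal (Real.exp (k * (r ^ 2 * t ^ 2 / 2))) := by
  have := hr.prob'
  set m := ∫ g, trunc r (blkC u i g) ∂Q with hm
  have hs := ProbabilityTheory.hasSubgaussianMGF_of_mem_Icc (μ := Q) (a := -r) (b := r)
    (X := fun f => trunc r (blkC u i f)) ((measurable_trunc r).comp (measurable_blkC i)).aemeasurable
    (ae_of_all _ fun f => abs_le.1 (abs_trunc_le hr0 _))
  have h1 : ∫⁻ f, ENNReal.ofReal (Real.exp (t * (trunc r (blkC u i f) - m))) ∂Q ≤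
      ENNReal.ofReal (Real.exp (r ^ 2 * t ^ 2 / 2)) := by
    rw [← ofReal_integral_eq_lintegral_ofReal (hs.integrable_exp_mul t)
      (ae_of_all _ fun f => (Real.exp_pos _).le)]
    refine ENNReal.ofReal_le_ofReal ((hs.mgf_le t).trans (le_of_eq ?_))
    congr 1
    push_cast
    rw [show r - -r = 2 * r by ring, Real.norm_of_nonneg (by positivity)]
    ring
  have h2 := hr.lintegral_prod_blk
    (fun g => ENNReal.ofReal (Real.exp (t * (trunc r (g.1 i : ℝ) - m)))) k
  calc _ = ∫⁻ f, ∏ j ∈ Finset.range k,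
        ENNReal.ofReal (Real.exp (t * (trunc r ((blk u ((nxt u)^[j] f)).1 i : ℝ) - m))) ∂Q := by
        refine lintegral_congr fun f => ?_
        rw [← ENNReal.ofReal_prod_of_nonneg fun j _ => (Real.exp_pos _).le, ← Real.exp_sum,
          truncSum, Finset.mul_sum]
        rfl
    _ ≤ _ := by
        rw [h2, Real.exp_nat_mul, ENNReal.ofReal_pow (Real.exp_pos _).le]
        gcongr
        exact h1

lemma IsRenewal.measure_truncSum_gt_le (hr : IsRenewal μ Q u K B) (i : Fin d) {r a : ℝ} (hr0 : 0 < r)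
    (ha : 0 ≤ a) {k n : ℕ} (hkn : k ≤ n) :
    Q {f | a < |truncSum Q u i r k f|} ≤ 2 * ENNReal.ofReal (Real.exp (-(a ^ 2 / (2 * n * r ^ 2)))) := by
  have := hr.prob'
  rcases Nat.eq_zero_or_pos n with rfl | hn
  · have hk : k = 0 := by omega
    subst hk
    have : {f | a < |truncSum Q u i r 0 f|} = ∅ := by
      ext f
      simp [truncSum, ha]
    rw [this]
    simp
  have hn' : (0 : ℝ) < n := by exact_mod_cast hn
  have hkn' : (k : ℝ) ≤ n := by exact_mod_cast hkn
  set t := a / (n * r ^ 2) with ht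
  have ht0 : 0 ≤ t := by positivity
  have key : ∀ t', t' ^ 2 = t ^ 2 → Q {f | ENNReal.ofReal (Real.exp (t * a)) ≤
      ENNReal.ofReal (Real.exp (t' * truncSum Q u i r k f))} ≤
      ENNReal.ofReal (Real.exp (-(a ^ 2 / (2 * n * r ^ 2)))) := by
    intro t' ht'
    have h1 := (mul_meas_ge_le_lintegral (μ := Q) (f := fun f => ENNReal.ofReal (Real.exp (t' *
      truncSum Q u i r k f))) (((measurable_truncSum i r k).const_mul t').exp.ennreal_ofReal)
      (ENNReal.ofReal (Real.exp (t * a)))).trans (hr.lintegral_exp_truncSum_le i hr0.le k t')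
    have h2 := mul_le_mul_right h1 (ENNReal.ofReal (Real.exp (-(t * a))))
    rw [← mul_assoc, ← ENNReal.ofReal_mul (Real.exp_pos _).le, ← ENNReal.ofReal_mul (Real.exp_pos _).le,
      ← Real.exp_add, ← Real.exp_add, neg_add_cancel, Real.exp_zero, ENNReal.ofReal_one, one_mul] at h2
    refine h2.trans (ENNReal.ofReal_le_ofReal (Real.exp_le_exp.2 ?_))
    rw [ht']
    have e1 : t * a = a ^ 2 / (n * r ^ 2) := by rw [ht]; ring
    have e2 : (n : ℝ) * (r ^ 2 * t ^ 2 / 2) = a ^ 2 / (2 * n * r ^ 2) := by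
      rw [ht]
      field_simp
    have e3 : (k : ℝ) * (r ^ 2 * t ^ 2 / 2) ≤ n * (r ^ 2 * t ^ 2 / 2) := by gcongr
    have e4 : a ^ 2 / (n * r ^ 2) = 2 * (a ^ 2 / (2 * n * r ^ 2)) := by field_simp
    linarith
  calc _ ≤ Q ({f | ENNReal.ofReal (Real.exp (t * a)) ≤
      ENNReal.ofReal (Real.exp (t * truncSum Q u i r k f))} ∪ {f | ENNReal.ofReal (Real.exp (t * a)) ≤
      ENNReal.ofReal (Real.exp (-t * truncSum Q u i r k f))}) := by
        refine measure_mono fun f hf => ?_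
        rcases lt_abs.1 (show a < |truncSum Q u i r k f| from hf) with h | h
        · left
          refine ENNReal.ofReal_le_ofReal (Real.exp_le_exp.2 ?_)
          gcongr
        · right
          refine ENNReal.ofReal_le_ofReal (Real.exp_le_exp.2 ?_)
          rw [neg_mul_comm]
          gcongr
    _ ≤ _ := by
        refine (measure_union_le _ _).trans ?_
        rw [two_mul]
        exact add_le_add (key t rfl) (key (-t) (neg_sq t))

end

/-! ### Negligible sequences -/

/-- Decay faster than every power. -/
def Negl (G : ℕ → ℝ≥0∞) : Prop := ∀ p : ℕ, ∀ᶠ N : ℕ in atTop, (N : ℝ≥0∞) ^ p * G N ≤ 1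

lemma Negl.mono {G G' : ℕ → ℝ≥0∞} (h : Negl G) (hG : ∀ᶠ N in atTop, G' N ≤ G N) : Negl G' := by
  intro p
  filter_upwards [h p, hG] with N h1 h2
  exact (mul_le_mul_right h2 _).trans h1

lemma Negl.pow_mul {G : ℕ → ℝ≥0∞} (h : Negl G) (c k : ℕ) :
    Negl fun N => ((c * N ^ k : ℕ) : ℝ≥0∞) * G N := by
  intro p
  filter_upwards [h (p + k + 1), eventually_ge_atTop c] with N h1 h2
  refine le_trans ?_ h1
  rw [← mul_assoc]
  gcongr
  have : N ^ p * (c * N ^ k) ≤ N ^ (p + k + 1) := by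
    calc N ^ p * (c * N ^ k) = c * N ^ (p + k) := by ring
      _ ≤ N * N ^ (p + k) := by gcongr
      _ = _ := by ring
  exact_mod_cast this

lemma Negl.add {G G' : ℕ → ℝ≥0∞} (h : Negl G) (h' : Negl G') : Negl fun N => G N + G' N := by
  intro p
  filter_upwards [h.pow_mul 2 0 p, h'.pow_mul 2 0 p] with N h1 h2
  have h3 := add_le_add h1 h2
  have e : (N : ℝ≥0∞) ^ p * (((2 * N ^ 0 : ℕ) : ℝ≥0∞) * G N) + (N : ℝ≥0∞) ^ p *
      (((2 * N ^ 0 : ℕ) : ℝ≥0∞) * G' N) = 2 * ((N : ℝ≥0∞) ^ p * (G N + G' N)) := by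
    push_cast
    ring
  rw [e, one_add_one_eq_two] at h3
  rw [← ENNReal.mul_le_mul_iff_right (a := 2) (by norm_num) (by norm_num), mul_one]
  exact h3

lemma tendsto_log_nat : Tendsto (fun N : ℕ => Real.log N) atTop atTop :=
  Real.tendsto_log_atTop.comp tendsto_natCast_atTop_atTop

lemma negl_exp {c : ℝ} (hc : 0 < c) :
    Negl fun N => ENNReal.ofReal (Real.exp (-(c * Real.log N ^ 2))) := by
  intro p
  filter_upwards [eventually_ge_atTop 1, tendsto_log_nat.eventually_ge_atTop (p / c)] with N hN hl
  have hN' : (0 : ℝ) < N := by exact_mod_cast hN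
  have hl0 : 0 ≤ Real.log N := Real.log_natCast_nonneg N
  rw [← ENNReal.ofReal_natCast N, ← ENNReal.ofReal_pow hN'.le, ← ENNReal.ofReal_mul (by positivity)]
  refine (ENNReal.ofReal_le_ofReal ?_).trans (by simp : ENNReal.ofReal 1 ≤ 1)
  have : (N : ℝ) ^ p = Real.exp (p * Real.log N) := by
    rw [Real.exp_nat_mul, Real.exp_log hN']
  rw [this, ← Real.exp_add]
  refine Real.exp_le_one_iff.2 ?_
  rw [div_le_iff₀ hc] at hl
  nlinarith

/-- The integer approximating the logarithm. -/
def lg (N : ℕ) : ℕ := ⌈Real.log N⌉₊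

lemma log_le_lg (N : ℕ) : Real.log N ≤ lg N := Nat.le_ceil _

lemma StretchedDecay.exists_negl {g : ℕ → ℝ≥0∞} (h : StretchedDecay g) :
    ∃ a₀ : ℕ, ∀ a, a₀ ≤ a → Negl fun N => g (lg N ^ a) := by
  obtain ⟨δ, hδ, C, hC, h⟩ := h
  refine ⟨⌈2 / δ⌉₊, fun a ha => ?_⟩
  have ha' : 2 ≤ a * δ := by
    rw [← div_le_iff₀ hδ]
    exact (Nat.le_ceil _).trans (by exact_mod_cast ha)
  refine ((negl_exp one_pos).pow_mul ⌈C⌉₊ 0).mono ?_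
  filter_upwards [tendsto_log_nat.eventually_ge_atTop 1] with N hN
  have hl : (1 : ℝ) ≤ lg N := hN.trans (log_le_lg N)
  have hl' : 1 ≤ lg N := by exact_mod_cast hl
  refine (h _ (Nat.one_le_pow _ _ hl')).trans ?_
  rw [ENNReal.ofReal_mul hC, pow_zero, mul_one]
  refine mul_le_mul' ?_ ?_
  · rw [← ENNReal.ofReal_natCast]
    exact ENNReal.ofReal_le_ofReal (Nat.le_ceil _)
  · refine ENNReal.ofReal_le_ofReal (Real.exp_le_exp.2 (neg_le_neg ?_))
    rw [one_mul]
    calc Real.log N ^ 2 ≤ (lg N : ℝ) ^ 2 := by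
          gcongr
          exact log_le_lg N
      _ ≤ (lg N : ℝ) ^ (a * δ) := by
          rw [← Real.rpow_natCast]
          exact Real.rpow_le_rpow_of_exponent_le hl (by exact_mod_cast ha')
      _ = _ := by
          push_cast
          rw [Real.rpow_mul (by positivity), Real.rpow_natCast]

section
variable {d : ℕ} {μ Q : Measure (Path d)} {u : Site d} {K B : ℕ}

/-! ### Regular trajectories -/

/-- Paths staying within distance `b` of the line in direction `v` up to the `n`-th cut time. -/
structure Reg (u : Site d) (v : Fin d → ℝ) (n : ℕ) (b : ℝ) (f : Path d) : Prop where
  start : f 0 = 0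
  steps : ∀ k, ∃ s, f (k + 1) = f k + stepVec s
  lev_le : (n : ℤ) ≤ lev u (f (cutSeq u (n + 1) f))
  dev : ∀ i, |(f (cutSeq u (n + 1) f) i : ℝ) - n * v i| ≤ b
  dev_le : ∀ m ≤ n, ∀ t ≤ cutSeq u (m + 1) f, ∃ k ≤ m, ∀ i, |(f t i : ℝ) - k * v i| ≤ b

lemma lev_blk_pos {f : Path d} {h : ℕ} (hf : f ∉ NoCut u K B h) : 1 ≤ lev u (blk u f).1 := by
  obtain ⟨n, h1, h2, -⟩ := not_not.1 hf
  have hs := cutTime_spec ⟨n, h1, h2⟩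
  have := hs.2.1 0 (by omega)
  simp only [blk, lev_sub]
  omega

lemma lev_disp_ge {f : Path d} {h : ℕ} {n : ℕ} (hf : ∀ j < n, (nxt u)^[j] f ∉ NoCut u K B h) :
    (n : ℤ) ≤ lev u (disp u n f).1 := by
  induction n with
  | zero => simp [disp_zero, lev_zero]
  | succ n ih =>
    rw [disp_succ', Prod.fst_add, lev_add]
    have h1 := ih fun j hj => hf j (by omega)
    have h2 := lev_blk_pos (hf n (by omega))
    push_cast
    omega

lemma reg_of_notMem_noCut {f : Path d} (h0 : f 0 = 0) (hs : ∀ k, ∃ s, f (k + 1) = f k + stepVec s)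
    {h n : ℕ} {v : Fin d → ℝ} {r s b : ℝ} (hKr : ((K * h ^ B : ℕ) : ℝ) ≤ r)
    (hcut : ∀ j ≤ n + 1, (nxt u)^[j] f ∉ NoCut u K B h)
    (hdev : ∀ k ≤ n, ∀ i, |((disp u k (nxt u f)).1 i : ℝ) - k * v i| ≤ s) (hb : s + 2 * r ≤ b) :
    Reg u v n b f := by
  have hs0 : ∀ i : Fin d, 0 ≤ s := fun i => (abs_nonneg _).trans (hdev 0 (Nat.zero_le _) i)
  have hr0 : 0 ≤ r := le_trans (by positivity) hKr
  have hblk : ∀ j ≤ n + 1, ∀ t ≤ cutTime u ((nxt u)^[j] f), ∀ i, |((nxt u)^[j] f t i : ℝ)| ≤ r := by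
    intro j hj t ht i
    refine le_trans ?_ hKr
    exact_mod_cast abs_le_of_notMem_noCut (hcut j hj) ht i
  have hdisp : ∀ k, f (cutSeq u k f) = (disp u k f).1 := fun k => by simp [disp, h0]
  have hcutdev : ∀ k ≤ n, ∀ i, |(f (cutSeq u (k + 1) f) i : ℝ) - k * v i| ≤ s + r := by
    intro k hk i
    have h1 := hdev k hk i
    have h2 := hblk 0 (Nat.zero_le _) _ le_rfl i
    rw [Function.iterate_zero, id] at h2
    rw [hdisp, disp_succ, Prod.fst_add, Pi.add_apply]
    have h3 : (blk u f).1 i = f (cutTime u f) i := by simp [blk, h0]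
    rw [h3]
    push_cast
    rw [abs_le] at *
    constructor <;> linarith
  refine ⟨h0, hs, ?_, fun i => (hcutdev n le_rfl i).trans (by linarith), fun m hm t ht => ?_⟩
  · rw [hdisp]
    have := lev_disp_ge (u := u) (n := n + 1) (fun j hj => hcut j (by omega))
    push_cast at this
    omega
  · induction m with
    | zero =>
      refine ⟨0, le_rfl, fun i => ?_⟩
      have h2 := hblk 0 (Nat.zero_le _) t (by simpa [cutSeq] using ht) i
      have := hs0 i
      simp only [Function.iterate_zero, id] at h2
      simp only [Nat.cast_zero, zero_mul, sub_zero]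
      linarith
    | succ m ih =>
      rcases le_total t (cutSeq u (m + 1) f) with hle | hle
      · obtain ⟨k, hk, h⟩ := ih (by omega) hle
        exact ⟨k, by omega, h⟩
      · refine ⟨m, by omega, fun i => ?_⟩
        rw [cutSeq_succ'] at ht
        have h1 := hcutdev m (by omega) i
        have h2 := hblk (m + 1) (by omega) (t - cutSeq u (m + 1) f) (by omega) i
        rw [iterate_nxt _ h0, tail, Nat.add_sub_cancel' hle, Pi.sub_apply] at h2
        push_cast at h2
        rw [abs_le] at *
        constructor <;> linarith

lemma disp_fst_eq_sum (k : ℕ) (i : Fin d) (g : Path d) :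
    ((disp u k g).1 i : ℝ) = ∑ j ∈ Finset.range k, blkC u i ((nxt u)^[j] g) := by
  induction k with
  | zero => simp [disp_zero]
  | succ k ih =>
    rw [disp_succ', Finset.sum_range_succ, ← ih]
    simp [blkC]

lemma abs_disp_sub_le {g : Path d} {h n k : ℕ} (hk : k ≤ n) {i : Fin d} {r a : ℝ}
    (hKr : ((K * h ^ B : ℕ) : ℝ) ≤ r) (h0 : g 0 = 0)
    (hcut : ∀ j ≤ n, (nxt u)^[j] g ∉ NoCut u K B h)
    (hbias : n * |(∫ f, trunc r (blkC u i f) ∂Q) - meanC Q u i| ≤ 1)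
    (hg : |truncSum Q u i r k g| ≤ a) :
    |((disp u k g).1 i : ℝ) - k * meanC Q u i| ≤ a + 1 := by
  have e : ∀ j ∈ Finset.range k, trunc r (blkC u i ((nxt u)^[j] g)) = blkC u i ((nxt u)^[j] g) := by
    intro j hj
    have hj' : j ≤ n := (Finset.mem_range.1 hj).le.trans hk
    have h0' : (nxt u)^[j] g 0 = 0 := by simp [iterate_nxt j h0, tail]
    exact if_pos ((abs_blkC_le (hcut j hj') h0' i).trans hKr)
  have e2 : ((disp u k g).1 i : ℝ) - k * meanC Q u i = truncSum Q u i r k g +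
      k * ((∫ f, trunc r (blkC u i f) ∂Q) - meanC Q u i) := by
    rw [truncSum, Finset.sum_sub_distrib, Finset.sum_congr rfl e, disp_fst_eq_sum, Finset.sum_const,
      Finset.card_range, nsmul_eq_mul]
    ring
  rw [e2]
  refine (abs_add_le _ _).trans (add_le_add hg ?_)
  rw [abs_mul, Nat.abs_cast]
  refine le_trans ?_ hbias
  gcongr

/-- Trajectories are regular up to a negligible probability. -/
theorem IsRenewal.exists_negl_not_reg (hr : IsRenewal μ Q u K B) : ∃ A : ℕ, ∀ C₂ : ℕ, 1 ≤ C₂ →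
    Negl fun N => μ {f | ¬ Reg u (meanC Q u) (C₂ * N ^ 2) (N * Real.log N ^ A) f} := by
  have := hr.prob
  have := hr.prob'
  obtain ⟨a1, ha1⟩ := hr.noCut.exists_negl
  obtain ⟨a2, ha2⟩ := hr.noCut'.exists_negl
  choose a3 ha3 using fun i => (hr.stretchedDecay_blkC i).exists_negl
  set a := a1 + a2 + ∑ i, a3 i with ha
  have hN1 := ha1 a (by omega)
  have hN2 := ha2 a (by omega)
  have hN3 := fun i => ha3 i a (by
    have := Finset.single_le_sum (fun j _ => Nat.zero_le (a3 j)) (Finset.mem_univ i)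
    omega)
  refine ⟨a * B + 2, fun C₂ hC => ?_⟩
  have hC' : (1 : ℝ) ≤ C₂ := by exact_mod_cast hC
  have hexp := (negl_exp (c := 1 / (2 * C₂)) (by positivity)).pow_mul (2 * C₂ * (d * 2)) 2
  refine ((hN1.add (hN2.pow_mul (2 * C₂) 2)).add hexp).mono ?_
  have hbias : ∀ᶠ N : ℕ in atTop, ∀ i, (((C₂ * N ^ 2 : ℕ) : ℝ≥0∞) *
      ∫⁻ f in NoCut u K B (lg N ^ a), ‖blkC u i f‖ₑ ∂Q) ≤ 1 := by
    rw [eventually_all]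
    intro i
    filter_upwards [(hN3 i).pow_mul C₂ 2 0] with N hN
    simpa using hN
  filter_upwards [hbias, eventually_ge_atTop 1, tendsto_log_nat.eventually_ge_atTop 1,
    tendsto_log_nat.eventually_ge_atTop (4 * (K + 1) * 2 ^ (a * B + 1))] with N hbias hN hl1 hl2
  have hN' : (1 : ℝ) ≤ N := by exact_mod_cast hN
  have hlg1 : (1 : ℝ) ≤ lg N := hl1.trans (log_le_lg N)
  have hlg1' : 1 ≤ lg N := by exact_mod_cast hlg1
  have hlg2 : (lg N : ℝ) ≤ 2 * Real.log N := by
    have := (Nat.ceil_lt_add_one (by linarith : 0 ≤ Real.log N)).le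
    have : (lg N : ℝ) ≤ Real.log N + 1 := this
    linarith
  set h := lg N ^ a with hh
  set n := C₂ * N ^ 2 with hn
  set r : ℝ := (K + 1) * (h : ℝ) ^ B with hrdef
  have hh1 : 1 ≤ h := Nat.one_le_pow _ _ hlg1'
  have hh1' : (1 : ℝ) ≤ h := by exact_mod_cast hh1
  have hr1 : 1 ≤ r := by
    have h1 : (1 : ℝ) ≤ (h : ℝ) ^ B := one_le_pow₀ hh1'
    have h2 : (1 : ℝ) ≤ K + 1 := by simp
    exact one_le_mul_of_one_le_of_one_le h2 h1
  have hKr : ((K * h ^ B : ℕ) : ℝ) ≤ r := by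
    push_cast
    rw [hrdef]
    gcongr
    simp
  set s : ℝ := N * r * lg N with hsdef
  have hs1 : 1 ≤ s := one_le_mul_of_one_le_of_one_le (one_le_mul_of_one_le_of_one_le hN' hr1) hlg1
  have hb : s + 1 + 2 * r ≤ N * Real.log N ^ (a * B + 2) := by
    have h1 : r ≤ s := by
      have : 1 * r * 1 ≤ N * r * lg N := by gcongr
      linarith
    have h2 : s = N * ((K + 1) * (lg N : ℝ) ^ (a * B + 1)) := by
      rw [hsdef, hrdef, hh]
      push_cast
      ring
    have h3 : (lg N : ℝ) ^ (a * B + 1) ≤ (2 * Real.log N) ^ (a * B + 1) := by gcongr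
    calc s + 1 + 2 * r ≤ 4 * s := by linarith
      _ = N * (4 * (K + 1) * (lg N : ℝ) ^ (a * B + 1)) := by rw [h2]; ring
      _ ≤ N * (4 * (K + 1) * (2 * Real.log N) ^ (a * B + 1)) := by gcongr
      _ = N * (4 * (K + 1) * 2 ^ (a * B + 1) * Real.log N ^ (a * B + 1)) := by ring
      _ ≤ N * (Real.log N * Real.log N ^ (a * B + 1)) := by gcongr
      _ = _ := by ring
  set Bad : Set (Path d) := (⋃ j ∈ Finset.range (n + 1), (nxt u)^[j] ⁻¹' NoCut u K B h) ∪
    ⋃ k ∈ Finset.range (n + 1), ⋃ i ∈ (Finset.univ : Finset (Fin d)),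
      {f | s < |truncSum Q u i r k f|} with hBad
  have hmBad : MeasurableSet Bad := by
    refine MeasurableSet.union (Finset.measurableSet_biUnion _ fun j _ =>
      measurable_iterate_nxt j (measurableSet_noCut u K B h)) (Finset.measurableSet_biUnion _ fun k _ =>
      Finset.measurableSet_biUnion _ fun i _ => ?_)
    exact measurableSet_lt measurable_const (measurable_truncSum i r k).norm
  have hn2 : n + 1 ≤ 2 * C₂ * N ^ 2 := by
    have : 1 ≤ C₂ * N ^ 2 := Nat.one_le_iff_ne_zero.2 (by positivity)
    rw [hn]
    linarith
  have hQBad : Q Bad ≤ ((2 * C₂ * N ^ 2 : ℕ) : ℝ≥0∞) * Q (NoCut u K B h) +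
      ((2 * C₂ * (d * 2) * N ^ 2 : ℕ) : ℝ≥0∞) *
        ENNReal.ofReal (Real.exp (-(1 / (2 * C₂) * Real.log N ^ 2))) := by
    refine (measure_union_le _ _).trans (add_le_add ?_ ?_)
    · refine (measure_biUnion_finset_le _ _).trans ?_
      calc _ = ∑ j ∈ Finset.range (n + 1), Q (NoCut u K B h) :=
            Finset.sum_congr rfl fun j _ => hr.measure_iterate_nxt j (measurableSet_noCut u K B h)
        _ = ((n + 1 : ℕ) : ℝ≥0∞) * Q (NoCut u K B h) := by simp
        _ ≤ _ := by gcongr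
    · set e := ENNReal.ofReal (Real.exp (-(1 / (2 * C₂) * Real.log N ^ 2)))
      have hone : ∀ k ∈ Finset.range (n + 1), ∀ i ∈ (Finset.univ : Finset (Fin d)),
          Q {f | s < |truncSum Q u i r k f|} ≤ 2 * e := by
        intro k hk i _
        refine (hr.measure_truncSum_gt_le i (by linarith) (by linarith)
          (Nat.lt_succ_iff.1 (Finset.mem_range.1 hk))).trans ?_
        refine mul_le_mul_right (ENNReal.ofReal_le_ofReal (Real.exp_le_exp.2 (neg_le_neg ?_))) _
        rw [hsdef, hn]
        push_cast
        have : (N * r * lg N) ^ 2 / (2 * ((C₂ : ℝ) * N ^ 2) * r ^ 2) = 1 / (2 * C₂) * (lg N : ℝ) ^ 2 := by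
          have : (r : ℝ) ≠ 0 := by linarith
          field_simp
        rw [this]
        gcongr
        exact log_le_lg N
      calc _ ≤ ∑ k ∈ Finset.range (n + 1), ∑ i : Fin d, 2 * e := by
            refine (measure_biUnion_finset_le _ _).trans (Finset.sum_le_sum fun k hk => ?_)
            exact (measure_biUnion_finset_le _ _).trans (Finset.sum_le_sum fun i hi => hone k hk i hi)
        _ = ((n + 1 : ℕ) : ℝ≥0∞) * ((d * 2 : ℕ) : ℝ≥0∞) * e := by
            simp only [Finset.sum_const, Finset.card_range, Finset.card_univ, Fintype.card_fin,
              nsmul_eq_mul]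
            push_cast
            ring
        _ ≤ _ := by
            gcongr
            rw [← Nat.cast_mul]
            norm_cast
            calc (n + 1) * (d * 2) ≤ (2 * C₂ * N ^ 2) * (d * 2) := by gcongr
              _ = _ := by ring
  calc μ {f | ¬ Reg u (meanC Q u) n (N * Real.log N ^ (a * B + 2)) f}
      ≤ μ (NoCut u K B h ∪ nxt u ⁻¹' Bad) := by
        refine measure_mono_ae ?_
        filter_upwards [hr.start, hr.steps] with f h0 hst
        refine Not.imp_symm fun hnot => ?_
        have hf1 : f ∉ NoCut u K B h := fun hf => hnot (Or.inl hf)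
        have hf2 : nxt u f ∉ Bad := fun hf => hnot (Or.inr hf)
        have hf3 : ∀ j ≤ n, (nxt u)^[j] (nxt u f) ∉ NoCut u K B h := fun j hj hc =>
          hf2 (Or.inl (Set.mem_biUnion (Finset.mem_coe.2 (Finset.mem_range.2 (by omega))) hc))
        have hf4 : ∀ k ≤ n, ∀ i, |truncSum Q u i r k (nxt u f)| ≤ s := fun k hk i => by
          by_contra hc
          exact hf2 (Or.inr (Set.mem_biUnion (Finset.mem_coe.2 (Finset.mem_range.2 (by omega)))
            (Set.mem_biUnion (Finset.mem_coe.2 (Finset.mem_univ i)) (not_le.1 hc))))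
        refine reg_of_notMem_noCut h0 hst hKr (fun j hj => ?_) (fun k hk i => ?_) hb
        · rcases j with _ | j
          · exact hf1
          · exact hf3 j (by omega)
        · refine abs_disp_sub_le hk hKr (by simp [nxt, tail]) hf3 ?_ (hf4 k hk i)
          have hbi := hbias i
          have h1 := ENNReal.toReal_mono ENNReal.one_ne_top hbi
          rw [ENNReal.toReal_mul, ENNReal.toReal_natCast, ENNReal.toReal_one] at h1
          refine le_trans ?_ h1
          gcongr
          exact hr.abs_integral_trunc_sub_le i hh1 hKr
    _ ≤ _ := by
        refine (measure_union_le _ _).trans ?_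
        rw [IsRenewal.measure_nxt hr.indep hmBad, add_assoc]
        exact add_le_add le_rfl hQBad

end

section
variable {d : ℕ} {μ Q : Measure (Path d)} {u : Site d} {K B : ℕ}

/-! ### The asymptotic direction -/

lemma Negl.exists_frequently_notMem [IsProbabilityMeasure μ] {S : ℕ → Set (Path d)}
    (h : Negl fun N => μ (S N)) : ∀ᵐ f ∂μ, ∃ᶠ N in atTop, f ∉ S N := by
  have : ∀ M : ℕ, ∀ᵐ f ∂μ, ∃ N, M ≤ N ∧ f ∉ S N := by
    intro M
    rw [ae_iff]
    refine le_antisymm (ENNReal.le_of_forall_pos_le_add fun ε hε _ => ?_) zero_le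
    obtain ⟨n, hn⟩ := exists_nat_gt (1 / (ε : ℝ))
    obtain ⟨N, h1, hM, hN⟩ := ((h 1).and ((eventually_ge_atTop M).and (eventually_ge_atTop (n + 1)))).exists
    have hsub : {f | ¬ ∃ N, M ≤ N ∧ f ∉ S N} ⊆ S N := by
      intro f hf
      by_contra hc
      exact hf ⟨N, hM, hc⟩
    refine (measure_mono hsub).trans ?_
    rw [zero_add]
    have hN0 : (N : ℝ≥0∞) ≠ 0 := by
      have : N ≠ 0 := by omega
      exact_mod_cast this
    rw [pow_one, mul_comm, ← ENNReal.le_div_iff_mul_le (Or.inl hN0) (Or.inl (by simp))] at h1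
    refine h1.trans ?_
    rw [ENNReal.div_le_iff_le_mul (Or.inl hN0) (Or.inl (by simp))]
    have hε' : (0 : ℝ) < ε := hε
    rw [div_lt_iff₀ hε'] at hn
    have hle : (n : ℝ) ≤ N := by exact_mod_cast (by omega : n ≤ N)
    have : (1 : ℝ) ≤ ε * N := by nlinarith
    exact_mod_cast this
  filter_upwards [ae_all_iff.2 this] with f hf
  exact frequently_atTop.2 hf

lemma continuous_norm2R : Continuous (norm2R (d := d)) := by
  unfold norm2R
  fun_prop

lemma eq_norm2R_mul (x : Fin d → ℝ) (i : Fin d) : x i = norm2R x * (x i / norm2R x) := by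
  rcases eq_or_ne (norm2R x) 0 with h | h
  · have h1 : x i ^ 2 ≤ 0 := by
      rw [norm2R, Real.sqrt_eq_zero (Finset.sum_nonneg fun i _ => sq_nonneg _)] at h
      rw [← h]
      exact Finset.single_le_sum (f := fun i => x i ^ 2) (fun i _ => sq_nonneg _) (Finset.mem_univ i)
    have : x i = 0 := by nlinarith [sq_nonneg (x i)]
    simp [this]
  · field_simp

lemma norm2R_smul {c : ℝ} (hc : 0 ≤ c) (x : Fin d → ℝ) : norm2R (fun i => c * x i) = c * norm2R x := by
  unfold norm2R
  simp_rw [mul_pow]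
  rw [← Finset.mul_sum, Real.sqrt_mul (by positivity), Real.sqrt_sq hc]

lemma tendsto_log_pow_div (A : ℕ) :
    Tendsto (fun N : ℕ => Real.log N ^ A / N) atTop (nhds 0) := by
  have h2 : Tendsto (fun x : ℝ => Real.log x ^ A / x) atTop (nhds 0) := by
    have := Real.isLittleO_pow_log_id_atTop (n := A)
    exact this.tendsto_div_nhds_zero
  exact h2.comp tendsto_natCast_atTop_atTop

theorem IsRenewal.exists_mean_eq (hr : IsRenewal μ Q u K B) {ϑ : Fin d → ℝ}
    (hϑ : ∀ᵐ f ∂μ, Tendsto (fun n => fun i => toR (f n) i / norm2R (toR (f n))) atTop (nhds ϑ)) :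
    ∃ c : ℝ, 0 < c ∧ ∀ i, meanC Q u i = c * ϑ i := by
  have := hr.prob
  set v := meanC Q u
  obtain ⟨A, hA⟩ := hr.exists_negl_not_reg
  obtain ⟨f, hf, hreg⟩ := (hϑ.and (hA 1 le_rfl).exists_frequently_notMem).exists
  simp only [Set.mem_ofPred_eq, not_not, one_mul] at hreg
  set l := atTop ⊓ 𝓟 {N : ℕ | Reg u v (N ^ 2) (N * Real.log N ^ A) f} with hl
  have : l.NeBot := frequently_mem_iff_neBot.1 hreg
  have hl1 : l ≤ atTop := inf_le_left
  have hmem : ∀ᶠ N in l, Reg u v (N ^ 2) (N * Real.log N ^ A) f := mem_inf_of_right (mem_principal_self _)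
  set T : ℕ → ℕ := fun N => cutSeq u (N ^ 2 + 1) f with hT
  have hTt : Tendsto T l atTop := by
    refine tendsto_atTop.2 fun t0 => ?_
    obtain ⟨M, hM⟩ := ((Finset.range t0).image fun t => lev u (f t)).exists_le
    filter_upwards [hmem, hl1 (eventually_gt_atTop M.toNat)] with N hN hNM
    by_contra hc
    have h1 := hM _ (Finset.mem_image_of_mem _ (Finset.mem_range.2 (not_le.1 hc)))
    have h2 := hN.lev_le
    have h3 : N ≤ N ^ 2 := Nat.le_self_pow (by norm_num) N
    have h4 : ((N ^ 2 : ℕ) : ℤ) ≤ M := h2.trans h1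
    omega
  set x : ℕ → Fin d → ℝ := fun N i => ((N : ℝ) ^ 2)⁻¹ * toR (f (T N)) i with hx
  have hN0 : ∀ᶠ N : ℕ in l, (0 : ℝ) < N := hl1 ((eventually_gt_atTop 0).mono fun N hN => by exact_mod_cast hN)
  have hxv : Tendsto x l (nhds v) := by
    refine tendsto_pi_nhds.2 fun i => ?_
    refine tendsto_iff_norm_sub_tendsto_zero.2 ?_
    refine squeeze_zero' (Eventually.of_forall fun _ => norm_nonneg _) ?_
      ((tendsto_log_pow_div A).mono_left hl1)
    filter_upwards [hmem, hN0] with N hN hN0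
    have h1 := hN.dev i
    have e : x N i - v i = ((N : ℝ) ^ 2)⁻¹ * ((f (T N) i : ℝ) - (N ^ 2 : ℕ) * v i) := by
      simp only [hx, toR]
      push_cast
      field_simp
    rw [e, norm_mul, norm_inv, Real.norm_of_nonneg (by positivity), Real.norm_eq_abs]
    calc _ ≤ ((N : ℝ) ^ 2)⁻¹ * (N * Real.log N ^ A) := by gcongr
      _ = _ := by field_simp
  have hdir : ∀ i, v i = norm2R v * ϑ i := by
    intro i
    have h1 : Tendsto (fun N => x N i) l (nhds (v i)) := (continuous_apply i).continuousAt.tendsto.comp hxv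
    have h2 : Tendsto (fun N => norm2R (x N)) l (nhds (norm2R v)) :=
      continuous_norm2R.continuousAt.tendsto.comp hxv
    have h3 : Tendsto (fun N => toR (f (T N)) i / norm2R (toR (f (T N)))) l (nhds (ϑ i)) :=
      ((continuous_apply i).continuousAt.tendsto.comp hf).comp hTt
    refine tendsto_nhds_unique (h1.congr' ?_) (h2.mul h3)
    filter_upwards [hN0] with N hN0
    rw [eq_norm2R_mul (x N) i]
    congr 1
    simp only [hx]
    rw [norm2R_smul (by positivity), mul_div_mul_left _ _ (by positivity)]
  have hpos : 1 ≤ ∑ i, (u i : ℝ) * v i := by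
    have h1 : Tendsto (fun N => ∑ i, (u i : ℝ) * x N i) l (nhds (∑ i, (u i : ℝ) * v i)) :=
      tendsto_finsetSum _ fun i _ => tendsto_const_nhds.mul
        ((continuous_apply i).continuousAt.tendsto.comp hxv)
    refine ge_of_tendsto h1 ?_
    filter_upwards [hmem, hN0] with N hN hN0
    have h2 := hN.lev_le
    have h3 : ((N ^ 2 : ℕ) : ℝ) ≤ ∑ i, (u i : ℝ) * (f (T N) i : ℝ) := by
      have : ((N ^ 2 : ℕ) : ℤ) ≤ ∑ i, u i * f (T N) i := h2
      exact_mod_cast this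
    have e : ∑ i, (u i : ℝ) * x N i = ((N : ℝ) ^ 2)⁻¹ * ∑ i, (u i : ℝ) * (f (T N) i : ℝ) := by
      rw [Finset.mul_sum]
      refine Finset.sum_congr rfl fun i _ => ?_
      simp only [hx, toR]
      ring
    rw [e, ← div_eq_inv_mul, le_div_iff₀ (by positivity)]
    push_cast at h3
    linarith
  refine ⟨norm2R v, lt_of_le_of_ne (Real.sqrt_nonneg _) fun h0 => ?_, hdir⟩
  have : ∀ i, v i = 0 := fun i => by rw [hdir i, ← h0, zero_mul]
  simp [this] at hpos
  linarith

end

section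
variable {d : ℕ} {P : Measure (Env d)} {Pq : Env d → Site d → Measure (Path d)}

/-! ### From ballisticity in real directions to integer directions -/

/-- An integer vector with nonzero coordinates close to `x`. -/
def roundNe (x : Fin d → ℝ) : Site d := fun i => if ⌊x i⌋ = 0 then 1 else ⌊x i⌋

lemma roundNe_ne_zero (x : Fin d → ℝ) (i : Fin d) : roundNe x i ≠ 0 := by
  unfold roundNe
  split_ifs with h
  · exact one_ne_zero
  · exact h

lemma abs_roundNe_sub_le (x : Fin d → ℝ) (i : Fin d) : |(roundNe x i : ℝ) - x i| ≤ 1 := by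
  have h1 := Int.floor_le (x i)
  have h2 := Int.lt_floor_add_one (x i)
  unfold roundNe
  split_ifs with h
  · rw [h] at h1 h2
    push_cast at *
    rw [abs_le]
    constructor <;> linarith
  · rw [abs_le]
    constructor <;> linarith

/-- A rounded multiple of `ℓ`, possibly shifted by a unit vector. -/
def nearDir (ℓ : Fin d → ℝ) (o : Option (StepIdx d)) (M : ℕ) : Site d :=
  roundNe (fun i => M * ℓ i) - o.elim 0 stepVec

lemma tendsto_nearDir (ℓ : Fin d → ℝ) (o : Option (StepIdx d)) :
    Tendsto (fun M : ℕ => fun i => (M : ℝ)⁻¹ * (nearDir ℓ o M i : ℝ)) atTop (nhds ℓ) := by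
  refine tendsto_pi_nhds.2 fun i => tendsto_iff_norm_sub_tendsto_zero.2 ?_
  refine squeeze_zero' (Eventually.of_forall fun _ => norm_nonneg _) ?_
    (tendsto_const_div_atTop_nhds_zero_nat (2 : ℝ))
  filter_upwards [eventually_gt_atTop 0] with M hM
  have hM' : (0 : ℝ) < M := by exact_mod_cast hM
  have h1 : |((o.elim 0 stepVec : Site d) i : ℝ)| ≤ 1 := by
    rcases o with _ | s
    · simp
    · exact_mod_cast abs_stepVec_le s i
  have h2 := abs_roundNe_sub_le (fun i => M * ℓ i) i
  have e : (M : ℝ)⁻¹ * (nearDir ℓ o M i : ℝ) - ℓ i = (M : ℝ)⁻¹ *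
      ((roundNe (fun i => M * ℓ i) i : ℝ) - M * ℓ i - ((o.elim 0 stepVec : Site d) i : ℝ)) := by
    simp only [nearDir, Pi.sub_apply]
    push_cast
    field_simp
    ring
  rw [e, norm_mul, Real.norm_of_nonneg (by positivity), Real.norm_eq_abs, div_eq_inv_mul]
  gcongr
  rw [abs_le] at *
  constructor <;> linarith

lemma measurableSet_back (w : Site d) (L : ℕ) : MeasurableSet (Back w L) := by
  refine measurableSet_setOfPred.2 ?_
  fun_prop

lemma back_eq {w : Site d} (hw : 0 < norm2R (toR w)) (L : ℕ) :
    Back w L = backtrackEvent (fun i => (norm2R (toR w))⁻¹ * toR w i) (L / norm2R (toR w)) := by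
  set n := norm2R (toR w)
  have e : ∀ x : Site d, dotR x (fun i => n⁻¹ * toR w i) = (lev w x : ℝ) / n := by
    intro x
    simp only [dotR, lev, toR]
    push_cast
    rw [Finset.sum_div]
    refine Finset.sum_congr rfl fun i _ => ?_
    field_simp
  have e' : ∀ x : Site d, dotR x (-fun i => n⁻¹ * toR w i) = -((lev w x : ℝ) / n) := by
    intro x
    rw [← e]
    simp [dotR]
  ext f
  simp only [Back, backtrackEvent, Set.mem_ofPred_eq, e, e', div_lt_div_iff_of_pos_right hw, ← neg_div,
    div_le_div_iff_of_pos_right hw]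
  refine exists_congr fun n => and_congr ?_ ?_
  · rw [le_neg]
    exact_mod_cast Iff.rfl
  · exact forall₂_congr fun m _ => by exact_mod_cast Iff.rfl

lemma eventually_nearDir {ℓ : Fin d → ℝ} (hℓ : norm2R ℓ = 1) {ε : ℝ} (hε : 0 < ε)
    (o : Option (StepIdx d)) : ∀ᶠ M : ℕ in atTop, 0 < norm2R (toR (nearDir ℓ o M)) ∧
      norm2R ((fun i => (norm2R (toR (nearDir ℓ o M)))⁻¹ * toR (nearDir ℓ o M) i) - ℓ) < ε := by
  have h1 := tendsto_nearDir ℓ o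
  have h2 : Tendsto (fun M : ℕ => norm2R fun i => (M : ℝ)⁻¹ * (nearDir ℓ o M i : ℝ)) atTop
      (nhds 1) := by
    rw [← hℓ]
    exact continuous_norm2R.continuousAt.tendsto.comp h1
  have h3 : Tendsto (fun M : ℕ => norm2R ((fun i => (norm2R fun i => (M : ℝ)⁻¹ *
      (nearDir ℓ o M i : ℝ))⁻¹ * ((M : ℝ)⁻¹ * (nearDir ℓ o M i : ℝ))) - ℓ)) atTop (nhds 0) := by
    have h4 : norm2R ((fun i => (1 : ℝ)⁻¹ * ℓ i) - ℓ) = 0 := by simp [norm2R]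
    rw [← h4]
    refine continuous_norm2R.continuousAt.tendsto.comp (Tendsto.sub_const ?_ _)
    refine tendsto_pi_nhds.2 fun i => (h2.inv₀ one_ne_zero).mul ?_
    exact (continuous_apply i).continuousAt.tendsto.comp h1
  filter_upwards [eventually_gt_atTop 0, h2.eventually (lt_mem_nhds one_half_lt_one),
    h3.eventually (gt_mem_nhds hε)] with M hM h4 h5
  have hM' : (0 : ℝ) < (M : ℝ)⁻¹ := by positivity
  have e := norm2R_smul hM'.le (toR (nearDir ℓ o M))
  change norm2R (fun i => (M : ℝ)⁻¹ * (nearDir ℓ o M i : ℝ)) = _ at e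
  rw [e] at h4 h5
  have e2 : (fun i => ((M : ℝ)⁻¹ * norm2R (toR (nearDir ℓ o M)))⁻¹ *
      ((M : ℝ)⁻¹ * (nearDir ℓ o M i : ℝ))) =
      fun i => (norm2R (toR (nearDir ℓ o M)))⁻¹ * toR (nearDir ℓ o M) i := by
    funext i
    rw [mul_inv, toR]
    field_simp
  exact ⟨pos_of_mul_pos_right (lt_trans (by norm_num) h4) hM'.le, e2 ▸ h5⟩

lemma annLaw_back_le (hPq : IsQuenchedFamily Pq) {γ : ℝ} (hγ : 0 < γ) {w : Site d}
    (hw : 0 < norm2R (toR w)) {C : ℝ} (hC : ∀ L : ℝ, 0 < L → ann P Pq 0 (backtrackEvent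
      (fun i => (norm2R (toR w))⁻¹ * toR w i) L) ≤ ENNReal.ofReal (C * Real.exp (-(L ^ γ))))
    {W K : ℝ} (hW : norm2R (toR w) ≤ W) (hK : |C| ≤ K) {L : ℕ} (hL : 1 ≤ L) :
    annLaw P Pq 0 (Back w L) ≤ ENNReal.ofReal (K * Real.exp (-((W ^ γ)⁻¹ * (L : ℝ) ^ γ))) := by
  have hL' : (0 : ℝ) < L := by exact_mod_cast hL
  rw [← ann_eq_annLaw hPq 0 (measurableSet_back _ _), back_eq hw]
  refine (hC _ (div_pos hL' hw)).trans (ENNReal.ofReal_le_ofReal ?_)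
  have h1 : C ≤ K := (le_abs_self _).trans hK
  have h0 : 0 ≤ K := (abs_nonneg _).trans hK
  have h2 : (W ^ γ)⁻¹ * (L : ℝ) ^ γ ≤ ((L : ℝ) / norm2R (toR w)) ^ γ := by
    rw [← div_eq_inv_mul, ← Real.div_rpow hL'.le (hw.le.trans hW)]
    have := hw.trans_le hW
    gcongr
  gcongr

theorem exists_ballistic (hPq : IsQuenchedFamily Pq) (hC : CondP P Pq) :
    ∃ u, Ballistic (annLaw P Pq 0) u := by
  obtain ⟨γ, hγ, -, ℓ₀, hℓ, ε, hε, hT⟩ := hC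
  obtain ⟨M, hM⟩ := (eventually_all.2 fun o => eventually_nearDir hℓ hε o).exists
  have hb := fun o => hT _ (by
    rw [norm2R_smul (inv_nonneg.2 (hM o).1.le), inv_mul_cancel₀ (hM o).1.ne']) (hM o).2
  choose C hC using hb
  have hwW : ∀ o, norm2R (toR (nearDir ℓ₀ o M)) ≤ ∑ o, norm2R (toR (nearDir ℓ₀ o M)) := fun o =>
    Finset.single_le_sum (f := fun o => norm2R (toR (nearDir ℓ₀ o M)))
      (fun o _ => (hM o).1.le) (Finset.mem_univ o)
  have hW := (hM none).1.trans_le (hwW none)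
  have hCK : ∀ o, |C o| ≤ ∑ o, |C o| := fun o =>
    Finset.single_le_sum (f := fun o => |C o|) (fun o _ => abs_nonneg _) (Finset.mem_univ o)
  have hsome : ∀ s, nearDir ℓ₀ (some s) M = nearDir ℓ₀ none M - stepVec s := fun s => by
    simp [nearDir]
  have hne : ∀ o, nearDir ℓ₀ o M ≠ 0 := fun o h0 => (hM o).1.ne' (by
    rw [h0]
    simp [norm2R, toR])
  have key := fun o {L : ℕ} (hL : 1 ≤ L) =>
    annLaw_back_le hPq hγ (hM o).1 (hC o) (hwW o) (hCK o) hL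
  refine ⟨nearDir ℓ₀ none M, fun i => ?_, fun s => hsome s ▸ hne _, γ, hγ, _,
    inv_pos.2 (Real.rpow_pos_of_pos hW γ), _, (abs_nonneg _).trans (hCK none), ?_⟩
  · simpa [nearDir] using roundNe_ne_zero (fun i => M * ℓ₀ i) i
  · rintro _ (rfl | ⟨s, rfl⟩) L hL
    · exact key none hL
    · rw [← hsome]
      exact key (some s) hL

lemma DirSpeed.ae (hPq : IsQuenchedFamily Pq) {ϑ : Fin d → ℝ} (h : DirSpeed P Pq ϑ) :
    ∀ᵐ f ∂annLaw P Pq 0,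
      Tendsto (fun n => fun i => toR (f n) i / norm2R (toR (f n))) atTop (nhds ϑ) := by
  rw [ae_iff, ← ann_eq_annLaw hPq]
  · exact h
  · refine (measurableSet_tendsto_fun (fun n => ?_) measurable_const).compl
    exact (Measurable.of_discrete (f := fun x : Site d => fun i => toR x i / norm2R (toR x))).comp
      (measurable_pi_apply n)

end

section

/-! ### Local estimates for the hitting distribution of a hyperplane -/

lemma tsum_mul_le_lnorm {G : Type*} [AddCommGroup G] (φ : G →+ ℤ) (w q : G → ℝ≥0∞)
    (hq : ∀ a, ∑' g : {g // φ g = a}, q g ≤ 1) : ∑' g, w g * q g ≤ lnorm φ w := by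
  rw [← (Equiv.sigmaFiberEquiv φ).tsum_eq, ENNReal.tsum_sigma']
  refine ENNReal.tsum_le_tsum fun a => ?_
  calc _ ≤ ∑' g : {g // φ g = a}, (⨆ (x : G) (_ : φ x = a), w x) * q g :=
        ENNReal.tsum_le_tsum fun g => mul_le_mul_left
          (le_iSup₂ (f := fun (x : G) (_ : φ x = a) => w x) g.1 g.2) _
    _ ≤ _ := by
        rw [ENNReal.tsum_mul_left]
        exact mul_le_of_le_one_right zero_le (hq a)

variable {d : ℕ} {μ Q : Measure (Path d)} {u : Site d} {K B : ℕ}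

/-- The path first reaches the hyperplane through `X.1` orthogonal to `e₁` from below
at time `X.2` and in the point `X.1`. -/
def Hit (X : Site d × ℤ) : Set (Path d) :=
  {f | ∃ k : ℕ, (k : ℤ) = X.2 ∧ f k = X.1 ∧ ∀ j < k, firstCoord (f j) < firstCoord X.1}

lemma measurableSet_hit (X : Site d × ℤ) : MeasurableSet (Hit X) := by
  refine measurableSet_setOfPred.2 ?_
  have : Measurable (firstCoord (d := d)) := Measurable.of_discrete
  fun_prop

lemma Hit.unique {X Y : Site d × ℤ} (h : fc d X = fc d Y) {f : Path d} (hX : f ∈ Hit X)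
    (hY : f ∈ Hit Y) : X = Y := by
  change firstCoord X.1 = firstCoord Y.1 at h
  obtain ⟨k, hk, hf, hlt⟩ := hX
  obtain ⟨l, hl, hf', hlt'⟩ := hY
  rcases lt_trichotomy k l with hkl | rfl | hkl
  · have := hlt' k hkl
    rw [hf, h] at this
    exact (lt_irrefl _ this).elim
  · exact Prod.ext (hf.symm.trans hf') (hk.symm.trans hl)
  · have := hlt l hkl
    rw [hf', h] at this
    exact (lt_irrefl _ this).elim

lemma tsum_hit_le (Q : Measure (Path d)) [IsProbabilityMeasure Q] (X : Site d × ℤ) (a : ℤ) :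
    ∑' g : {g // fc d g = a}, Q (Hit (X - g)) ≤ 1 := by
  rw [← measure_univ (μ := Q)]
  refine tsum_measure_le_measure_univ (fun g => (measurableSet_hit _).nullMeasurableSet) ?_
  intro g g' hne
  refine (Set.disjoint_left.2 fun f hf hf' => hne ?_).aedisjoint
  have := Hit.unique (by rw [map_sub, map_sub, g.2, g'.2]) hf hf'
  exact Subtype.ext (sub_right_injective this)

lemma conv_hit_le (w : Site d × ℤ → ℝ≥0∞) (Q : Measure (Path d)) [IsProbabilityMeasure Q]
    (X : Site d × ℤ) : conv w (fun x => Q (Hit x)) X ≤ lnorm (fc d) w :=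
  tsum_mul_le_lnorm _ _ _ fun a => tsum_hit_le Q X a

lemma adist_conv_hit_le (w : Site d × ℤ → ℝ≥0∞) (Q : Measure (Path d)) [IsProbabilityMeasure Q]
    (X σ : Site d × ℤ) : adist (conv w (fun x => Q (Hit x)) X)
      (conv w (fun x => Q (Hit x)) (X + σ)) ≤ Nr (fc d) w σ := by
  have e : conv w (fun x => Q (Hit x)) (X + σ) = ∑' g, w (g + σ) * Q (Hit (X - g)) := by
    unfold conv
    rw [← (Equiv.addRight σ).tsum_eq]
    refine tsum_congr fun g => ?_
    rw [Equiv.coe_addRight, add_sub_add_right_eq_sub]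
  rw [e]
  calc _ ≤ ∑' g, adist (w g) (w (g + σ)) * Q (Hit (X - g)) := by
        refine (adist_tsum_le _ _).trans (ENNReal.tsum_le_tsum fun g => ?_)
        rw [mul_comm (w g), mul_comm (w (g + σ)), mul_comm (adist _ _)]
        exact adist_mul_le _ _ _
    _ ≤ Nr (fc d) w (-σ) := by
        refine (tsum_mul_le_lnorm _ _ _ fun a => tsum_hit_le Q X a).trans (le_of_eq ?_)
        simp only [Nr, sub_neg_eq_add]
    _ ≤ _ := nr_neg_le _ _

theorem IsRenewal.exists_bound (h : IsRenewal μ Q u K B) (hd : 0 < d) (hu : ∀ i, u i ≠ 0) :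
    ∃ c : ℝ, 0 < c ∧ ∀ (M : ℕ) (X : Site d × ℤ),
      conv (dispLaw μ Q u ((d + 1) * M)) (fun x => Q (Hit x)) X ≤
        ENNReal.ofReal (1 / √(c * M + 1)) ^ d ∧
      ∀ s, adist (conv (dispLaw μ Q u ((d + 1) * M)) (fun x => Q (Hit x)) X)
        (conv (dispLaw μ Q u ((d + 1) * M)) (fun x => Q (Hit x)) (X + (stepVec s, 1))) ≤
        9 * ENNReal.ofReal (1 / √(c * M + 1)) ^ (d + 1) := by
  have := h.prob
  have := h.prob'
  obtain ⟨c, hc, hb⟩ := (h.hasAtoms hu).exists_bound hd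
  refine ⟨c, hc, fun M X => ?_⟩
  obtain ⟨h1, h2⟩ := hb dirac0 M tsum_dirac0.le
  refine ⟨(conv_hit_le _ _ _).trans ((lnorm_conv_le _ _).trans ?_), fun s =>
    (adist_conv_hit_le _ _ _ _).trans ((nr_conv_le _ _ _).trans ?_)⟩
  · rwa [tsum_blkLaw, one_mul]
  · rw [tsum_blkLaw, one_mul]
    exact h2 s

lemma hit_iff {f : Path d} (h0 : f 0 = 0) {X : Site d × ℤ} {n : ℕ}
    (hX : ∀ t ≤ cutSeq u n f, firstCoord (f t) < firstCoord X.1) :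
    (nxt u)^[n] f ∈ Hit (X - disp u n f) ↔ f ∈ Hit X := by
  have hsub : ∀ x y : Site d, firstCoord (x - y) = firstCoord x - firstCoord y := fun x y =>
    map_sub (fc d) (x, 0) (y, 0)
  rw [iterate_nxt n h0]
  constructor
  · rintro ⟨k, hk, hf, hlt⟩
    simp only [disp, tail, h0, Prod.fst_sub, Prod.snd_sub, hsub, sub_zero, sub_left_inj,
      sub_lt_sub_iff_right] at hk hf hlt
    refine ⟨cutSeq u n f + k, by push_cast; omega, hf, fun j hj => ?_⟩
    rcases le_or_gt j (cutSeq u n f) with hj' | hj'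
    · exact hX j hj'
    · simpa [Nat.add_sub_cancel' hj'.le] using hlt (j - cutSeq u n f) (by omega)
  · rintro ⟨k, hk, hf, hlt⟩
    have hk' : cutSeq u n f < k := by
      by_contra hle
      have := hX k (not_lt.1 hle)
      rw [hf] at this
      exact lt_irrefl _ this
    refine ⟨k - cutSeq u n f, ?_, ?_, fun j hj => ?_⟩
    · simp only [disp, Prod.snd_sub]
      omega
    · simp [disp, tail, h0, Nat.add_sub_cancel' hk'.le, hf]
    · simp only [disp, tail, h0, Prod.fst_sub, hsub, sub_zero, sub_lt_sub_iff_right]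
      exact hlt _ (by omega)

end

section
variable {d : ℕ}

/-! ### Exit from the parallelogram -/

lemma exitEvent_singleton (A : Set (Site d)) (x : Site d) (m : ℕ) :
    exitEvent A {x} {m} = {f | f m = x ∧ x ∈ A ∧ ∀ j < m, f j ∉ A} := by
  ext f
  simp only [exitEvent, hits, hitTime, Set.mem_singleton_iff, Set.mem_ofPred_eq]
  constructor
  · rintro ⟨hh, hx, rfl⟩
    exact ⟨hx, hx ▸ Nat.sInf_mem hh, fun j hj => Nat.notMem_of_lt_sInf hj⟩
  · rintro ⟨rfl, hx, hj⟩
    have e : sInf {n | f n ∈ A} = m := le_antisymm (Nat.sInf_le hx)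
      (le_csInf ⟨m, hx⟩ fun j hjA => not_lt.1 fun hlt => hj j hlt hjA)
    exact ⟨⟨m, hx⟩, by rw [e], e⟩

lemma norm1_stepVec (s : StepIdx d) : norm1 (stepVec s) = 1 := by
  rw [norm1, Finset.sum_eq_single s.1]
  · cases h : s.2 <;> simp [stepVec, h]
  · intro i _ hi
    simp [stepVec, hi]
  · simp

lemma exists_stepVec_of_norm1 {x : Site d} (hx : norm1 x = 1) : ∃ s, x = stepVec s := by
  have hne : ∃ i, x i ≠ 0 := by
    by_contra h
    push Not at h
    simp [norm1, h] at hx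
  obtain ⟨i, hi⟩ := hne
  rw [norm1, ← Finset.add_sum_erase _ _ (Finset.mem_univ i)] at hx
  have h0 : 0 ≤ ∑ j ∈ Finset.univ.erase i, |x j| := Finset.sum_nonneg fun _ _ => abs_nonneg _
  have h1 : 1 ≤ |x i| := Int.one_le_abs hi
  have h2 : ∑ j ∈ Finset.univ.erase i, |x j| = 0 := by omega
  have h3 : |x i| = 1 := by omega
  rw [Finset.sum_eq_zero_iff_of_nonneg fun _ _ => abs_nonneg _] at h2
  have h4 : ∀ j ≠ i, x j = 0 := fun j hj => abs_eq_zero.1 (h2 j (by simp [hj]))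
  rcases (abs_eq one_pos.le).1 h3 with h | h
  · refine ⟨(i, true), funext fun j => ?_⟩
    by_cases hj : j = i
    · simp [stepVec, hj, h]
    · simp [stepVec, hj, h4 j hj]
  · refine ⟨(i, false), funext fun j => ?_⟩
    by_cases hj : j = i
    · simp [stepVec, hj, h]
    · simp [stepVec, hj, h4 j hj]

lemma firstCoord_add (x y : Site d) : firstCoord (x + y) = firstCoord x + firstCoord y :=
  map_add (fc d) (x, 0) (y, 0)

lemma firstCoord_sub (x y : Site d) : firstCoord (x - y) = firstCoord x - firstCoord y :=
  map_sub (fc d) (x, 0) (y, 0)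

lemma firstCoord_stepVec_le (s : StepIdx d) : |firstCoord (stepVec s)| ≤ 1 := by
  rw [firstCoord]
  split_ifs
  · exact abs_stepVec_le s _
  · simp

/-- The first passage of a nearest neighbour path above level `L`. -/
lemma exists_first_passage {f : Path d} (h0 : f 0 = 0)
    (hs : ∀ k, ∃ s, f (k + 1) = f k + stepVec s) {L : ℤ} (hL : 0 < L) {T : ℕ}
    (hT : L ≤ firstCoord (f T)) : ∃ t, t < T ∧ firstCoord (f (t + 1)) = L ∧
      ∀ j ≤ t, firstCoord (f j) < L := by
  have hex : ∃ t, L ≤ firstCoord (f t) := ⟨T, hT⟩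
  have hlt : ∀ j < Nat.find hex, firstCoord (f j) < L := fun j hj => not_le.1 (Nat.find_min hex hj)
  have hsp := Nat.find_spec hex
  have hle : Nat.find hex ≤ T := Nat.find_min' hex hT
  rcases hn : Nat.find hex with _ | t
  · rw [hn, h0] at hsp
    have : firstCoord (0 : Site d) = 0 := map_zero (fc d)
    omega
  · rw [hn] at hsp hlt hle
    refine ⟨t, hle, le_antisymm ?_ hsp, fun j hj => hlt j (by omega)⟩
    obtain ⟨s, hs⟩ := hs t
    have h1 := hlt t (by omega)
    have h2 := (abs_le.1 (firstCoord_stepVec_le s)).2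
    rw [hs, firstCoord_add]
    omega

/-- The transversal deviation of `x` from the line spanned by `ϑ`. -/
def slope (ϑ : Fin d → ℝ) (x : Site d) (i : Fin d) : ℝ :=
  (x i : ℝ) - (firstCoord x : ℝ) / firstCoordR ϑ * ϑ i

lemma slope_add (ϑ : Fin d → ℝ) (x y : Site d) (i : Fin d) :
    slope ϑ (x + y) i = slope ϑ x i + slope ϑ y i := by
  simp only [slope, firstCoord_add, Pi.add_apply]
  push_cast
  ring

lemma abs_slope_le {ϑ : Fin d → ℝ} (hϑ : 0 < firstCoordR ϑ) (x : Site d) {a b : ℝ}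
    (hx : ∀ i, |(x i : ℝ) - a * ϑ i| ≤ b) (i : Fin d) :
    |slope ϑ x i| ≤ b * (1 + |ϑ i| / firstCoordR ϑ) := by
  have h0 : |(firstCoord x : ℝ) - a * firstCoordR ϑ| ≤ b := by
    rw [firstCoord, firstCoordR, dif_pos i.pos, dif_pos i.pos]
    exact hx _
  have e : slope ϑ x i = ((x i : ℝ) - a * ϑ i) -
      ((firstCoord x : ℝ) - a * firstCoordR ϑ) * (ϑ i / firstCoordR ϑ) := by
    rw [slope]
    field_simp
    ring
  rw [e]
  refine (abs_sub _ _).trans ?_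
  rw [mul_add, mul_one, abs_mul, abs_div, abs_of_pos hϑ]
  gcongr
  exact hx i

theorem exit_iff_hit {ϑ : Fin d → ℝ} (hϑ : 0 < firstCoordR ϑ) {u : Site d} {v : Fin d → ℝ} {c : ℝ}
    (hc : 0 < c) (hv : ∀ i, v i = c * ϑ i) {n : ℕ} {b : ℝ} {f : Path d} (hR : Reg u v n b f)
    {z₁ w x : Site d} {N : ℕ} (hx : firstCoord (x - z₁) = (N : ℤ) ^ 2)
    (hw : firstCoord (w - z₁) < (N : ℤ) ^ 2)
    (hw0 : -(N : ℝ) ^ 2 < firstCoord (w - z₁) - b)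
    (hw1 : (N : ℝ) ^ 2 - firstCoord (w - z₁) ≤ n * (c * firstCoordR ϑ) - b)
    (hw2 : ∀ i, |slope ϑ (w - z₁) i| + b * (1 + |ϑ i| / firstCoordR ϑ) < N * (Rk 5 N : ℝ)) (m : ℕ) :
    (fun k => f k + w) ∈ exitEvent (paraBdry ϑ z₁ N) {x} {m} ↔ f ∈ Hit (x - w, (m : ℤ)) := by
  have hd : 0 < d := by
    by_contra h
    simp [firstCoordR, h] at hϑ
  have hfc : ∀ x : Site d, firstCoord x = x ⟨0, hd⟩ := fun x => firstCoord_eq rfl x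
  have hv0 : v ⟨0, hd⟩ = c * firstCoordR ϑ := by rw [hv, firstCoordR, dif_pos hd]
  have hL : firstCoord (x - w) = (N : ℤ) ^ 2 - firstCoord (w - z₁) := by
    rw [← hx, ← firstCoord_sub]
    congr 1
    abel
  have hcross : firstCoord (x - w) ≤ firstCoord (f (cutSeq u (n + 1) f)) := by
    have h1 := (abs_le.1 (hR.dev ⟨0, hd⟩)).1
    rw [hv0, ← hfc (f _)] at h1
    rw [hL]
    have : ((N : ℝ) ^ 2 - firstCoord (w - z₁)) ≤ (firstCoord (f (cutSeq u (n + 1) f)) : ℝ) := by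
      linarith
    exact_mod_cast this
  obtain ⟨t, htT, ht, hlt⟩ := exists_first_passage hR.start hR.steps (L := firstCoord (x - w))
    (by omega) hcross
  have hpara : ∀ j ≤ t, f j + w ∈ para ϑ z₁ N := by
    intro j hj
    obtain ⟨k, -, hk⟩ := hR.dev_le n le_rfl j (by omega)
    have e : f j + w - z₁ = f j + (w - z₁) := by abel
    refine ⟨?_, fun i => ?_⟩
    · have h1 := (abs_le.1 (hk ⟨0, hd⟩)).1
      rw [hv0, ← hfc (f _)] at h1
      have h2 : 0 ≤ (k : ℝ) * (c * firstCoordR ϑ) := by positivity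
      have h3 : (-(N : ℝ) ^ 2) < firstCoord (f j) + firstCoord (w - z₁) := by linarith
      have h4 := hlt j hj
      rw [e, firstCoord_add, abs_lt]
      constructor
      · exact_mod_cast h3
      · omega
    · change |slope ϑ (f j + w - z₁) i| < _
      rw [e, slope_add]
      have h1 := abs_slope_le hϑ (f j) (a := k * c) (b := b)
        (fun i => by rw [mul_assoc, ← hv]; exact hk i) i
      have := abs_add_le (slope ϑ (f j) i) (slope ϑ (w - z₁) i)
      have := hw2 i
      linarith
  have hnot : ∀ y : Site d, firstCoord y = firstCoord (x - w) → y + w ∉ para ϑ z₁ N := by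
    intro y hy h
    have h1 := (abs_lt.1 h.1).2
    have e : y + w - z₁ = y + (w - z₁) := by abel
    rw [e, firstCoord_add, hy, hL] at h1
    omega
  have hbdry : f (t + 1) + w ∈ paraBdry ϑ z₁ N := by
    refine ⟨hnot _ ht, f t + w, hpara t le_rfl, ?_⟩
    obtain ⟨s, hs⟩ := hR.steps t
    rw [hs, ← norm1_stepVec s]
    congr 1
    abel
  rw [exitEvent_singleton]
  constructor
  · rintro ⟨h1, h2, h3⟩
    have hm : m = t + 1 := by
      rcases lt_trichotomy m (t + 1) with h | h | h
      · rw [← h1] at h2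
        exact (h2.1 (hpara m (by omega))).elim
      · exact h
      · exact (h3 _ h hbdry).elim
    subst hm
    exact ⟨t + 1, rfl, eq_sub_of_add_eq h1, fun j hj => hlt j (by omega)⟩
  · rintro ⟨k, hk, h1, h2⟩
    obtain rfl : k = m := Int.ofNat_inj.1 hk
    have hm : k = t + 1 := by
      rcases lt_trichotomy k (t + 1) with h | h | h
      · have := hlt k (by omega)
        rw [h1] at this
        exact (lt_irrefl _ this).elim
      · exact h
      · exact ((h2 _ h).ne ht).elim
    subst hm
    have h3 : f (t + 1) + w = x := by rw [h1, sub_add_cancel]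
    exact ⟨h3, h3 ▸ hbdry, fun j hj hb => hb.1 (hpara j (by omega))⟩

end

section
variable {d : ℕ}

/-! ### The comparison for large boxes -/

lemma eventually_lt_mul_Rk (A : ℕ) (D : ℝ) :
    ∀ᶠ N : ℕ in atTop, D * (N * Real.log N ^ A + 1) < N * (Rk 5 N : ℝ) := by
  filter_upwards [eventually_ge_atTop 1, tendsto_log_nat.eventually_ge_atTop 1,
    tendsto_log_nat.eventually_gt_atTop (2 * |D| + 1),
    (Real.tendsto_log_atTop.comp tendsto_log_nat).eventually_ge_atTop ((A : ℝ) + 1)] with N h1 h2 h3 h4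
  have hN : (1 : ℝ) ≤ N := by exact_mod_cast h1
  simp only [Function.comp_apply] at h4
  set ℓ := Real.log (N : ℝ) with hℓ
  have hA : (0 : ℝ) ≤ A := Nat.cast_nonneg A
  have hpow : (A + 1 : ℝ) * Real.log ℓ ≤ Real.log ℓ ^ (5 + 1) := by
    have h5 : (1 : ℝ) ≤ Real.log ℓ := by linarith
    have h6 : Real.log ℓ ≤ Real.log ℓ ^ 5 := le_self_pow₀ h5 (by norm_num)
    rw [pow_succ]
    gcongr
    linarith
  have hexp : ℓ ^ (A + 1) ≤ Real.exp (Real.log ℓ ^ (5 + 1)) := by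
    refine le_trans (le_of_eq ?_) (Real.exp_le_exp.2 hpow)
    have := Real.exp_nat_mul (Real.log ℓ) (A + 1)
    rw [Real.exp_log (by linarith)] at this
    rw [← this]
    push_cast
    rfl
  have hR : ℓ ^ (A + 1) - 1 < (Rk 5 N : ℝ) := by
    have := Nat.lt_floor_add_one (Real.exp (Real.log ℓ ^ (5 + 1)))
    rw [Rk]
    linarith
  have hℓA : 1 ≤ ℓ ^ A := one_le_pow₀ h2
  have hD := le_abs_self D
  have hD0 := abs_nonneg D
  calc D * (N * ℓ ^ A + 1) ≤ |D| * (N * ℓ ^ A + N * ℓ ^ A) := by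
        have : 1 ≤ N * ℓ ^ A := one_le_mul_of_one_le_of_one_le hN hℓA
        gcongr
    _ = N * (ℓ ^ A * (2 * |D|)) := by ring
    _ ≤ N * (ℓ ^ (A + 1) - 1) := by
        rw [pow_succ]
        gcongr
        nlinarith
    _ < _ := by gcongr

lemma eventually_le_sq (A : ℕ) :
    ∀ᶠ N : ℕ in atTop, 4 * (N * Real.log N ^ A + 1) ≤ (N : ℝ) ^ 2 := by
  filter_upwards [eventually_ge_atTop 3, (tendsto_log_pow_div A).eventually
    (gt_mem_nhds (show (0 : ℝ) < 1 / 8 by norm_num))] with N h1 h2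
  have hN : (3 : ℝ) ≤ N := by exact_mod_cast h1
  rw [div_lt_iff₀ (by linarith)] at h2
  nlinarith

lemma adist_measure_le {μ : Measure (Path d)} {S S' T : Set (Path d)}
    (h : ∀ f ∉ T, f ∈ S ↔ f ∈ S') : adist (μ S) (μ S') ≤ 2 * μ T := by
  have key : ∀ {S S' : Set (Path d)}, (∀ f ∉ T, f ∈ S → f ∈ S') → μ S - μ S' ≤ μ T := by
    intro S S' h
    rw [tsub_le_iff_left]
    refine (measure_mono fun f hf => ?_).trans (measure_union_le _ _)
    by_cases hT : f ∈ T
    · exact Or.inr hT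
    · exact Or.inl (h f hT hf)
  rw [two_mul]
  exact add_le_add (key fun f hf => (h f hf).1) (key fun f hf => (h f hf).2)

variable {P : Measure (Env d)} {Pq : Env d → Site d → Measure (Path d)}

lemma measurableSet_exitEvent (A : Set (Site d)) (x : Site d) (m : ℕ) :
    MeasurableSet (exitEvent A {x} {m}) := by
  rw [exitEvent_singleton]
  refine measurableSet_setOfPred.2 ?_
  have : Measurable fun y => y ∈ A := Measurable.of_discrete
  fun_prop

lemma ann_exitEvent (hPq : IsQuenchedFamily Pq) (hIID : IsIID P) (A : Set (Site d)) (w x : Site d)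
    (m : ℕ) : ann P Pq w (exitEvent A {x} {m}) =
      annLaw P Pq 0 {f | (fun k => f k + w) ∈ exitEvent A {x} {m}} := by
  have hm : Measurable fun (f : Path d) k => f k + w :=
    measurable_pi_lambda _ fun k => (measurable_pi_apply k).add_const _
  rw [ann_eq_annLaw hPq w (measurableSet_exitEvent A x m)]
  refine Eq.trans ?_ (annLaw_translate hPq hIID w (hm (measurableSet_exitEvent A x m)))
  congr 1
  ext f
  simp

/-- The exit distribution of the parallelogram is close to a convolution with the law of
the position after many renewals. -/
theorem IsRenewal.exists_adist_exit_le (hPq : IsQuenchedFamily Pq) (hIID : IsIID P)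
    {Q : Measure (Path d)} {u : Site d} {K B : ℕ} (hr : IsRenewal (annLaw P Pq 0) Q u K B)
    {ϑ : Fin d → ℝ} (hϑ : 0 < firstCoordR ϑ) {c : ℝ} (hc : 0 < c) (hv : ∀ i, meanC Q u i = c * ϑ i) :
    ∃ k₀ : ℕ, 0 < k₀ ∧ ∃ G, Negl G ∧ ∀ᶠ N : ℕ in atTop, ∀ z₁ w x : Site d, ∀ m : ℕ,
      3 * |firstCoord (w - z₁)| ≤ (N : ℤ) ^ 2 + 3 →
      (∀ i, 3 * |slope ϑ (w - z₁) i| ≤ N * (Rk 5 N : ℝ) + 3 * (1 + |ϑ i| / firstCoordR ϑ)) →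
      firstCoord (x - z₁) = (N : ℤ) ^ 2 →
      adist (ann P Pq w (exitEvent (paraBdry ϑ z₁ N) {x} {m}))
        (conv (dispLaw (annLaw P Pq 0) Q u ((d + 1) * (N ^ 2 / k₀))) (fun x => Q (Hit x))
          (x - w, (m : ℤ))) ≤ 2 * G N := by
  have hd : 0 < d := by
    by_contra h
    simp [firstCoordR, h] at hϑ
  obtain ⟨A, hA⟩ := hr.exists_negl_not_reg
  set v₀ := c * firstCoordR ϑ with hv₀
  have hv₀p : 0 < v₀ := mul_pos hc hϑ
  obtain ⟨k₀, hk₀⟩ := exists_nat_ge (4 * (d + 1) * v₀ + 1)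
  obtain ⟨C₂, hC₂⟩ := exists_nat_ge (2 / v₀ + (d + 1))
  have hC₂d : d + 1 ≤ C₂ := by
    have : (0 : ℝ) < 2 / v₀ := by positivity
    have : ((d + 1 : ℕ) : ℝ) ≤ C₂ := by push_cast; linarith
    exact_mod_cast this
  have hC₂v : 2 ≤ C₂ * v₀ := by
    rw [← div_le_iff₀ hv₀p]
    have : (0 : ℝ) ≤ d := Nat.cast_nonneg d
    linarith
  have hk₀p : (0 : ℝ) < k₀ := by
    have : 0 < 4 * ((d : ℝ) + 1) * v₀ := by positivity
    linarith
  refine ⟨k₀, by exact_mod_cast hk₀p, _, hA C₂ (by omega), ?_⟩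
  filter_upwards [eventually_ge_atTop 1, eventually_le_sq A,
    eventually_all.2 fun i : Fin d => eventually_lt_mul_Rk A (3 / 2 * (1 + |ϑ i| / firstCoordR ϑ))]
    with N hN hsq hRk z₁ w x m hw hws hx
  set b := (N : ℝ) * Real.log N ^ A with hb
  have hN1 : (1 : ℝ) ≤ N := by exact_mod_cast hN
  have hb0 : 0 ≤ b := mul_nonneg (by linarith) (pow_nonneg (Real.log_nonneg hN1) _)
  have hwR : 3 * |(firstCoord (w - z₁) : ℝ)| ≤ (N : ℝ) ^ 2 + 3 := by exact_mod_cast hw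
  have hw' := abs_le.1 (le_div_iff₀' (by norm_num : (0 : ℝ) < 3) |>.2 hwR)
  have hL : (firstCoord (x - w) : ℝ) = (N : ℝ) ^ 2 - firstCoord (w - z₁) := by
    have : firstCoord (x - w) = firstCoord (x - z₁) - firstCoord (w - z₁) := by
      rw [← firstCoord_sub]
      congr 1
      abel
    rw [this, hx]
    push_cast
    ring
  have hM : ((d + 1 : ℕ) : ℝ) * ((N ^ 2 / k₀ : ℕ) : ℝ) * v₀ ≤ (N : ℝ) ^ 2 / 4 := by
    have h1 : ((N ^ 2 / k₀ : ℕ) : ℝ) ≤ (N : ℝ) ^ 2 / k₀ := by exact_mod_cast Nat.cast_div_le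
    have h2 : ((N ^ 2 / k₀ : ℕ) : ℝ) * (4 * (d + 1) * v₀) ≤ (N : ℝ) ^ 2 / k₀ * k₀ := by
      gcongr
      linarith
    rw [div_mul_cancel₀ _ hk₀p.ne'] at h2
    push_cast
    linarith
  have hMn : (d + 1) * (N ^ 2 / k₀) ≤ C₂ * N ^ 2 :=
    Nat.mul_le_mul hC₂d (Nat.div_le_self _ _)
  rw [ann_exitEvent hPq hIID, ← hr.measure_conv _ measurableSet_hit]
  refine adist_measure_le fun f hf => ?_
  have hR : Reg u (meanC Q u) (C₂ * N ^ 2) b f := not_not.1 hf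
  refine (exit_iff_hit hϑ hc hv hR hx ?_ ?_ ?_ (fun i => ?_) m).trans (hit_iff hR.start ?_).symm
  · have : (firstCoord (w - z₁) : ℝ) < (N : ℝ) ^ 2 := by linarith
    exact_mod_cast this
  · linarith
  · push_cast
    have : 2 * (N : ℝ) ^ 2 ≤ C₂ * v₀ * (N : ℝ) ^ 2 := by gcongr
    rw [← hv₀]
    linarith
  · have h1 := hws i
    have h2 := hRk i
    linarith
  · intro t ht
    obtain ⟨k, hk, hdev⟩ := hR.dev_le _ hMn t ht
    have h1 := (abs_le.1 (hdev ⟨0, hd⟩)).2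
    have h2 : meanC Q u ⟨0, hd⟩ = v₀ := by rw [hv, hv₀, firstCoordR, dif_pos hd]
    rw [h2, ← firstCoord_eq (i := ⟨0, hd⟩) rfl (f t)] at h1
    have h3 : (k : ℝ) * v₀ ≤ ((d + 1 : ℕ) : ℝ) * ((N ^ 2 / k₀ : ℕ) : ℝ) * v₀ := by
      gcongr
      exact_mod_cast hk
    have h4 : (firstCoord (f t) : ℝ) < firstCoord (x - w) := by
      rw [hL]
      linarith
    exact_mod_cast h4

lemma abs_toReal_sub_le {a b : ℝ≥0∞} (ha : a ≠ ∞) (hb : b ≠ ∞) {r : ℝ} (hr : 0 ≤ r)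
    (h : adist a b ≤ ENNReal.ofReal r) : |a.toReal - b.toReal| ≤ r := by
  have key : ∀ {a b : ℝ≥0∞}, b ≠ ∞ → adist a b ≤ ENNReal.ofReal r → a.toReal ≤ b.toReal + r := by
    intro a b hb h
    have h1 := (le_add_adist a b).trans (add_le_add_right h b)
    have h2 := ENNReal.toReal_mono (by finiteness) h1
    rwa [ENNReal.toReal_add hb (by finiteness), ENNReal.toReal_ofReal hr] at h2
  have h1 := key hb h
  have h2 := key ha (adist_comm a b ▸ h)
  rw [abs_le]
  constructor <;> linarith

lemma exists_one_div_sqrt_le {c : ℝ} (hc : 0 < c) {k₀ : ℕ} (hk₀ : 0 < k₀) :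
    ∃ κ : ℝ, 0 < κ ∧ ∀ N : ℕ, 0 < N → 1 / √(c * ((N ^ 2 / k₀ : ℕ) : ℝ) + 1) ≤ κ / N := by
  have hk : (0 : ℝ) < k₀ := by exact_mod_cast hk₀
  have hm : 0 < min c 1 / k₀ := div_pos (lt_min hc one_pos) hk
  refine ⟨1 / √(min c 1 / k₀), by positivity, fun N hN => ?_⟩
  have hN' : (0 : ℝ) < N := by exact_mod_cast hN
  rw [div_div]
  refine one_div_le_one_div_of_le (by positivity) (Real.le_sqrt_of_sq_le ?_)
  rw [mul_pow, Real.sq_sqrt hm.le]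
  have h1 : (N : ℝ) ^ 2 / k₀ ≤ ((N ^ 2 / k₀ : ℕ) : ℝ) + 1 := by
    rw [div_le_iff₀ hk]
    have := Nat.lt_div_mul_add (a := N ^ 2) hk₀
    have h2 : N ^ 2 ≤ (N ^ 2 / k₀ + 1) * k₀ := by rw [add_mul, one_mul]; exact this.le
    exact_mod_cast h2
  calc min c 1 / k₀ * (N : ℝ) ^ 2 = min c 1 * ((N : ℝ) ^ 2 / k₀) := by ring
    _ ≤ min c 1 * (((N ^ 2 / k₀ : ℕ) : ℝ) + 1) := by
        have := lt_min hc one_pos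
        gcongr
    _ ≤ _ := by
        rw [mul_add, mul_one]
        gcongr
        · exact min_le_left _ _
        · exact min_le_right _ _

end

/-- Annealed derivative estimates for the exit point and exit time
of the parallelogram `𝒫(z₁,N)`. -/
theorem statement8 (d : ℕ) (hd : 4 ≤ d)
    (P : Measure (Env d)) [IsProbabilityMeasure P]
    (Pq : Env d → Site d → Measure (Path d)) (hPq : IsQuenchedFamily Pq)
    (hUE : UniformlyElliptic P) (hIID : IsIID P) (hCond : CondP P Pq)
    (ϑ : Fin d → ℝ) (hϑu : norm2R ϑ = 1) (hϑ : DirSpeed P Pq ϑ)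
    (hϑ1 : 0 < firstCoordR ϑ) :
    ∃ C : ℝ, 0 < C ∧ ∃ N₀ : ℕ, ∀ N : ℕ, N₀ ≤ N → ∀ z₁ : Site d, ∀ z ∈ paraMid ϑ z₁ N,
      (∀ m : ℕ, ∀ x ∈ paraBdryPlus ϑ z₁ N,
        (ann P Pq z (exitEvent (paraBdry ϑ z₁ N) {x} {m})).toReal
          < C * (N : ℝ) ^ (-(d : ℝ))) ∧
      (∀ m : ℕ, ∀ x ∈ paraBdryPlus ϑ z₁ N, ∀ y ∈ paraBdryPlus ϑ z₁ N, norm1 (x - y) = 1 →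
        |(ann P Pq z (exitEvent (paraBdry ϑ z₁ N) {x} {m})).toReal -
          (ann P Pq z (exitEvent (paraBdry ϑ z₁ N) {y} {m + 1})).toReal|
          < C * (N : ℝ) ^ (-(d : ℝ) - 1)) ∧
      (∀ m : ℕ, ∀ x ∈ paraBdryPlus ϑ z₁ N, ∀ j : Fin d,
        |(ann P Pq z (exitEvent (paraBdry ϑ z₁ N) {x} {m})).toReal -
          (ann P Pq (z + stepVec (j, true))
            (exitEvent (paraBdry ϑ z₁ N) {x} {m + 1})).toReal|
          < C * (N : ℝ) ^ (-(d : ℝ) - 1)) := by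
  have hd0 : 0 < d := by omega
  obtain ⟨u, hB⟩ := exists_ballistic hPq hCond
  obtain ⟨η, hann⟩ := isAnnealed_annLaw hPq hUE hIID
  have hu0 : u ≠ 0 := fun h => hB.ne_zero ⟨0, hd0⟩ (by simp [h])
  obtain ⟨Q, K, B, hr⟩ := hann.isRenewal hB hu0
  obtain ⟨c, hc, hv⟩ := hr.exists_mean_eq (DirSpeed.ae hPq hϑ)
  obtain ⟨k₀, hk₀, G, hG, hex⟩ := hr.exists_adist_exit_le hPq hIID hϑ1 hc hv
  obtain ⟨c', hc', hbd⟩ := hr.exists_bound hd0 hB.ne_zero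
  obtain ⟨κ, hκ, hκN⟩ := exists_one_div_sqrt_le hc' hk₀
  refine ⟨κ ^ d + 9 * κ ^ (d + 1) + 5, by positivity, ?_⟩
  obtain ⟨N₀, hN₀⟩ := eventually_atTop.1 (hex.and ((hG (d + 1)).and (eventually_gt_atTop 0)))
  refine ⟨N₀, fun N hN z₁ z hz => ?_⟩
  obtain ⟨hex, hGN, hNpos⟩ := hN₀ N hN
  have hNR : (1 : ℝ) ≤ N := by exact_mod_cast hNpos
  have hGN' : G N ≤ ENNReal.ofReal (1 / (N : ℝ) ^ (d + 1)) := by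
    have hpow : ENNReal.ofReal ((N : ℝ) ^ (d + 1)) = (N : ℝ≥0∞) ^ (d + 1) := by
      rw [ENNReal.ofReal_pow (by positivity), ENNReal.ofReal_natCast]
    rw [ENNReal.ofReal_div_of_pos (by positivity), ENNReal.ofReal_one, hpow,
      ENNReal.le_div_iff_mul_le (by left; positivity) (by left; finiteness), mul_comm]
    exact hGN
  have hrho : ∀ p, ENNReal.ofReal (1 / √(c' * ((N ^ 2 / k₀ : ℕ) : ℝ) + 1)) ^ p ≤
      ENNReal.ofReal (κ ^ p / (N : ℝ) ^ p) := by
    intro p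
    rw [← div_pow, ENNReal.ofReal_pow (by positivity)]
    exact pow_le_pow_left' (ENNReal.ofReal_le_ofReal (hκN N hNpos)) p
  have hfin : ∀ w A, ann P Pq w A ≠ ∞ := by
    intro w A
    refine ((lintegral_mono fun ω => ?_).trans_lt (?_ : ∫⁻ _, 1 ∂P < ∞)).ne
    · have := (hPq.1 ω w).1
      exact prob_le_one
    · simp
  have e1 : (N : ℝ) ^ (-(d : ℝ)) = 1 / (N : ℝ) ^ d := by
    rw [Real.rpow_neg (by positivity), Real.rpow_natCast, one_div]
  have e2 : (N : ℝ) ^ (-(d : ℝ) - 1) = 1 / (N : ℝ) ^ (d + 1) := by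
    rw [← neg_add', Real.rpow_neg (by positivity), ← Nat.cast_add_one, Real.rpow_natCast, one_div]
  have hpd : (0 : ℝ) < 1 / (N : ℝ) ^ (d + 1) := by positivity
  have hpd' : 1 / (N : ℝ) ^ (d + 1) ≤ 1 / (N : ℝ) ^ d := by
    gcongr
    omega
  have hslope : ∀ i, 3 * |slope ϑ (z - z₁) i| ≤ N * (Rk 5 N : ℝ) := fun i => (hz.2 i).le
  have hD : ∀ i, 0 ≤ |ϑ i| / firstCoordR ϑ := fun i => by positivity
  have hstep : ∀ s i, |slope ϑ (stepVec s) i| ≤ 1 + |ϑ i| / firstCoordR ϑ := by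
    intro s i
    have := abs_slope_le hϑ1 (stepVec s) (a := 0) (b := 1) (fun i => by
      rw [zero_mul, sub_zero]
      exact_mod_cast abs_stepVec_le s i) i
    rwa [one_mul] at this
  have hcmp := fun x (hx : x ∈ paraBdryPlus ϑ z₁ N) m =>
    hex z₁ z x m (by have := hz.1; omega) (fun i => by
      have := hslope i
      have := hD i
      linarith) hx.2
  have hcmp' := fun x (hx : x ∈ paraBdryPlus ϑ z₁ N) m j =>
    hex z₁ (z + stepVec (j, true)) x m (by
      have h1 := hz.1
      have h2 := firstCoord_stepVec_le (j, true)
      have h3 := abs_add_le (firstCoord (z - z₁)) (firstCoord (stepVec (j, true)))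
      rw [add_sub_right_comm, firstCoord_add]
      omega) (fun i => by
      have h1 := hslope i
      have h2 := hstep (j, true) i
      have h3 := abs_add_le (slope ϑ (z - z₁) i) (slope ϑ (stepVec (j, true)) i)
      rw [add_sub_right_comm, slope_add]
      linarith) hx.2
  -- Two exit probabilities whose comparison convolutions differ by a unit space-time step.
  have hdiff : ∀ {a b : ℝ≥0∞} (X : Site d × ℤ) (s : StepIdx d), a ≠ ∞ → b ≠ ∞ →
      adist a (conv (dispLaw (annLaw P Pq 0) Q u ((d + 1) * (N ^ 2 / k₀)))
        (fun x => Q (Hit x)) X) ≤ 2 * G N →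
      adist b (conv (dispLaw (annLaw P Pq 0) Q u ((d + 1) * (N ^ 2 / k₀)))
        (fun x => Q (Hit x)) (X + (stepVec s, 1))) ≤ 2 * G N →
      |a.toReal - b.toReal| < (κ ^ d + 9 * κ ^ (d + 1) + 5) * (N : ℝ) ^ (-(d : ℝ) - 1) := by
    intro a b X s ha hb h1 h2
    have h3 : adist a b ≤ ENNReal.ofReal ((9 * κ ^ (d + 1) + 4) * (1 / (N : ℝ) ^ (d + 1))) := by
      rw [adist_comm] at h2
      refine (adist_triangle a _ b).trans ((add_le_add h1 ((adist_triangle _ _ b).trans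
        (add_le_add ((hbd _ X).2 s) h2))).trans ?_)
      calc _ ≤ 2 * ENNReal.ofReal (1 / (N : ℝ) ^ (d + 1)) +
            (9 * ENNReal.ofReal (κ ^ (d + 1) / (N : ℝ) ^ (d + 1)) +
              2 * ENNReal.ofReal (1 / (N : ℝ) ^ (d + 1))) := by
            gcongr 2 * ?_ + (9 * ?_ + 2 * ?_)
            exact hrho _
        _ = _ := by
            rw [← ENNReal.ofReal_ofNat 2, ← ENNReal.ofReal_ofNat 9,
              ← ENNReal.ofReal_mul (by positivity), ← ENNReal.ofReal_mul (by positivity),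
              ← ENNReal.ofReal_add (by positivity) (by positivity),
              ← ENNReal.ofReal_add (by positivity) (by positivity)]
            congr 1
            ring
    refine (abs_toReal_sub_le ha hb (by positivity) h3).trans_lt ?_
    rw [e2]
    have : 0 < κ ^ d := by positivity
    exact mul_lt_mul_of_pos_right (by linarith) (by positivity)
  refine ⟨fun m x hx => ?_, fun m x hx y hy hxy => ?_, fun m x hx j => ?_⟩
  · have h1 : ann P Pq z (exitEvent (paraBdry ϑ z₁ N) {x} {m}) ≤
        ENNReal.ofReal ((κ ^ d + 2) * (1 / (N : ℝ) ^ d)) := by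
      refine (le_add_adist _ _).trans ((add_le_add (hbd _ _).1 (hcmp x hx m)).trans ?_)
      calc _ ≤ ENNReal.ofReal (κ ^ d / (N : ℝ) ^ d) + 2 * ENNReal.ofReal (1 / (N : ℝ) ^ d) := by
            gcongr
            · exact hrho d
            · exact hGN'.trans (ENNReal.ofReal_le_ofReal hpd')
        _ = _ := by
            rw [← ENNReal.ofReal_ofNat 2, ← ENNReal.ofReal_mul (by positivity),
              ← ENNReal.ofReal_add (by positivity) (by positivity)]
            congr 1
            ring
    refine (ENNReal.toReal_le_of_le_ofReal (by positivity) h1).trans_lt ?_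
    rw [e1]
    have : 0 < κ ^ (d + 1) := by positivity
    exact mul_lt_mul_of_pos_right (by linarith) (by positivity)
  · obtain ⟨s, hs⟩ := exists_stepVec_of_norm1 hxy
    obtain ⟨s', hs'⟩ : ∃ s', y = x + stepVec s' :=
      ⟨(s.1, !s.2), by rw [stepVec_not, ← hs]; abel⟩
    refine hdiff _ s' (hfin _ _) (hfin _ _) (hcmp x hx m) ?_
    have e : ((x - z, (m : ℤ)) + (stepVec s', 1) : Site d × ℤ) = (y - z, ((m + 1 : ℕ) : ℤ)) := by
      rw [Prod.mk_add_mk, hs', sub_add_eq_add_sub]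
      push_cast
      rfl
    rw [e]
    exact hcmp y hy (m + 1)
  · refine hdiff _ (j, false) (hfin _ _) (hfin _ _) (hcmp x hx m) ?_
    have e : ((x - z, (m : ℤ)) + (stepVec (j, false), 1) : Site d × ℤ) =
        (x - (z + stepVec (j, true)), ((m + 1 : ℕ) : ℤ)) := by
      have hn : stepVec (j, false) = -stepVec (j, true) := stepVec_not (j, true)
      rw [Prod.mk_add_mk, hn, ← sub_eq_add_neg, sub_sub]
      push_cast
      rfl
    rw [e]
    exact hcmp' x hx (m + 1) j

end RWRE
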